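/- Let n ≥ 2, p > 1, and let Ω ⊂ ℝⁿ be a strongly convex bounded open set with boundary of class C². Then there exist constants M > 0, β ∈ (0,1) and ε₀ > 0, all independent of ε, such that for every ε ∈ (0, ε₀) and every normalized minimizer u_ε of the ε-regularized problem, one has |u_ε(x)| ≤ M for all x ∈ cl Ω and |u_ε(x) − u_ε(y)| ≤ M ‖x − y‖^β for all x, y ∈ cl Ω. -/

import Mathlib

open MeasureTheory Real Set Metric Bornology
open scoped RealInnerProductSpace Pointwise NNReal Topology

noncomputable def gaussianMeasure (n : ℕ) : Measure (EuclideanSpace ℝ (Fin n)) :=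
  (volume : Measure (EuclideanSpace ℝ (Fin n))).withDensity
    (fun x => ENNReal.ofReal ((2 * π) ^ (-(n : ℝ) / 2) * Real.exp (-‖x‖ ^ 2 / 2)))

/-- `φ` is a smooth compactly supported test function on `Ω`. -/
def IsTestFun (n : ℕ) (Ω : Set (EuclideanSpace ℝ (Fin n)))
    (φ : EuclideanSpace ℝ (Fin n) → ℝ) : Prop :=
  ContDiff ℝ (⊤ : ℕ∞) φ ∧ HasCompactSupport φ ∧ tsupport φ ⊆ Ω

/-- The first eigenvalue of the Gaussian-weighted `p`-Laplacian on `Ω`. -/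
noncomputable def lambdaPGamma (n : ℕ) (p : ℝ) (Ω : Set (EuclideanSpace ℝ (Fin n))) : ℝ :=
  sInf { r : ℝ | ∃ v : EuclideanSpace ℝ (Fin n) → ℝ, IsTestFun n Ω v ∧ v ≠ 0 ∧
    r = (∫ x in Ω, ‖gradient v x‖ ^ p ∂(gaussianMeasure n)) /
        (∫ x in Ω, |v x| ^ p ∂(gaussianMeasure n)) }

/-- `Ω` has boundary of class `C²`. -/
def HasC2Boundary (n : ℕ) (Ω : Set (EuclideanSpace ℝ (Fin n))) : Prop :=
  ∀ x ∈ frontier Ω, ∃ (U : Set (EuclideanSpace ℝ (Fin n))) (f : EuclideanSpace ℝ (Fin n) → ℝ),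
    IsOpen U ∧ x ∈ U ∧ ContDiff ℝ 2 f ∧ (∀ y ∈ U, (y ∈ Ω ↔ f y < 0)) ∧
    (∀ y ∈ U, y ∈ frontier Ω → fderiv ℝ f y ≠ 0)

/-- The regularized functional `J_ε(v) = ∫_Ω (ε v² + ‖∇v‖²)^{p/2} dγ`. -/
noncomputable def Jeps (n : ℕ) (p ε : ℝ) (Ω : Set (EuclideanSpace ℝ (Fin n)))
    (v : EuclideanSpace ℝ (Fin n) → ℝ) : ℝ :=
  ∫ x in Ω, (ε * v x ^ 2 + ‖gradient v x‖ ^ 2) ^ (p / 2) ∂(gaussianMeasure n)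

/-- The infimum of the regularized functional over normalized test functions. -/
noncomputable def lambdaEps (n : ℕ) (p ε : ℝ) (Ω : Set (EuclideanSpace ℝ (Fin n))) : ℝ :=
  sInf { r : ℝ | ∃ v : EuclideanSpace ℝ (Fin n) → ℝ, IsTestFun n Ω v ∧
    (∫ x in Ω, |v x| ^ p ∂(gaussianMeasure n)) = 1 ∧ r = Jeps n p ε Ω v }

/-- A normalized minimizer of the `ε`-regularized problem. -/
def IsNormalizedMinimizer (n : ℕ) (p ε : ℝ) (Ω : Set (EuclideanSpace ℝ (Fin n)))
    (uε : EuclideanSpace ℝ (Fin n) → ℝ) : Prop :=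
  ContinuousOn uε (closure Ω) ∧ ContDiffOn ℝ 1 uε Ω ∧
  (∀ x ∈ closure Ω, 0 ≤ uε x) ∧ (∀ x ∈ frontier Ω, uε x = 0) ∧
  (∫ x in Ω, uε x ^ p ∂(gaussianMeasure n)) = 1 ∧
  Jeps n p ε Ω uε = lambdaEps n p ε Ω


section PA
variable {F : Type*} [NormedAddCommGroup F] [InnerProductSpace ℝ F]

lemma rpow_two_mul_self {p x : ℝ} (hp : 1 < p) (hx : 0 ≤ x) : x ^ (p - 2) * x = x ^ (p - 1) := by
  rcases hx.eq_or_lt with h | h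
  · subst h; rw [zero_rpow (by linarith : p - 1 ≠ 0)]; simp
  · rw [show p - 1 = (p - 2) + 1 by ring, rpow_add h, rpow_one]

lemma rpow_one_mul_self {p x : ℝ} (hp : 1 < p) (hx : 0 ≤ x) : x ^ (p - 1) * x = x ^ p := by
  rcases hx.eq_or_lt with h | h
  · subst h; rw [zero_rpow (by linarith : p ≠ 0)]; simp
  · rw [show p = (p - 1) + 1 by ring, rpow_add h, rpow_one]; simp

lemma rpow_two_mul_sq {p x : ℝ} (hp : 1 < p) (hx : 0 ≤ x) : x ^ (p - 2) * x ^ 2 = x ^ p := by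
  rw [← rpow_one_mul_self hp hx, ← rpow_two_mul_self hp hx]; ring

lemma scal1 {p α β : ℝ} (hp : 1 < p) (hα : 0 < α) (hβ : 0 ≤ β) (h : β ≤ α) :
    min 1 (p - 1) * (α ^ (p - 2) * (α - β)) ≤ α ^ (p - 2) * α - β ^ (p - 2) * β := by
  have hx0 : 0 ≤ β / α := by positivity
  have hx1 : β / α ≤ 1 := (div_le_one hα).2 h
  have key : min 1 (p - 1) * (1 - β / α) ≤ 1 - (β / α) ^ (p - 1) := by
    rcases le_total p 2 with h2 | h2
    · have := rpow_one_add_le_one_add_mul_self (s := β / α - 1) (by linarith) (p := p - 1)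
        (by linarith) (by linarith)
      rw [min_eq_right (by linarith)]
      rw [show 1 + (β / α - 1) = β / α by ring] at this
      nlinarith
    · rw [min_eq_left (by linarith)]
      have := rpow_le_rpow_of_exponent_ge_of_imp hx0 hx1 (by linarith : (1:ℝ) ≤ p - 1)
        (by intro _ h; linarith)
      rw [rpow_one] at this
      linarith
  have e1 : α ^ (p - 2) * (α - β) = α ^ (p - 1) * (1 - β / α) := by
    rw [← rpow_two_mul_self hp hα.le]; field_simp
  have e2 : α ^ (p - 2) * α - β ^ (p - 2) * β = α ^ (p - 1) * (1 - (β / α) ^ (p - 1)) := by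
    rw [rpow_two_mul_self hp hα.le, rpow_two_mul_self hp hβ, div_rpow hβ hα.le]
    have : α ^ (p - 1) ≠ 0 := (rpow_pos_of_pos hα _).ne'
    field_simp
  rw [e1, e2]
  have := mul_le_mul_of_nonneg_left key (rpow_nonneg hα.le (p - 1))
  nlinarith

lemma scal2 {p α β : ℝ} (hα : 0 < α) (hβ : 0 ≤ β) (h : β ≤ α) :
    min 1 (2 ^ (-(p - 2)) : ℝ) * (α + β) ^ (p - 2) ≤ α ^ (p - 2) := by
  rcases le_total p 2 with h2 | h2
  · calc _ ≤ 1 * (α + β) ^ (p - 2) := by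
          gcongr
          exact min_le_left _ _
      _ ≤ _ := by
          rw [one_mul]
          exact rpow_le_rpow_of_nonpos hα (by linarith) (by linarith)
  · calc _ ≤ 2 ^ (-(p - 2)) * (α + β) ^ (p - 2) := by
          gcongr
          exact min_le_right _ _
      _ = ((α + β) / 2) ^ (p - 2) := by
          rw [div_rpow (by linarith) (by norm_num), rpow_neg (by norm_num)]; field_simp
      _ ≤ _ := by
          apply rpow_le_rpow (by linarith) (by linarith) (by linarith)

/-- the monotonicity quantity -/
noncomputable def mon (p : ℝ) (a b : F) : ℝ :=
  ⟪‖a‖ ^ (p - 2) • a - ‖b‖ ^ (p - 2) • b, a - b⟫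

noncomputable def kap (p : ℝ) : ℝ := min 1 (p - 1) * min 1 (2 ^ (-(p - 2)) : ℝ) / 2

lemma kap_pos {p : ℝ} (hp : 1 < p) : 0 < kap p := by
  unfold kap
  have : 0 < min 1 (p - 1) := lt_min one_pos (by linarith)
  have : 0 < min 1 (2 ^ (-(p - 2)) : ℝ) := lt_min one_pos (by positivity)
  positivity

lemma mon_symm (p : ℝ) (a b : F) : mon p a b = mon p b a := by
  unfold mon
  rw [← neg_sub b a, ← neg_sub (‖b‖ ^ (p - 2) • b), inner_neg_neg]

lemma mon_lower {p : ℝ} (hp : 1 < p) (a b : F) :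
    kap p * ((‖a‖ + ‖b‖) ^ (p - 2) * ‖a - b‖ ^ 2) ≤ mon p a b := by
  wlog h : ‖b‖ ≤ ‖a‖ generalizing a b
  · have := this b a (le_of_not_ge h)
    rw [mon_symm, norm_sub_rev, add_comm]; exact this
  rcases (norm_nonneg a).eq_or_lt with h0 | h0
  · have ha : a = 0 := norm_eq_zero.1 h0.symm
    have hb : b = 0 := norm_eq_zero.1 (le_antisymm (by rw [h0]; exact h) (norm_nonneg b))
    subst ha; subst hb; simp [mon]
  have s1 := scal1 hp h0 (norm_nonneg b) h
  have s2 := scal2 (p := p) h0 (norm_nonneg b) h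
  have hcs : ⟪a, b⟫ ≤ ‖a‖ * ‖b‖ := real_inner_le_norm a b
  have e1 : mon p a b = (‖a‖ ^ (p - 2) * ‖a‖ - ‖b‖ ^ (p - 2) * ‖b‖) * (‖a‖ - ‖b‖)
      + (‖a‖ ^ (p - 2) + ‖b‖ ^ (p - 2)) * (‖a‖ * ‖b‖ - ⟪a, b⟫) := by
    unfold mon
    simp only [inner_sub_left, inner_sub_right, real_inner_smul_left, real_inner_self_eq_norm_sq,
      real_inner_comm a b]
    ring
  have e2 : ‖a - b‖ ^ 2 = (‖a‖ - ‖b‖) ^ 2 + 2 * (‖a‖ * ‖b‖ - ⟪a, b⟫) := by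
    rw [norm_sub_sq_real]; ring
  rw [e1, e2]
  unfold kap
  set c0 := min 1 (p - 1)
  set c1 := min 1 (2 ^ (-(p - 2)) : ℝ)
  have hc0 : 0 < c0 := lt_min one_pos (by linarith)
  have hc01 : c0 ≤ 1 := min_le_left _ _
  have hc1 : 0 < c1 := lt_min one_pos (by positivity)
  set y := (‖a‖ + ‖b‖) ^ (p - 2)
  set z := ‖a‖ ^ (p - 2)
  have hy : 0 ≤ y := by positivity
  have hz : 0 ≤ z := by positivity
  have hb : 0 ≤ ‖b‖ ^ (p - 2) := by positivity
  set q := ‖a‖ * ‖b‖ - ⟪a, b⟫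
  have hq : 0 ≤ q := by simp only [q]; linarith
  set δ := ‖a‖ - ‖b‖
  have hδ : 0 ≤ δ := by simp only [δ]; linarith
  have t1 : c0 * (c1 * y) * δ ^ 2 ≤ (z * ‖a‖ - ‖b‖ ^ (p - 2) * ‖b‖) * δ := by
    calc _ ≤ c0 * z * δ ^ 2 := by gcongr
      _ = (c0 * (z * δ)) * δ := by ring
      _ ≤ _ := by gcongr
  have t2 : c0 * (c1 * y) * q ≤ (z + ‖b‖ ^ (p - 2)) * q := by
    gcongr
    nlinarith [mul_nonneg hc1.le hy]
  have t3 : 0 ≤ c0 * (c1 * y) * δ ^ 2 := by positivity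
  nlinarith

lemma mon_nonneg {p : ℝ} (hp : 1 < p) (a b : F) : 0 ≤ mon p a b :=
  le_trans (mul_nonneg (kap_pos hp).le (by positivity)) (mon_lower hp a b)

lemma mon_young {p : ℝ} (hp : 1 < p) {t : ℝ} (ht : 0 < t) (a b : F) :
    (‖a‖ + ‖b‖) ^ (p - 1) * ‖a - b‖ ≤
      t * (‖a‖ + ‖b‖) ^ p + (kap p)⁻¹ * (t⁻¹ * mon p a b) := by
  have hS : 0 ≤ ‖a‖ + ‖b‖ := by positivity
  have h1 := mon_lower hp a b
  rw [← rpow_two_mul_sq hp hS, ← rpow_two_mul_self hp hS]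
  set S := ‖a‖ + ‖b‖
  set y := S ^ (p - 2)
  have hy : 0 ≤ y := by positivity
  set d := ‖a - b‖
  have hk := kap_pos hp
  have h2 : y * d ^ 2 ≤ (kap p)⁻¹ * mon p a b := by
    rw [le_inv_mul_iff₀ hk]; exact h1
  have h3 : t⁻¹ * (y * d ^ 2) ≤ t⁻¹ * ((kap p)⁻¹ * mon p a b) := by gcongr
  have h4 : S * d ≤ t * S ^ 2 + t⁻¹ * d ^ 2 := by
    have : 0 ≤ t⁻¹ * ((t * S - d) ^ 2 + t * S * d) := by positivity
    have e : t⁻¹ * ((t * S - d) ^ 2 + t * S * d) = t * S ^ 2 + t⁻¹ * d ^ 2 - S * d := by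
      field_simp; ring
    linarith
  have h5 := mul_le_mul_of_nonneg_left h4 hy
  calc y * S * d = y * (S * d) := by ring
    _ ≤ _ := h5
    _ = t * (y * S ^ 2) + t⁻¹ * (y * d ^ 2) := by ring
    _ ≤ _ := by
      rw [show (kap p)⁻¹ * (t⁻¹ * mon p a b) = t⁻¹ * ((kap p)⁻¹ * mon p a b) by ring]
      linarith

lemma rpow_young {p t S : ℝ} (hp : 1 < p) (ht : 0 < t) (hS : 0 ≤ S) :
    S ^ (p - 1) ≤ t * S ^ p + t ^ (-(p - 1)) := by
  have e0 : 0 ≤ t * S ^ p := by positivity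
  have e1 : 0 ≤ t ^ (-(p-1)) := by positivity
  rcases le_total (t⁻¹) S with h | h
  · have : 1 ≤ t * S := by rwa [inv_le_iff_one_le_mul₀' ht] at h
    rw [← rpow_one_mul_self hp hS] at *
    have h3 : 0 ≤ S ^ (p-1) := by positivity
    nlinarith
  · have := rpow_le_rpow hS h (by linarith : 0 ≤ p - 1)
    rw [inv_rpow ht.le, ← rpow_neg ht.le] at this
    linarith
end PA

lemma iter_lemma {p ν C : ℝ} (hp : 1 < p) (hν : 0 < ν) (hC : 1 ≤ C) :
    ∃ β r0 : ℝ, 0 < β ∧ β < 1 ∧ 0 < r0 ∧ r0 ≤ 1 ∧ ∀ r : ℝ, 0 < r → r ≤ r0 →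
      ∀ a X : ℕ → ℝ, (∀ j, 0 ≤ a j) → (∀ j, 0 ≤ X j) → X 0 ≤ C → a 0 ≤ C * (r * (r ^ β)⁻¹) →
      (∀ j : ℕ, ∀ t : ℝ, 0 < t → t ≤ 1 →
        X (j + 1) ≤ C * 32 ^ j * ((r ^ β)⁻¹) ^ 5 * (t * X j + t ^ (1 - 2 * p) * a j)) →
      (∀ j : ℕ, ∀ t : ℝ, 0 < t → t ≤ 1 →
        a (j + 1) ≤ (C * 32 ^ j * ((r ^ β)⁻¹) ^ 5 * (t * X j + t ^ (1 - 2 * p) * a j)) ^ (1 + ν)) →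
      Filter.Tendsto a Filter.atTop (𝓝 0) := by
  have hp0 : 0 < p := by linarith
  set σ : ℝ := 32 ^ (-(2 * p / ν)) with hσ
  have hσ0 : 0 < σ := by positivity
  have hσ1 : σ < 1 := rpow_lt_one_of_one_lt_of_neg (by norm_num) (by
    have : 0 < 2 * p / ν := by positivity
    linarith)
  have hσν : σ ^ ν = 32 ^ (-(2 * p)) := by
    rw [hσ, ← rpow_mul (by norm_num)]; congr 1; field_simp
  set β : ℝ := ν / (4 * p * (6 * ν + 10 * p)) with hβ
  have hβ0 : 0 < β := by positivity
  have hβ1 : β < 1 := by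
    rw [hβ, div_lt_one (by positivity)]; nlinarith
  set C1 := 32 * C with hC1
  have hC10 : 1 ≤ C1 := by linarith
  have hC1p : 0 < C1 := by linarith
  set c3 : ℝ := C1 * (σ / (2 * C1)) ^ (1 - 2 * p) * (2 * C ^ 2) ^ ν with hc3
  have hc30 : 0 < c3 := by positivity
  set r0 : ℝ := min 1 ((σ / 2 / c3) ^ (4 * p / ν)) with hr0
  have hr00 : 0 < r0 := lt_min one_pos (by positivity)
  refine ⟨β, r0, hβ0, hβ1, hr00, min_le_left _ _, ?_⟩
  intro r hr hrr a X ha hX hX0 ha0 hXs has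
  have hr1 : r ≤ 1 := hrr.trans (min_le_left _ _)
  set d := r ^ β with hd
  have hd0 : 0 < d := by positivity
  have hd1 : d ≤ 1 := rpow_le_one hr.le hr1 hβ0.le
  set A : ℝ := 2 * C ^ 2 * (d⁻¹) ^ 6 * r ^ (1 / (2 * p)) with hA
  have hA0 : 0 < A := by positivity
  have hdi : 1 ≤ d⁻¹ := (one_le_inv₀ hd0).2 hd1
  -- first step
  have first : C * 32 ^ 0 * (d⁻¹) ^ 5 * (r ^ (1 / (2 * p)) * X 0 + (r ^ (1 / (2 * p))) ^ (1 - 2 * p) * a 0) ≤ A := by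
    have e1 : (r ^ (1 / (2 * p))) ^ (1 - 2 * p) * r = r ^ (1 / (2 * p)) := by
      rw [← rpow_mul hr.le]
      nth_rewrite 2 [← rpow_one r]
      rw [← rpow_add hr]
      congr 1; field_simp; ring
    have e2 : (r ^ (1 / (2 * p))) ^ (1 - 2 * p) * a 0 ≤ C * d⁻¹ * r ^ (1 / (2 * p)) := by
      calc _ ≤ (r ^ (1 / (2 * p))) ^ (1 - 2 * p) * (C * (r * d⁻¹)) := by gcongr
        _ = C * d⁻¹ * ((r ^ (1 / (2 * p))) ^ (1 - 2 * p) * r) := by ring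
        _ = _ := by rw [e1]
    have e3 : r ^ (1 / (2 * p)) * X 0 ≤ C * d⁻¹ * r ^ (1 / (2 * p)) := by
      calc _ ≤ r ^ (1 / (2 * p)) * (C * d⁻¹) := by
            gcongr; nlinarith
        _ = _ := by ring
    calc _ ≤ C * 32 ^ 0 * (d⁻¹) ^ 5 * (C * d⁻¹ * r ^ (1 / (2 * p)) + C * d⁻¹ * r ^ (1 / (2 * p))) := by
          gcongr
      _ = A := by rw [hA]; ring
  have ht1 : r ^ (1 / (2 * p)) ≤ 1 := rpow_le_one hr.le hr1 (by positivity)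
  -- t_j and B_j
  let t : ℕ → ℝ := fun j => σ * d ^ 5 / (2 * C1) * ((32 : ℝ)⁻¹) ^ j
  let B : ℕ → ℝ := fun j => A * σ ^ j
  have ht0 : ∀ j, 0 < t j := fun j => by positivity
  have htle : ∀ j, t j ≤ 1 := by
    intro j
    have h1 : ((32 : ℝ)⁻¹) ^ j ≤ 1 := pow_le_one₀ (by norm_num) (by norm_num)
    have h2 : d ^ 5 ≤ 1 := pow_le_one₀ hd0.le hd1
    have h3 : σ * d ^ 5 / (2 * C1) ≤ 1 := by
      rw [div_le_one (by positivity)]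
      nlinarith [pow_pos hd0 5]
    exact mul_le_one₀ h3 (by positivity) h1
  have hB0 : ∀ j, 0 < B j := fun j => by positivity
  let Y : ℕ → ℝ := fun j => C1 * 32 ^ j * (d⁻¹) ^ 5 * (t j) ^ (1 - 2 * p) * (B j) ^ ν
  have hYs : ∀ j, Y (j + 1) = Y j := by
    intro j
    have e1 : t (j + 1) = t j * (32 : ℝ)⁻¹ := by simp only [t]; ring
    have e2 : B (j + 1) = B j * σ := by simp only [B]; ring
    simp only [Y]
    have e3 : ((32 : ℝ)⁻¹) ^ (1 - 2 * p) = 32 ^ (-(1 - 2 * p)) := by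
      rw [inv_rpow (by norm_num), rpow_neg (by norm_num)]
    rw [e1, e2, mul_rpow (ht0 j).le (by norm_num), mul_rpow (hB0 j).le hσ0.le, hσν, e3]
    have : (32 : ℝ) ^ (-(1 - 2 * p)) * 32 ^ (-(2 * p)) * 32 = 1 := by
      nth_rewrite 3 [← rpow_one (32 : ℝ)]
      rw [← rpow_add (by norm_num), ← rpow_add (by norm_num)]
      ring_nf; simp
    rw [pow_succ]
    linear_combination (C1 * 32 ^ j * (d⁻¹) ^ 5 * (t j) ^ (1 - 2 * p) * (B j) ^ ν) * this
  have hY0 : Y 0 ≤ σ / 2 := by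
    have e : Y 0 = c3 * r ^ (ν / (4 * p)) := by
      simp only [Y, t, B, pow_zero, mul_one]
      rw [show σ * d ^ 5 / (2 * C1) = (σ / (2 * C1)) * d ^ 5 by ring,
        mul_rpow (by positivity) (by positivity), hA,
        mul_rpow (by positivity) (by positivity), mul_rpow (by positivity) (by positivity), hc3]
      have : (d⁻¹) ^ 5 * (d ^ 5) ^ (1 - 2 * p) * (((d⁻¹) ^ 6) ^ ν * (r ^ (1 / (2 * p))) ^ ν)
          = r ^ (ν / (4 * p)) := by
        rw [hd]
        simp only [← rpow_natCast, ← rpow_neg hr.le, ← rpow_mul hr.le, ← rpow_add hr]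
        congr 1
        push_cast
        have hβ2 : β * (6 * ν + 10 * p) = ν / (4 * p) := by rw [hβ]; field_simp
        have : 1 / (2 * p) * ν = 2 * (ν / (4 * p)) := by field_simp; ring
        rw [this]
        linear_combination (-1) * hβ2
      rw [← this]; ring
    rw [e]
    have h1 : r ^ (ν / (4 * p)) ≤ σ / 2 / c3 := by
      calc _ ≤ ((σ / 2 / c3) ^ (4 * p / ν)) ^ (ν / (4 * p)) :=
            rpow_le_rpow hr.le (hrr.trans (min_le_right _ _)) (by positivity)
        _ = _ := by
          rw [← rpow_mul (by positivity)]
          rw [show 4 * p / ν * (ν / (4 * p)) = 1 by field_simp, rpow_one]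
    rw [le_div_iff₀ hc30] at h1
    linarith
  have hY : ∀ j, Y j ≤ σ / 2 := by
    intro j
    induction j with
    | zero => exact hY0
    | succ j ih => rw [hYs]; exact ih
  have claim : ∀ j, X (j + 1) ≤ B j ∧ a (j + 1) ≤ (B j) ^ (1 + ν) := by
    intro j
    induction j with
    | zero =>
      have hB : B 0 = A := by simp [B]
      rw [hB]
      have hn : 0 ≤ C * 32 ^ 0 * (d⁻¹) ^ 5 * (r ^ (1 / (2 * p)) * X 0 + (r ^ (1 / (2 * p))) ^ (1 - 2 * p) * a 0) := by
        have := hX 0; have := ha 0; positivity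
      exact ⟨(hXs 0 _ (by positivity) ht1).trans first, (has 0 _ (by positivity) ht1).trans
        (rpow_le_rpow hn first (by linarith))⟩
    | succ j ih =>
      have key : C * 32 ^ (j + 1) * (d⁻¹) ^ 5 * (t j * X (j + 1) + (t j) ^ (1 - 2 * p) * a (j + 1)) ≤ B (j + 1) := by
        have htj := ht0 j
        have hBj := hB0 j
        calc _ ≤ C * 32 ^ (j + 1) * (d⁻¹) ^ 5 * (t j * B j + (t j) ^ (1 - 2 * p) * (B j) ^ (1 + ν)) := by
              gcongr
              exacts [ih.1, ih.2]
          _ = (C1 * 32 ^ j * (d⁻¹) ^ 5 * t j) * B j + Y j * B j := by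
              rw [rpow_add hBj, rpow_one]; simp only [Y, hC1]; ring
          _ ≤ σ / 2 * B j + σ / 2 * B j := by
              gcongr ?_ * _ + ?_ * _
              · apply le_of_eq
                simp only [t]
                rw [inv_pow, inv_pow]
                field_simp
              · exact hY j
          _ = B (j + 1) := by simp only [B]; ring
      have hn : 0 ≤ C * 32 ^ (j + 1) * (d⁻¹) ^ 5 * (t j * X (j + 1) + (t j) ^ (1 - 2 * p) * a (j + 1)) := by
        have := hX (j + 1); have := ha (j + 1); have := ht0 j; positivity
      exact ⟨(hXs (j + 1) _ (ht0 j) (htle j)).trans key, (has (j + 1) _ (ht0 j) (htle j)).trans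
        (rpow_le_rpow hn key (by linarith))⟩
  have lim : Filter.Tendsto (fun j => (B j) ^ (1 + ν)) Filter.atTop (𝓝 0) := by
    have h1 : Filter.Tendsto B Filter.atTop (𝓝 0) := by
      have := (tendsto_pow_atTop_nhds_zero_of_lt_one hσ0.le hσ1).const_mul A
      simpa [B] using this
    have h2 := h1.rpow_const (p := 1 + ν) (Or.inr (by linarith))
    rwa [zero_rpow (by linarith)] at h2
  rw [← Filter.tendsto_add_atTop_iff_nat 1]
  exact squeeze_zero (fun j => ha _) (fun j => (claim j).2) lim

section PB
set_option linter.unusedSectionVars false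
variable {E : Type*} [NormedAddCommGroup E] [InnerProductSpace ℝ E] [CompleteSpace E]

structure Dat (ε : ℝ) (Ω : Set E) (v : E → ℝ) (D : E → E) : Prop where
  opn : IsOpen Ω
  bdd : IsBounded Ω
  cont : Continuous v
  nn : ∀ x, 0 ≤ v x
  le1 : ∀ x, v x ≤ 1
  off : ∀ x, x ∉ Ω → v x = 0
  cd : ContDiffOn ℝ 1 v Ω
  fd : ∀ x ∈ Ω, ∀ y, fderiv ℝ v x y = ⟪D x, y⟫
  Doff : ∀ x, x ∉ Ω → D x = 0
  e0 : 0 < ε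
  e1 : ε ≤ 1

noncomputable def VV (ε : ℝ) (v : E → ℝ) (D : E → E) (x : E) : WithLp 2 (ℝ × E) :=
  WithLp.toLp 2 (√ε * v x, D x)

noncomputable def PP (ε : ℝ) (v : E → ℝ) (D : E → E) (x : E) : ℝ := √(ε * v x ^ 2 + ‖D x‖ ^ 2)

lemma norm_VV {ε : ℝ} (he : 0 ≤ ε) (v : E → ℝ) (D : E → E) (x : E) :
    ‖VV ε v D x‖ = PP ε v D x := by
  rw [VV, PP, WithLp.prod_norm_eq_of_L2]
  simp [mul_pow, Real.sq_sqrt he]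

lemma PP_nonneg (ε : ℝ) (v : E → ℝ) (D : E → E) (x : E) : 0 ≤ PP ε v D x := Real.sqrt_nonneg _

lemma PP_sq {ε : ℝ} (he : 0 ≤ ε) (v : E → ℝ) (D : E → E) (x : E) :
    PP ε v D x ^ 2 = ε * v x ^ 2 + ‖D x‖ ^ 2 := Real.sq_sqrt (by positivity)

lemma norm_D_le {ε : ℝ} (he : 0 ≤ ε) (v : E → ℝ) (D : E → E) (x : E) : ‖D x‖ ≤ PP ε v D x := by
  apply Real.le_sqrt_of_sq_le; nlinarith [mul_nonneg he (sq_nonneg (v x))]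

lemma v_le_PP {ε : ℝ} (he : 0 ≤ ε) (v : E → ℝ) (D : E → E) (x : E) : √ε * |v x| ≤ PP ε v D x := by
  apply Real.le_sqrt_of_sq_le; rw [mul_pow, sq_abs, Real.sq_sqrt he]; nlinarith [sq_nonneg ‖D x‖]

lemma Dat.contD {ε : ℝ} {Ω : Set E} {v : E → ℝ} {D : E → E} (d : Dat ε Ω v D) :
    ContinuousOn D Ω := by
  have h1 : ContinuousOn (fun x => (InnerProductSpace.toDual ℝ E).symm (fderiv ℝ v x)) Ω := by
    refine (LinearIsometryEquiv.continuous _).comp_continuousOn ?_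
    exact d.cd.continuousOn_fderiv_of_isOpen d.opn le_rfl
  refine h1.congr fun x hx => ?_
  have : fderiv ℝ v x = InnerProductSpace.toDual ℝ E (D x) := by
    ext y; simp [d.fd x hx y]
  show D x = (InnerProductSpace.toDual ℝ E).symm (fderiv ℝ v x)
  rw [this]; simp

lemma Dat.diff {ε : ℝ} {Ω : Set E} {v : E → ℝ} {D : E → E} (d : Dat ε Ω v D) {x : E} (hx : x ∈ Ω) :
    DifferentiableAt ℝ v x :=
  (d.cd.contDiffAt (d.opn.mem_nhds hx)).differentiableAt (by norm_num)

variable [MeasurableSpace E] [BorelSpace E]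

lemma Dat.measD {ε : ℝ} {Ω : Set E} {v : E → ℝ} {D : E → E} (d : Dat ε Ω v D) :
    Measurable D := by
  classical
  have h : D = Ω.piecewise D (fun _ => 0) := by
    ext1 x
    by_cases hx : x ∈ Ω
    · simp [hx]
    · simp [hx, d.Doff x hx]
  rw [h]
  exact d.contD.measurable_piecewise continuousOn_const d.opn.measurableSet

lemma Dat.measP {ε : ℝ} {Ω : Set E} {v : E → ℝ} {D : E → E} (d : Dat ε Ω v D) :
    Measurable (PP ε v D) := by
  have h1 := d.measD.norm
  have h2 := d.cont.measurable
  unfold PP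
  fun_prop

lemma test_mk {U : Set E} (hU : IsOpen U) {f ψ : E → ℝ} (hf : Continuous f)
    (hfU : ContDiffOn ℝ 1 f U) (hψ : ContDiffOn ℝ 1 ψ U) {θ θ' : ℝ → ℝ}
    (hθ : ∀ s, HasDerivAt θ (θ' s) s) (hθc : Continuous θ') {k : ℝ} (hk : ∀ s ≤ k, θ s = 0)
    (hK : IsCompact {x | k ≤ f x}) (hKU : {x | k ≤ f x} ⊆ U) :
    ContDiff ℝ 1 (fun x => θ (f x) * ψ x) ∧ HasCompactSupport (fun x => θ (f x) * ψ x) ∧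
    tsupport (fun x => θ (f x) * ψ x) ⊆ {x | k ≤ f x} ∧
    (∀ x ∈ U, ∀ y, fderiv ℝ (fun x => θ (f x) * ψ x) x y =
      θ' (f x) * fderiv ℝ f x y * ψ x + θ (f x) * fderiv ℝ ψ x y) ∧
    (∀ x, f x ≤ k → fderiv ℝ (fun x => θ (f x) * ψ x) x = 0) := by
  have hcl : IsClosed {x | k ≤ f x} := isClosed_le continuous_const hf
  have hts : tsupport (fun x => θ (f x) * ψ x) ⊆ {x | k ≤ f x} := by
    apply closure_minimal _ hcl
    intro x hx
    by_contra h
    simp only [mem_setOf_eq, not_le] at h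
    exact hx (by simp [hk _ h.le])
  have hcs : HasCompactSupport (fun x => θ (f x) * ψ x) := hK.of_isClosed_subset (isClosed_tsupport _) hts
  have hθd : deriv θ = θ' := funext fun s => (hθ s).deriv
  have hθC : ContDiff ℝ 1 θ := contDiff_one_iff_deriv.2
    ⟨fun s => (hθ s).differentiableAt, by rw [hθd]; exact hθc⟩
  have hCU : ∀ x ∈ U, ContDiffAt ℝ 1 (fun x => θ (f x) * ψ x) x := fun x hx =>
    (hθC.contDiffAt.comp x (hfU.contDiffAt (hU.mem_nhds hx))).mul (hψ.contDiffAt (hU.mem_nhds hx))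
  have hform : ∀ x ∈ U, ∀ y, fderiv ℝ (fun x => θ (f x) * ψ x) x y =
      θ' (f x) * fderiv ℝ f x y * ψ x + θ (f x) * fderiv ℝ ψ x y := by
    intro x hx y
    have h1 := ((hfU.contDiffAt (hU.mem_nhds hx)).differentiableAt (by norm_num)).hasFDerivAt
    have h2 := ((hψ.contDiffAt (hU.mem_nhds hx)).differentiableAt (by norm_num)).hasFDerivAt
    have h3 := ((hθ (f x)).comp_hasFDerivAt x h1).mul h2
    have h4 : fderiv ℝ (fun x => θ (f x) * ψ x) x = _ := h3.fderiv
    rw [h4]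
    simp
    ring
  have hz : ∀ x, x ∉ {x | k ≤ f x} → (fun x => θ (f x) * ψ x) =ᶠ[𝓝 x] fun _ => 0 := by
    intro x hx
    filter_upwards [hcl.isOpen_compl.mem_nhds hx] with y hy
    simp only [mem_compl_iff, mem_setOf_eq, not_le] at hy
    simp [hk _ hy.le]
  have hθ'0 : ∀ s ≤ k, θ' s = 0 := by
    have hlt : ∀ s < k, θ' s = 0 := by
      intro s hs
      have : θ =ᶠ[𝓝 s] fun _ => 0 := by
        filter_upwards [Iio_mem_nhds hs] with y hy using hk _ (le_of_lt hy)
      rw [← hθd, this.deriv_eq]; simp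
    intro s hs
    rcases hs.eq_or_lt with h | h
    · subst h
      have h1 : Filter.Tendsto θ' (𝓝[<] s) (𝓝 (θ' s)) := hθc.continuousAt.tendsto.mono_left nhdsWithin_le_nhds
      have h2 : Filter.Tendsto θ' (𝓝[<] s) (𝓝 0) := by
        refine Filter.Tendsto.congr' ?_ tendsto_const_nhds
        filter_upwards [self_mem_nhdsWithin] with y hy using (hlt y hy).symm
      exact tendsto_nhds_unique h1 h2
    · exact hlt s h
  refine ⟨?_, hcs, hts, hform, ?_⟩
  · rw [contDiff_iff_contDiffAt]
    intro x
    by_cases hx : x ∈ {x | k ≤ f x}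
    · exact hCU x (hKU hx)
    · exact contDiffAt_const.congr_of_eventuallyEq (hz x hx)
  · intro x hx
    rcases hx.eq_or_lt with h | h
    · ext y
      rw [hform x (hKU (by simp [h])) y, hθ'0 _ hx, hk _ hx]; simp
    · rw [(hz x (by simp [h])).fderiv_eq]; simp

/-- Lebesgue form of the Euler-Lagrange inequality. -/
def ELp (p C : ℝ) (ε : ℝ) (Ω : Set E) (v : E → ℝ) (D : E → E) (μ : Measure E) : Prop :=
  ∀ φ : E → ℝ, ContDiff ℝ 1 φ → HasCompactSupport φ → tsupport φ ⊆ Ω →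
    |∫ x, PP ε v D x ^ (p - 2) * fderiv ℝ φ x (D x) ∂μ| ≤
      C * ∫ x, (1 + PP ε v D x ^ (p - 1)) * |φ x| ∂μ

end PB

section PF
set_option linter.unusedSectionVars false
variable {E : Type*} [NormedAddCommGroup E] [InnerProductSpace ℝ E] [FiniteDimensional ℝ E]
  [CompleteSpace E] [MeasurableSpace E] [BorelSpace E]

lemma hasDerivAt_sqp (k s : ℝ) :
    HasDerivAt (fun s => (max (s - k) 0) ^ 2) (2 * max (s - k) 0) s := by
  rcases lt_trichotomy s k with h | h | h
  · have : (fun s => (max (s - k) 0) ^ 2) =ᶠ[𝓝 s] fun _ => 0 := by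
      filter_upwards [Iio_mem_nhds h] with y hy
      rw [max_eq_right (by simp only [mem_Iio] at hy; linarith)]; norm_num
    rw [max_eq_right (by linarith), mul_zero]
    exact (hasDerivAt_const s (0:ℝ)).congr_of_eventuallyEq this
  · subst h
    simp only [sub_self, max_self, mul_zero]
    rw [hasDerivAt_iff_isLittleO]
    simp only [sub_self, max_self, smul_zero, sub_zero]
    have : (fun x' : ℝ => (max (x' - s) 0) ^ 2 - 0 ^ 2) =O[𝓝 s] fun x' => (x' - s) ^ 2 := by
      refine Asymptotics.IsBigO.of_bound 1 (Filter.Eventually.of_forall fun y => ?_)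
      simp only [ne_eq, OfNat.ofNat_ne_zero, not_false_eq_true, zero_pow, sub_zero, norm_pow, one_mul]
      gcongr
      rw [Real.norm_eq_abs, Real.norm_eq_abs, abs_of_nonneg (le_max_right _ _)]
      exact max_le (le_abs_self _) (abs_nonneg _)
    refine this.trans_isLittleO ?_
    have h2 : (fun x' : ℝ => (x' - s) ^ 2) =o[𝓝 s] fun x' => (x' - s) ^ 1 := by
      have := (Asymptotics.isLittleO_pow_pow (𝕜 := ℝ) (m := 1) (n := 2) (by norm_num))
      have ht : Filter.Tendsto (fun x' : ℝ => x' - s) (𝓝 s) (𝓝 0) := by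
        have : ContinuousAt (fun x' : ℝ => x' - s) s := by fun_prop
        simpa [ContinuousAt] using this
      exact this.comp_tendsto ht
    simpa using h2
  · have : (fun s => (max (s - k) 0) ^ 2) =ᶠ[𝓝 s] fun s => (s - k) ^ 2 := by
      filter_upwards [Ioi_mem_nhds h] with y hy
      rw [max_eq_left (by simp only [mem_Ioi] at hy; linarith)]
    rw [max_eq_left (by linarith)]
    have h2 : HasDerivAt (fun s : ℝ => (s - k) ^ 2) (2 * (s - k)) s := by
      have h3 := ((hasDerivAt_id' s).sub_const k).fun_pow 2
      simpa using h3
    exact h2.congr_of_eventuallyEq this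

structure PairH (p C ε k0 : ℝ) (Ω1 : Set E) (v1 : E → ℝ) (D1 : E → E)
    (Ω2 : Set E) (v2 : E → ℝ) (D2 : E → E) (μ : Measure E) : Prop where
  hp : 1 < p
  hC : 0 ≤ C
  d1 : Dat ε Ω1 v1 D1
  d2 : Dat ε Ω2 v2 D2
  l1 : ELp p C ε Ω1 v1 D1 μ
  l2 : ELp p C ε Ω2 v2 D2 μ
  i1 : Integrable (fun x => PP ε v1 D1 x ^ p) μ
  i2 : Integrable (fun x => PP ε v2 D2 x ^ p) μ
  hk0 : 0 < k0
  s1 : ∀ x, k0 ≤ v2 x - v1 x → x ∈ Ω1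
  s2 : ∀ x, k0 ≤ v2 x - v1 x → x ∈ Ω2

noncomputable def SS (ε : ℝ) (v1 : E → ℝ) (D1 : E → E) (v2 : E → ℝ) (D2 : E → E) (x : E) : ℝ :=
  PP ε v1 D1 x + PP ε v2 D2 x

def AA (v1 v2 : E → ℝ) (k : ℝ) : Set E := {x | k < v2 x - v1 x}

noncomputable def MM (p ε : ℝ) (v1 : E → ℝ) (D1 : E → E) (v2 : E → ℝ) (D2 : E → E) (x : E) : ℝ :=
  mon p (VV ε v2 D2 x) (VV ε v1 D1 x)

noncomputable def NN (ε : ℝ) (v1 : E → ℝ) (D1 : E → E) (v2 : E → ℝ) (D2 : E → E) (x : E) : ℝ :=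
  ‖VV ε v2 D2 x - VV ε v1 D1 x‖

lemma SS_nonneg (ε : ℝ) (v1 : E → ℝ) (D1 : E → E) (v2 : E → ℝ) (D2 : E → E) (x : E) :
    0 ≤ SS ε v1 D1 v2 D2 x := add_nonneg (PP_nonneg _ _ _ _) (PP_nonneg _ _ _ _)

lemma add_rpow_le' {p a b : ℝ} (hp : 1 < p) (ha : 0 ≤ a) (hb : 0 ≤ b) :
    (a + b) ^ p ≤ 2 ^ p * (a ^ p + b ^ p) := by
  have : a + b ≤ 2 * max a b := by
    linarith [le_max_left a b, le_max_right a b]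
  calc (a+b)^p ≤ (2 * max a b) ^ p := by gcongr
    _ = 2 ^ p * (max a b) ^ p := by rw [mul_rpow (by norm_num) (by positivity)]
    _ ≤ _ := by
      gcongr
      have e1 : 0 ≤ a ^ p := by positivity
      have e2 : 0 ≤ b ^ p := by positivity
      rcases max_choice a b with h | h <;> rw [h] <;> linarith

variable {p C ε k0 : ℝ} {Ω1 : Set E} {v1 : E → ℝ} {D1 : E → E}
    {Ω2 : Set E} {v2 : E → ℝ} {D2 : E → E} {μ : Measure E} [μ.IsAddHaarMeasure]

lemma VVinner (he : 0 ≤ ε) (x : E) (c1 c2 : ℝ) :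
    (⟪c2 • VV ε v2 D2 x - c1 • VV ε v1 D1 x, VV ε v2 D2 x - VV ε v1 D1 x⟫ : ℝ) =
     ε * (c2 * v2 x - c1 * v1 x) * (v2 x - v1 x) + ⟪c2 • D2 x - c1 • D1 x, D2 x - D1 x⟫ := by
  simp only [VV, WithLp.prod_inner_apply]
  simp
  have : √ε * √ε = ε := Real.mul_self_sqrt he
  linear_combination ((v2 x - v1 x) * (c2 * v2 x - c1 * v1 x)) * this

namespace PairH
variable (H : PairH p C ε k0 Ω1 v1 D1 Ω2 v2 D2 μ)
include H

lemma cw : Continuous (fun x => v2 x - v1 x) := H.d2.cont.sub H.d1.cont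

lemma mA (k : ℝ) : MeasurableSet (AA v1 v2 k) := (isOpen_lt continuous_const H.cw).measurableSet

lemma cpt {k : ℝ} (hk : k0 ≤ k) : IsCompact {x | k ≤ v2 x - v1 x} := by
  apply Metric.isCompact_of_isClosed_isBounded (isClosed_le continuous_const H.cw)
  exact H.d1.bdd.subset fun x hx => H.s1 x (le_trans hk hx)

lemma finA {k : ℝ} (hk : k0 ≤ k) : μ (AA v1 v2 k) < ⊤ :=
  lt_of_le_of_lt (measure_mono fun _ (hx : k < _) => (le_of_lt hx : k ≤ _)) (H.cpt hk).measure_lt_top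

lemma mS : Measurable (SS ε v1 D1 v2 D2) := H.d1.measP.add H.d2.measP

lemma iSp : Integrable (fun x => SS ε v1 D1 v2 D2 x ^ p) μ := by
  refine Integrable.mono' ((H.i1.add H.i2).const_mul (2 ^ p)) (H.mS.pow_const p).aestronglyMeasurable
    (Filter.Eventually.of_forall fun x => ?_)
  rw [Real.norm_eq_abs, abs_of_nonneg (rpow_nonneg (SS_nonneg _ _ _ _ _ _) _)]
  exact add_rpow_le' H.hp (PP_nonneg _ _ _ _) (PP_nonneg _ _ _ _)

lemma iOn {k : ℝ} (hk : k0 ≤ k) {f : E → ℝ} (hf : Measurable f) (c : ℝ)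
    (h : ∀ x, |f x| ≤ c * (1 + SS ε v1 D1 v2 D2 x ^ p)) : IntegrableOn f (AA v1 v2 k) μ := by
  have : IntegrableOn (fun x => c * (1 + SS ε v1 D1 v2 D2 x ^ p)) (AA v1 v2 k) μ :=
    ((integrableOn_const (H.finA hk).ne).add H.iSp.integrableOn).const_mul c
  exact Integrable.mono' this hf.aestronglyMeasurable (Filter.Eventually.of_forall h)

lemma S1 (x : E) : SS ε v1 D1 v2 D2 x ^ (p - 1) ≤ 1 + SS ε v1 D1 v2 D2 x ^ p := by
  have := rpow_young (t := 1) H.hp one_pos (SS_nonneg ε v1 D1 v2 D2 x)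
  simp at this; linarith

lemma mV1 : Measurable (VV ε v1 D1) :=
  (WithLp.measurable_toLp 2 _).comp ((H.d1.cont.measurable.const_mul _).prodMk H.d1.measD)
lemma mV2 : Measurable (VV ε v2 D2) :=
  (WithLp.measurable_toLp 2 _).comp ((H.d2.cont.measurable.const_mul _).prodMk H.d2.measD)

lemma NN_le (x : E) : NN ε v1 D1 v2 D2 x ≤ SS ε v1 D1 v2 D2 x := by
  refine (norm_sub_le _ _).trans ?_
  rw [norm_VV H.d1.e0.le, norm_VV H.d1.e0.le, SS, add_comm]

lemma NN_nonneg (x : E) : 0 ≤ NN ε v1 D1 v2 D2 x := norm_nonneg _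

lemma mN : Measurable (NN ε v1 D1 v2 D2) := by
  have h1 := H.mV1.comp measurable_id
  have : NN ε v1 D1 v2 D2 = fun x => √(ε * (v2 x - v1 x) ^ 2 + ‖D2 x - D1 x‖ ^ 2) := by
    ext x
    rw [NN, VV, VV, ← WithLp.toLp_sub, WithLp.prod_norm_eq_of_L2]
    have : √ε * v2 x - √ε * v1 x = √ε * (v2 x - v1 x) := by ring
    simp [this, mul_pow, Real.sq_sqrt H.d1.e0.le]
  rw [this]
  have h1 := (H.d2.measD.sub H.d1.measD).norm
  have h2 := H.cw.measurable
  have h3 := (((h2.pow_const 2).const_mul ε).add (h1.pow_const 2)).sqrt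
  exact h3

lemma MM_eq (x : E) : MM p ε v1 D1 v2 D2 x =
     ε * (PP ε v2 D2 x ^ (p-2) * v2 x - PP ε v1 D1 x ^ (p-2) * v1 x) * (v2 x - v1 x)
     + ⟪PP ε v2 D2 x ^ (p-2) • D2 x - PP ε v1 D1 x ^ (p-2) • D1 x, D2 x - D1 x⟫ := by
  rw [MM, mon, norm_VV H.d1.e0.le, norm_VV H.d1.e0.le, VVinner H.d1.e0.le x]

lemma MM_nonneg (x : E) : 0 ≤ MM p ε v1 D1 v2 D2 x := mon_nonneg H.hp _ _

lemma mM : Measurable (MM p ε v1 D1 v2 D2) := by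
  rw [funext H.MM_eq]
  have a1 := H.d1.cont.measurable
  have a2 := H.d2.cont.measurable
  have b1 := H.d1.measD
  have b2 := H.d2.measD
  have c1 := H.d1.measP.pow_const (p-2)
  have c2 := H.d2.measP.pow_const (p-2)
  refine Measurable.add ?_ ?_
  · exact (((c2.mul a2).sub (c1.mul a1)).const_mul ε).mul (a2.sub a1)
  · exact ((c2.smul b2).sub (c1.smul b1)).inner (b2.sub b1)

lemma P1le (x : E) : PP ε v1 D1 x ≤ SS ε v1 D1 v2 D2 x := by
  have := PP_nonneg ε v2 D2 x; unfold SS; linarith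
lemma P2le (x : E) : PP ε v2 D2 x ≤ SS ε v1 D1 v2 D2 x := by
  have := PP_nonneg ε v1 D1 x; unfold SS; linarith

lemma P1pow (x : E) : PP ε v1 D1 x ^ (p-1) ≤ SS ε v1 D1 v2 D2 x ^ (p-1) :=
  rpow_le_rpow (PP_nonneg _ _ _ _) (H.P1le x) (by linarith [H.hp])
lemma P2pow (x : E) : PP ε v2 D2 x ^ (p-1) ≤ SS ε v1 D1 v2 D2 x ^ (p-1) :=
  rpow_le_rpow (PP_nonneg _ _ _ _) (H.P2le x) (by linarith [H.hp])

lemma MM_le (x : E) : MM p ε v1 D1 v2 D2 x ≤ 2 * SS ε v1 D1 v2 D2 x ^ p := by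
  rw [MM, mon]
  refine (real_inner_le_norm _ _).trans ?_
  have h0 := SS_nonneg ε v1 D1 v2 D2 x
  have e1 := PP_nonneg ε v1 D1 x
  have e2 := PP_nonneg ε v2 D2 x
  have h1 : ‖‖VV ε v2 D2 x‖ ^ (p - 2) • VV ε v2 D2 x - ‖VV ε v1 D1 x‖ ^ (p - 2) • VV ε v1 D1 x‖
      ≤ 2 * SS ε v1 D1 v2 D2 x ^ (p-1) := by
    refine (norm_sub_le _ _).trans ?_
    rw [norm_smul, norm_smul, norm_VV H.d1.e0.le, norm_VV H.d1.e0.le, Real.norm_eq_abs,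
      Real.norm_eq_abs, abs_of_nonneg (rpow_nonneg e1 _), abs_of_nonneg (rpow_nonneg e2 _),
      rpow_two_mul_self H.hp e1, rpow_two_mul_self H.hp e2]
    linarith [H.P1pow x, H.P2pow x]
  calc _ ≤ (2 * SS ε v1 D1 v2 D2 x ^ (p-1)) * SS ε v1 D1 v2 D2 x :=
        mul_le_mul h1 (H.NN_le x) (norm_nonneg _) (by positivity)
    _ = _ := by rw [mul_assoc, rpow_one_mul_self H.hp h0]

end PairH
end PF

section PF
set_option linter.unusedSectionVars false
variable {E : Type*} [NormedAddCommGroup E] [InnerProductSpace ℝ E] [FiniteDimensional ℝ E]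
  [CompleteSpace E] [MeasurableSpace E] [BorelSpace E]
variable {p C ε k0 : ℝ} {Ω1 : Set E} {v1 : E → ℝ} {D1 : E → E}
    {Ω2 : Set E} {v2 : E → ℝ} {D2 : E → E} {μ : Measure E} [μ.IsAddHaarMeasure]

namespace PairH
variable (H : PairH p C ε k0 Ω1 v1 D1 Ω2 v2 D2 μ)
include H

lemma w_le (x : E) : v2 x - v1 x ≤ 1 := by linarith [H.d2.le1 x, H.d1.nn x]
lemma w_abs (x : E) : |v2 x - v1 x| ≤ 1 :=
  abs_le.2 ⟨by linarith [H.d1.le1 x, H.d2.nn x], H.w_le x⟩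

lemma mx_le {k : ℝ} (hk : k0 ≤ k) (x : E) : max (v2 x - v1 x - k) 0 ≤ 1 :=
  max_le (by linarith [H.w_le x, H.hk0]) zero_le_one

lemma DD_le (x : E) : ‖D2 x - D1 x‖ ≤ NN ε v1 D1 v2 D2 x := by
  have h : NN ε v1 D1 v2 D2 x ^ 2 = ε * (v2 x - v1 x) ^ 2 + ‖D2 x - D1 x‖ ^ 2 := by
    rw [NN, ← real_inner_self_eq_norm_sq]
    have := VVinner (v1 := v1) (v2 := v2) (D1 := D1) (D2 := D2) H.d1.e0.le x 1 1
    simp only [one_smul, one_mul, real_inner_self_eq_norm_sq] at this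
    rw [real_inner_self_eq_norm_sq, this]; ring
  refine abs_le_of_sq_le_sq' ?_ (H.NN_nonneg x) |>.2
  rw [h]; nlinarith [mul_nonneg H.d1.e0.le (sq_nonneg (v2 x - v1 x))]

lemma gb1 (x : E) : |PP ε v1 D1 x ^ (p-2) * ⟪D2 x - D1 x, D1 x⟫| ≤
    SS ε v1 D1 v2 D2 x ^ (p-1) * NN ε v1 D1 v2 D2 x := by
  have e1 := PP_nonneg ε v1 D1 x
  rw [abs_mul, abs_of_nonneg (rpow_nonneg e1 _)]
  calc _ ≤ PP ε v1 D1 x ^ (p-2) * (NN ε v1 D1 v2 D2 x * PP ε v1 D1 x) := by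
        gcongr
        refine (abs_real_inner_le_norm _ _).trans ?_
        exact mul_le_mul (H.DD_le x) (norm_D_le H.d1.e0.le _ _ _) (norm_nonneg _) (H.NN_nonneg x)
    _ = PP ε v1 D1 x ^ (p-1) * NN ε v1 D1 v2 D2 x := by
        rw [← rpow_two_mul_self H.hp e1]; ring
    _ ≤ _ := mul_le_mul_of_nonneg_right (H.P1pow x) (H.NN_nonneg x)

lemma gb2 (x : E) : |PP ε v2 D2 x ^ (p-2) * ⟪D2 x - D1 x, D2 x⟫| ≤
    SS ε v1 D1 v2 D2 x ^ (p-1) * NN ε v1 D1 v2 D2 x := by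
  have e1 := PP_nonneg ε v2 D2 x
  rw [abs_mul, abs_of_nonneg (rpow_nonneg e1 _)]
  calc _ ≤ PP ε v2 D2 x ^ (p-2) * (NN ε v1 D1 v2 D2 x * PP ε v2 D2 x) := by
        gcongr
        refine (abs_real_inner_le_norm _ _).trans ?_
        exact mul_le_mul (H.DD_le x) (norm_D_le H.d1.e0.le _ _ _) (norm_nonneg _) (H.NN_nonneg x)
    _ = PP ε v2 D2 x ^ (p-1) * NN ε v1 D1 v2 D2 x := by
        rw [← rpow_two_mul_self H.hp e1]; ring
    _ ≤ _ := mul_le_mul_of_nonneg_right (H.P2pow x) (H.NN_nonneg x)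

lemma SN_le (x : E) : SS ε v1 D1 v2 D2 x ^ (p-1) * NN ε v1 D1 v2 D2 x ≤ SS ε v1 D1 v2 D2 x ^ p := by
  rw [← rpow_one_mul_self H.hp (SS_nonneg ε v1 D1 v2 D2 x)]
  exact mul_le_mul_of_nonneg_left (H.NN_le x) (rpow_nonneg (SS_nonneg _ _ _ _ _ _) _)

lemma cdw : ContDiffOn ℝ 1 (fun x => v2 x - v1 x) (Ω1 ∩ Ω2) :=
  (H.d2.cd.mono inter_subset_right).sub (H.d1.cd.mono inter_subset_left)

lemma fdw {x : E} (h1 : x ∈ Ω1) (h2 : x ∈ Ω2) (y : E) :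
    fderiv ℝ (fun x => v2 x - v1 x) x y = ⟪D2 x - D1 x, y⟫ := by
  have : fderiv ℝ (fun x => v2 x - v1 x) x = fderiv ℝ v2 x - fderiv ℝ v1 x :=
    fderiv_fun_sub (H.d2.diff h2) (H.d1.diff h1)
  rw [this]
  simp [H.d1.fd x h1, H.d2.fd x h2, inner_sub_left]

lemma iS1 {k : ℝ} (hk : k0 ≤ k) :
    IntegrableOn (fun x => 1 + SS ε v1 D1 v2 D2 x ^ (p-1)) (AA v1 v2 k) μ := by
  refine H.iOn hk ((H.mS.pow_const _).const_add 1) 2 fun x => ?_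
  have := H.S1 x
  have h0 := rpow_nonneg (SS_nonneg ε v1 D1 v2 D2 x) (p-1)
  have h1 := rpow_nonneg (SS_nonneg ε v1 D1 v2 D2 x) p
  rw [abs_of_nonneg (by linarith)]
  linarith

lemma iM {k : ℝ} (hk : k0 ≤ k) : IntegrableOn (MM p ε v1 D1 v2 D2) (AA v1 v2 k) μ := by
  refine H.iOn hk H.mM 2 fun x => ?_
  rw [abs_of_nonneg (H.MM_nonneg x)]
  linarith [H.MM_le x]

lemma iSN {k : ℝ} (hk : k0 ≤ k) :
    IntegrableOn (fun x => SS ε v1 D1 v2 D2 x ^ (p-1) * NN ε v1 D1 v2 D2 x) (AA v1 v2 k) μ := by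
  refine H.iOn hk ((H.mS.pow_const _).mul H.mN) 1 fun x => ?_
  rw [abs_of_nonneg (mul_nonneg (rpow_nonneg (SS_nonneg _ _ _ _ _ _) _) (H.NN_nonneg x))]
  linarith [H.SN_le x]

/-- The right-hand side of the Euler-Lagrange inequality. -/
lemma rhs {k : ℝ} (hk : k0 ≤ k) {φ : E → ℝ} (hφc : Continuous φ) (hφ : ∀ x, |φ x| ≤ 1)
    (h0 : ∀ x, x ∉ AA v1 v2 k → φ x = 0) {P : E → ℝ} (hm : Measurable P) (h1 : ∀ x, 0 ≤ P x)
    (hP : ∀ x, P x ^ (p-1) ≤ SS ε v1 D1 v2 D2 x ^ (p-1)) :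
    C * ∫ x, (1 + P x ^ (p-1)) * |φ x| ∂μ ≤
     C * ∫ x in AA v1 v2 k, (1 + SS ε v1 D1 v2 D2 x ^ (p-1)) ∂μ := by
  refine mul_le_mul_of_nonneg_left ?_ H.hC
  rw [← setIntegral_eq_integral_of_forall_compl_eq_zero (s := AA v1 v2 k)
    (fun x hx => by rw [h0 x hx]; simp)]
  have hb : ∀ x, (1 + P x ^ (p-1)) * |φ x| ≤ 1 + SS ε v1 D1 v2 D2 x ^ (p-1) := fun x => by
    have := rpow_nonneg (h1 x) (p-1)
    calc _ ≤ (1 + P x ^ (p-1)) * 1 := mul_le_mul_of_nonneg_left (hφ x) (by linarith)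
      _ ≤ _ := by linarith [hP x]
  refine setIntegral_mono ?_ (H.iS1 hk) hb
  refine Integrable.mono' (H.iS1 hk)
    (((hm.pow_const _).const_add 1).mul hφc.measurable.abs).aestronglyMeasurable
    (Filter.Eventually.of_forall fun x => ?_)
  rw [Real.norm_eq_abs, abs_of_nonneg (mul_nonneg (by linarith [rpow_nonneg (h1 x) (p-1)]) (abs_nonneg _))]
  exact hb x

lemma ineq1 {k d : ℝ} (hk : k0 ≤ k) (hd : 0 < d) :
    d * ∫ x in AA v1 v2 (k+d), MM p ε v1 D1 v2 D2 x ∂μ ≤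
     (2 + C) * ∫ x in AA v1 v2 k, (1 + SS ε v1 D1 v2 D2 x ^ (p-1)) ∂μ := by
  obtain ⟨t1, t2, t3, t4, t5⟩ := test_mk (H.d1.opn.inter H.d2.opn) H.cw H.cdw
    (contDiffOn_const (c := (1:ℝ))) (hasDerivAt_sqp k) (by fun_prop) (k := k)
    (fun s hs => by rw [max_eq_right (by linarith)]; norm_num) (H.cpt hk)
    (fun x hx => ⟨H.s1 x (le_trans hk hx), H.s2 x (le_trans hk hx)⟩)
  set φ : E → ℝ := fun x => max (v2 x - v1 x - k) 0 ^ 2 * 1 with hφ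
  have hφ1 : ∀ x, |φ x| ≤ 1 := fun x => by
    have := H.mx_le hk x
    have h0 : 0 ≤ max (v2 x - v1 x - k) 0 := le_max_right _ _
    simp only [hφ, mul_one]
    rw [abs_of_nonneg (by positivity)]
    nlinarith
  have hφ0 : ∀ x, x ∉ AA v1 v2 k → φ x = 0 := fun x hx => by
    simp only [hφ]; rw [max_eq_right]; · norm_num
    have : ¬ (k < v2 x - v1 x) := hx
    linarith
  have hf0 : ∀ x, x ∉ AA v1 v2 k → fderiv ℝ φ x = 0 := fun x hx => t5 x (le_of_not_gt hx)
  have e1 := (H.l1 φ t1 t2 (t3.trans fun x hx => H.s1 x (le_trans hk hx))).trans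
    (H.rhs hk t1.continuous hφ1 hφ0 H.d1.measP (PP_nonneg _ _ _) H.P1pow)
  have e2 := (H.l2 φ t1 t2 (t3.trans fun x hx => H.s2 x (le_trans hk hx))).trans
    (H.rhs hk t1.continuous hφ1 hφ0 H.d2.measP (PP_nonneg _ _ _) H.P2pow)
  have r1 : ∫ x, PP ε v1 D1 x ^ (p - 2) * fderiv ℝ φ x (D1 x) ∂μ = ∫ x in AA v1 v2 k,
      2 * max (v2 x - v1 x - k) 0 * (PP ε v1 D1 x ^ (p-2) * ⟪D2 x - D1 x, D1 x⟫) ∂μ := by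
    rw [← setIntegral_eq_integral_of_forall_compl_eq_zero (s := AA v1 v2 k)
      (fun x hx => by rw [hf0 x hx]; simp)]
    refine setIntegral_congr_fun (H.mA k) fun x hx => ?_
    have hx' : k0 ≤ v2 x - v1 x := le_trans hk (le_of_lt hx)
    rw [t4 x ⟨H.s1 x hx', H.s2 x hx'⟩, H.fdw (H.s1 x hx') (H.s2 x hx')]
    simp; ring
  have r2 : ∫ x, PP ε v2 D2 x ^ (p - 2) * fderiv ℝ φ x (D2 x) ∂μ = ∫ x in AA v1 v2 k,
      2 * max (v2 x - v1 x - k) 0 * (PP ε v2 D2 x ^ (p-2) * ⟪D2 x - D1 x, D2 x⟫) ∂μ := by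
    rw [← setIntegral_eq_integral_of_forall_compl_eq_zero (s := AA v1 v2 k)
      (fun x hx => by rw [hf0 x hx]; simp)]
    refine setIntegral_congr_fun (H.mA k) fun x hx => ?_
    have hx' : k0 ≤ v2 x - v1 x := le_trans hk (le_of_lt hx)
    rw [t4 x ⟨H.s1 x hx', H.s2 x hx'⟩, H.fdw (H.s1 x hx') (H.s2 x hx')]
    simp; ring
  rw [r1] at e1; rw [r2] at e2
  have hmx : Measurable fun x => 2 * max (v2 x - v1 x - k) 0 := by
    exact (((H.cw.sub continuous_const).max continuous_const).const_mul 2).measurable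
  have hb : ∀ x : E, ∀ g : ℝ, |g| ≤ SS ε v1 D1 v2 D2 x ^ (p-1) * NN ε v1 D1 v2 D2 x →
      |2 * max (v2 x - v1 x - k) 0 * g| ≤ 2 * (1 + SS ε v1 D1 v2 D2 x ^ p) := fun x g hg => by
    have h0 : 0 ≤ max (v2 x - v1 x - k) 0 := le_max_right _ _
    rw [abs_mul, abs_of_nonneg (by positivity)]
    have := mul_le_mul (H.mx_le hk x) (hg.trans (H.SN_le x)) (abs_nonneg _) zero_le_one
    linarith
  have j1 : IntegrableOn (fun x => 2 * max (v2 x - v1 x - k) 0 * (PP ε v1 D1 x ^ (p-2) * ⟪D2 x - D1 x, D1 x⟫)) (AA v1 v2 k) μ := H.iOn hk (hmx.mul ((H.d1.measP.pow_const (p-2)).mul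
    ((H.d2.measD.sub H.d1.measD).inner (𝕜 := ℝ) H.d1.measD))) 2 (fun x => hb x _ (H.gb1 x))
  have j2 : IntegrableOn (fun x => 2 * max (v2 x - v1 x - k) 0 * (PP ε v2 D2 x ^ (p-2) * ⟪D2 x - D1 x, D2 x⟫)) (AA v1 v2 k) μ := H.iOn hk (hmx.mul ((H.d2.measP.pow_const (p-2)).mul
    ((H.d2.measD.sub H.d1.measD).inner (𝕜 := ℝ) H.d2.measD))) 2 (fun x => hb x _ (H.gb2 x))
  have jM : IntegrableOn (fun x => 2 * max (v2 x - v1 x - k) 0 * MM p ε v1 D1 v2 D2 x)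
      (AA v1 v2 k) μ := by
    refine H.iOn hk (hmx.mul H.mM) 4 fun x => ?_
    have h0 : 0 ≤ max (v2 x - v1 x - k) 0 := le_max_right _ _
    rw [abs_of_nonneg (mul_nonneg (by positivity) (H.MM_nonneg x))]
    have := mul_le_mul (H.mx_le hk x) (H.MM_le x) (H.MM_nonneg x) zero_le_one
    linarith
  have main : ∫ x in AA v1 v2 k, 2 * max (v2 x - v1 x - k) 0 * MM p ε v1 D1 v2 D2 x ∂μ ≤
     (4 + 2 * C) * ∫ x in AA v1 v2 k, (1 + SS ε v1 D1 v2 D2 x ^ (p-1)) ∂μ := by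
    have hle : ∫ x in AA v1 v2 k, 2 * max (v2 x - v1 x - k) 0 * MM p ε v1 D1 v2 D2 x ∂μ ≤
      ∫ x in AA v1 v2 k, ((2 * max (v2 x - v1 x - k) 0 * (PP ε v2 D2 x ^ (p-2) * ⟪D2 x - D1 x, D2 x⟫)
       - 2 * max (v2 x - v1 x - k) 0 * (PP ε v1 D1 x ^ (p-2) * ⟪D2 x - D1 x, D1 x⟫))
       + 4 * (1 + SS ε v1 D1 v2 D2 x ^ (p-1))) ∂μ := by
      refine setIntegral_mono jM ((j2.sub j1).add ((H.iS1 hk).const_mul 4)) fun x => ?_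
      simp only
      rw [H.MM_eq x, inner_sub_left, real_inner_smul_left, real_inner_smul_left,
        real_inner_comm _ (D2 x), real_inner_comm _ (D1 x)]
      have h0 : 0 ≤ max (v2 x - v1 x - k) 0 := le_max_right _ _
      have h1 := H.mx_le hk x
      have q1 := H.P1pow x
      have q2 := H.P2pow x
      have z1 := PP_nonneg ε v1 D1 x
      have z2 := PP_nonneg ε v2 D2 x
      have s1 : ε * (PP ε v1 D1 x ^ (p-2) * v1 x) ≤ PP ε v1 D1 x ^ (p-1) := by
        rw [← rpow_two_mul_self H.hp z1]
        have := v_le_PP H.d1.e0.le v1 D1 x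
        rw [abs_of_nonneg (H.d1.nn x)] at this
        have h2 : ε * v1 x ≤ √ε * v1 x := by
          apply mul_le_mul_of_nonneg_right _ (H.d1.nn x)
          apply Real.le_sqrt_of_sq_le
          nlinarith [H.d1.e0, H.d1.e1]
        nlinarith [rpow_nonneg z1 (p-2)]
      have s2 : ε * (PP ε v2 D2 x ^ (p-2) * v2 x) ≤ PP ε v2 D2 x ^ (p-1) := by
        rw [← rpow_two_mul_self H.hp z2]
        have := v_le_PP H.d1.e0.le v2 D2 x
        rw [abs_of_nonneg (H.d2.nn x)] at this
        have h2 : ε * v2 x ≤ √ε * v2 x := by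
          apply mul_le_mul_of_nonneg_right _ (H.d2.nn x)
          apply Real.le_sqrt_of_sq_le
          nlinarith [H.d1.e0, H.d1.e1]
        nlinarith [rpow_nonneg z2 (p-2)]
      have n1 : 0 ≤ ε * (PP ε v1 D1 x ^ (p-2) * v1 x) :=
        mul_nonneg H.d1.e0.le (mul_nonneg (rpow_nonneg z1 _) (H.d1.nn x))
      have n2 : 0 ≤ ε * (PP ε v2 D2 x ^ (p-2) * v2 x) :=
        mul_nonneg H.d1.e0.le (mul_nonneg (rpow_nonneg z2 _) (H.d2.nn x))
      have hS : 0 ≤ SS ε v1 D1 v2 D2 x ^ (p-1) := rpow_nonneg (SS_nonneg _ _ _ _ _ _) _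
      have key : ε * (PP ε v2 D2 x ^ (p-2) * v2 x - PP ε v1 D1 x ^ (p-2) * v1 x) * (v2 x - v1 x)
          ≤ 2 * SS ε v1 D1 v2 D2 x ^ (p-1) := by
        refine (le_abs_self _).trans ?_
        rw [abs_mul]
        have ha : |ε * (PP ε v2 D2 x ^ (p-2) * v2 x - PP ε v1 D1 x ^ (p-2) * v1 x)| ≤
          2 * SS ε v1 D1 v2 D2 x ^ (p-1) := by
          rw [mul_sub, abs_le]; constructor <;> linarith
        calc _ ≤ 2 * SS ε v1 D1 v2 D2 x ^ (p-1) * 1 :=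
              mul_le_mul ha (H.w_abs x) (abs_nonneg _) (by positivity)
          _ = _ := by ring
      set m := max (v2 x - v1 x - k) 0
      have : m * (ε * (PP ε v2 D2 x ^ (p-2) * v2 x - PP ε v1 D1 x ^ (p-2) * v1 x) * (v2 x - v1 x))
        ≤ 1 * (2 * SS ε v1 D1 v2 D2 x ^ (p-1)) := by
        calc _ ≤ m * (2 * SS ε v1 D1 v2 D2 x ^ (p-1)) := mul_le_mul_of_nonneg_left key h0
          _ ≤ _ := mul_le_mul_of_nonneg_right h1 (by positivity)
      linarith
    rw [integral_add (by exact j2.sub j1) ((H.iS1 hk).const_mul 4), integral_sub j2 j1, integral_const_mul] at hle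
    have := abs_le.1 e1
    have := abs_le.1 e2
    linarith
  have hsub : AA v1 v2 (k+d) ⊆ AA v1 v2 k := fun x (hx : k + d < _) =>
    (by linarith : k < v2 x - v1 x)
  have l1 : ∫ x in AA v1 v2 (k+d), 2 * d * MM p ε v1 D1 v2 D2 x ∂μ ≤
     ∫ x in AA v1 v2 (k+d), 2 * max (v2 x - v1 x - k) 0 * MM p ε v1 D1 v2 D2 x ∂μ := by
    refine setIntegral_mono_on ((H.iM (by linarith)).const_mul _) (jM.mono_set hsub) (H.mA _)
      fun x (hx : k + d < _) => ?_
    refine mul_le_mul_of_nonneg_right ?_ (H.MM_nonneg x)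
    have := le_max_left (v2 x - v1 x - k) 0
    linarith
  have l2 : ∫ x in AA v1 v2 (k+d), 2 * max (v2 x - v1 x - k) 0 * MM p ε v1 D1 v2 D2 x ∂μ ≤
     ∫ x in AA v1 v2 k, 2 * max (v2 x - v1 x - k) 0 * MM p ε v1 D1 v2 D2 x ∂μ :=
    setIntegral_mono_set jM (Filter.Eventually.of_forall fun x =>
      mul_nonneg (mul_nonneg zero_le_two (le_max_right _ _)) (H.MM_nonneg x))
      (Filter.Eventually.of_forall hsub)
  rw [integral_const_mul] at l1
  linarith

end PairH
end PF

section PF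
set_option linter.unusedSectionVars false
variable {E : Type*} [NormedAddCommGroup E] [InnerProductSpace ℝ E] [FiniteDimensional ℝ E]
  [CompleteSpace E] [MeasurableSpace E] [BorelSpace E]
variable {p C ε k0 : ℝ} {Ω1 : Set E} {v1 : E → ℝ} {D1 : E → E}
    {Ω2 : Set E} {v2 : E → ℝ} {D2 : E → E} {μ : Measure E} [μ.IsAddHaarMeasure]

namespace PairH
variable (H : PairH p C ε k0 Ω1 v1 D1 Ω2 v2 D2 μ)
include H

lemma ineq2a {Ω : Set E} {v : E → ℝ} {D : E → E} (d : Dat ε Ω v D) (l : ELp p C ε Ω v D μ)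
    (s : ∀ x, k0 ≤ v2 x - v1 x → x ∈ Ω) (hPS : ∀ x, PP ε v D x ≤ SS ε v1 D1 v2 D2 x)
    {k : ℝ} (hk : k0 ≤ k) :
    ∫ x in AA v1 v2 k, max (v2 x - v1 x - k) 0 ^ 2 * PP ε v D x ^ p ∂μ ≤
     (1 + C) * (∫ x in AA v1 v2 k, (1 + SS ε v1 D1 v2 D2 x ^ (p-1)) ∂μ) +
     2 * ∫ x in AA v1 v2 k, SS ε v1 D1 v2 D2 x ^ (p-1) * NN ε v1 D1 v2 D2 x ∂μ := by
  have hm0 : ∀ x, 0 ≤ max (v2 x - v1 x - k) 0 := fun x => le_max_right _ _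
  have hm1 := H.mx_le hk
  have hq : ∀ x, max (v2 x - v1 x - k) 0 ^ 2 ≤ 1 := fun x => by nlinarith [hm0 x, hm1 x]
  have hPpow : ∀ x, PP ε v D x ^ (p-1) ≤ SS ε v1 D1 v2 D2 x ^ (p-1) := fun x =>
    rpow_le_rpow (PP_nonneg _ _ _ _) (hPS x) (by linarith [H.hp])
  have hPpow' : ∀ x, PP ε v D x ^ p ≤ SS ε v1 D1 v2 D2 x ^ p := fun x =>
    rpow_le_rpow (PP_nonneg _ _ _ _) (hPS x) (by linarith [H.hp])
  have gb : ∀ x, |PP ε v D x ^ (p-2) * ⟪D2 x - D1 x, D x⟫| ≤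
    SS ε v1 D1 v2 D2 x ^ (p-1) * NN ε v1 D1 v2 D2 x := fun x => by
    have e1 := PP_nonneg ε v D x
    rw [abs_mul, abs_of_nonneg (rpow_nonneg e1 _)]
    calc _ ≤ PP ε v D x ^ (p-2) * (NN ε v1 D1 v2 D2 x * PP ε v D x) := by
          gcongr
          refine (abs_real_inner_le_norm _ _).trans ?_
          exact mul_le_mul (H.DD_le x) (norm_D_le H.d1.e0.le _ _ _) (norm_nonneg _) (H.NN_nonneg x)
      _ = PP ε v D x ^ (p-1) * NN ε v1 D1 v2 D2 x := by
          rw [← rpow_two_mul_self H.hp e1]; ring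
      _ ≤ _ := mul_le_mul_of_nonneg_right (hPpow x) (H.NN_nonneg x)
  obtain ⟨t1, t2, t3, t4, t5⟩ := test_mk ((H.d1.opn.inter H.d2.opn).inter d.opn) H.cw
    (H.cdw.mono inter_subset_left)
    (d.cd.mono inter_subset_right) (hasDerivAt_sqp k) (by fun_prop) (k := k)
    (fun s hs => by rw [max_eq_right (by linarith)]; norm_num) (H.cpt hk)
    (fun x hx => ⟨⟨H.s1 x (le_trans hk hx), H.s2 x (le_trans hk hx)⟩, s x (le_trans hk hx)⟩)
  set φ : E → ℝ := fun x => max (v2 x - v1 x - k) 0 ^ 2 * v x with hφ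
  have hφ1 : ∀ x, |φ x| ≤ 1 := fun x => by
    simp only [hφ]
    have := d.nn x
    rw [abs_of_nonneg (by positivity)]
    exact mul_le_one₀ (hq x) this (d.le1 x)
  have hφ0 : ∀ x, x ∉ AA v1 v2 k → φ x = 0 := fun x hx => by
    simp only [hφ]; rw [max_eq_right]; · norm_num
    have : ¬ (k < v2 x - v1 x) := hx
    linarith
  have hf0 : ∀ x, x ∉ AA v1 v2 k → fderiv ℝ φ x = 0 := fun x hx => t5 x (le_of_not_gt hx)
  have e1 := (l φ t1 t2 (t3.trans fun x hx => s x (le_trans hk hx))).trans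
    (H.rhs hk t1.continuous hφ1 hφ0 d.measP (PP_nonneg _ _ _) hPpow)
  have r1 : ∫ x, PP ε v D x ^ (p - 2) * fderiv ℝ φ x (D x) ∂μ = ∫ x in AA v1 v2 k,
      (2 * max (v2 x - v1 x - k) 0 * v x * (PP ε v D x ^ (p-2) * ⟪D2 x - D1 x, D x⟫) +
        max (v2 x - v1 x - k) 0 ^ 2 * (PP ε v D x ^ (p-2) * ‖D x‖ ^ 2)) ∂μ := by
    rw [← setIntegral_eq_integral_of_forall_compl_eq_zero (s := AA v1 v2 k)
      (fun x hx => by rw [hf0 x hx]; simp)]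
    refine setIntegral_congr_fun (H.mA k) fun x hx => ?_
    have hx' : k0 ≤ v2 x - v1 x := le_trans hk (le_of_lt hx)
    rw [t4 x ⟨⟨H.s1 x hx', H.s2 x hx'⟩, s x hx'⟩, H.fdw (H.s1 x hx') (H.s2 x hx'),
      d.fd x (s x hx'), real_inner_self_eq_norm_sq]
    ring
  rw [r1] at e1
  have hmx : Measurable fun x => max (v2 x - v1 x - k) 0 :=
    ((H.cw.sub continuous_const).max continuous_const).measurable
  have hSp : ∀ x, 0 ≤ SS ε v1 D1 v2 D2 x ^ p := fun x => rpow_nonneg (SS_nonneg _ _ _ _ _ _) _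
  have hDP : ∀ x, PP ε v D x ^ (p-2) * ‖D x‖ ^ 2 ≤ PP ε v D x ^ p := fun x => by
    rw [← rpow_two_mul_sq H.hp (PP_nonneg ε v D x)]
    have := norm_D_le H.d1.e0.le v D x
    have := rpow_nonneg (PP_nonneg ε v D x) (p-2)
    gcongr
  have hDP0 : ∀ x, 0 ≤ PP ε v D x ^ (p-2) * ‖D x‖ ^ 2 := fun x =>
    mul_nonneg (rpow_nonneg (PP_nonneg _ _ _ _) _) (sq_nonneg _)
  have hb1 : ∀ x, |2 * max (v2 x - v1 x - k) 0 * v x * (PP ε v D x ^ (p-2) * ⟪D2 x - D1 x, D x⟫)|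
      ≤ 2 * (SS ε v1 D1 v2 D2 x ^ (p-1) * NN ε v1 D1 v2 D2 x) := fun x => by
    have h0 := d.nn x
    have h1 := hm0 x
    rw [abs_mul, abs_of_nonneg (by positivity)]
    have : max (v2 x - v1 x - k) 0 * v x ≤ 1 := mul_le_one₀ (hm1 x) h0 (d.le1 x)
    have := mul_le_mul this (gb x) (abs_nonneg _) zero_le_one
    linarith
  have j1 : IntegrableOn (fun x => (2 * max (v2 x - v1 x - k) 0 * v x * (PP ε v D x ^ (p-2) * ⟪D2 x - D1 x, D x⟫) +
        max (v2 x - v1 x - k) 0 ^ 2 * (PP ε v D x ^ (p-2) * ‖D x‖ ^ 2))) (AA v1 v2 k) μ := by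
    refine H.iOn hk ?_ 3 fun x => ?_
    · exact (((hmx.const_mul 2).mul d.cont.measurable).mul ((d.measP.pow_const (p-2)).mul
        ((H.d2.measD.sub H.d1.measD).inner (𝕜 := ℝ) d.measD))).add
        ((hmx.pow_const 2).mul ((d.measP.pow_const (p-2)).mul (d.measD.norm.pow_const 2)))
    · refine (abs_add_le _ _).trans ?_
      have a1 := hb1 x
      have a2 := H.SN_le x
      have a3 : |max (v2 x - v1 x - k) 0 ^ 2 * (PP ε v D x ^ (p-2) * ‖D x‖ ^ 2)| ≤
          1 * SS ε v1 D1 v2 D2 x ^ p := by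
        rw [abs_of_nonneg (mul_nonneg (sq_nonneg _) (hDP0 x))]
        exact mul_le_mul (hq x) ((hDP x).trans (hPpow' x)) (hDP0 x) zero_le_one
      have := hSp x
      linarith
  have j2 : IntegrableOn (fun x => max (v2 x - v1 x - k) 0 ^ 2 * PP ε v D x ^ p) (AA v1 v2 k) μ := by
    refine H.iOn hk ((hmx.pow_const 2).mul (d.measP.pow_const p)) 1 fun x => ?_
    have z := rpow_nonneg (PP_nonneg ε v D x) p
    rw [abs_of_nonneg (mul_nonneg (sq_nonneg _) z)]
    have := mul_le_mul (hq x) (hPpow' x) z zero_le_one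
    linarith
  have hle : ∫ x in AA v1 v2 k, max (v2 x - v1 x - k) 0 ^ 2 * PP ε v D x ^ p ∂μ ≤
      ∫ x in AA v1 v2 k, ((2 * max (v2 x - v1 x - k) 0 * v x * (PP ε v D x ^ (p-2) * ⟪D2 x - D1 x, D x⟫) +
        max (v2 x - v1 x - k) 0 ^ 2 * (PP ε v D x ^ (p-2) * ‖D x‖ ^ 2)) +
        ((1 + SS ε v1 D1 v2 D2 x ^ (p-1)) + 2 * (SS ε v1 D1 v2 D2 x ^ (p-1) * NN ε v1 D1 v2 D2 x))) ∂μ := by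
    refine setIntegral_mono j2 (j1.add ((H.iS1 hk).add ((H.iSN hk).const_mul 2))) fun x => ?_
    have a1 := neg_le_of_abs_le (hb1 x)
    have z := PP_nonneg ε v D x
    have e : PP ε v D x ^ p = PP ε v D x ^ (p-2) * (ε * v x ^ 2) + PP ε v D x ^ (p-2) * ‖D x‖ ^ 2 := by
      rw [← rpow_two_mul_sq H.hp z, PP_sq H.d1.e0.le]; ring
    have e2 : PP ε v D x ^ (p-2) * (ε * v x ^ 2) ≤ PP ε v D x ^ (p-1) := by
      rw [← rpow_two_mul_self H.hp z]
      refine mul_le_mul_of_nonneg_left ?_ (rpow_nonneg z _)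
      have h3 := v_le_PP H.d1.e0.le v D x
      rw [abs_of_nonneg (d.nn x)] at h3
      have h4 : √ε * v x ≤ 1 := mul_le_one₀ (by rw [Real.sqrt_le_one]; exact H.d1.e1) (d.nn x) (d.le1 x)
      have h5 : ε * v x ^ 2 = (√ε * v x) * (√ε * v x) := by
        rw [show (√ε * v x) * (√ε * v x) = (√ε * √ε) * v x ^ 2 by ring, Real.mul_self_sqrt H.d1.e0.le]
      rw [h5]
      have h6 : 0 ≤ √ε * v x := mul_nonneg (Real.sqrt_nonneg _) (d.nn x)
      nlinarith
    have e3 := mul_le_mul (hq x) (e2.trans (hPpow x))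
      (mul_nonneg (rpow_nonneg z _) (mul_nonneg H.d1.e0.le (sq_nonneg _))) zero_le_one
    simp only [Pi.add_apply]
    rw [e]
    linarith
  rw [integral_add (by exact j1) (by exact ((H.iS1 hk).add ((H.iSN hk).const_mul 2))),
    integral_add (H.iS1 hk) ((H.iSN hk).const_mul 2), integral_const_mul] at hle
  have := abs_le.1 e1
  linarith

lemma ineq2 {k d : ℝ} (hk : k0 ≤ k) (hd : 0 < d) :
    d ^ 2 * ∫ x in AA v1 v2 (k+d), SS ε v1 D1 v2 D2 x ^ p ∂μ ≤
     2 ^ p * (2 * (1 + C) * (∫ x in AA v1 v2 k, (1 + SS ε v1 D1 v2 D2 x ^ (p-1)) ∂μ) +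
     4 * ∫ x in AA v1 v2 k, SS ε v1 D1 v2 D2 x ^ (p-1) * NN ε v1 D1 v2 D2 x ∂μ) := by
  have q1 := H.ineq2a H.d1 H.l1 H.s1 H.P1le hk
  have q2 := H.ineq2a H.d2 H.l2 H.s2 H.P2le hk
  have hmx : Measurable fun x => max (v2 x - v1 x - k) 0 :=
    ((H.cw.sub continuous_const).max continuous_const).measurable
  have hq : ∀ x, max (v2 x - v1 x - k) 0 ^ 2 ≤ 1 := fun x => by
    nlinarith [H.mx_le hk x, le_max_right (v2 x - v1 x - k) 0]
  have j : ∀ P : E → ℝ, Measurable P → (∀ x, 0 ≤ P x) → (∀ x, P x ≤ SS ε v1 D1 v2 D2 x) →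
     IntegrableOn (fun x => max (v2 x - v1 x - k) 0 ^ 2 * P x ^ p) (AA v1 v2 k) μ := by
    intro P mP hP0 hPS
    refine H.iOn hk ((hmx.pow_const 2).mul (mP.pow_const p)) 1 fun x => ?_
    have z := rpow_nonneg (hP0 x) p
    rw [abs_of_nonneg (mul_nonneg (sq_nonneg _) z)]
    have := mul_le_mul (hq x) (rpow_le_rpow (hP0 x) (hPS x) (by linarith [H.hp])) z zero_le_one
    linarith
  have j1 := j _ H.d1.measP (PP_nonneg _ _ _) H.P1le
  have j2 := j _ H.d2.measP (PP_nonneg _ _ _) H.P2le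
  have j3 := j _ H.mS (SS_nonneg _ _ _ _ _) (fun x => le_rfl)
  have hsub : AA v1 v2 (k+d) ⊆ AA v1 v2 k := fun x (hx : k + d < _) =>
    (by linarith : k < v2 x - v1 x)
  have hS := fun x => rpow_nonneg (SS_nonneg ε v1 D1 v2 D2 x) p
  have l1 : ∫ x in AA v1 v2 (k+d), d ^ 2 * SS ε v1 D1 v2 D2 x ^ p ∂μ ≤
     ∫ x in AA v1 v2 (k+d), max (v2 x - v1 x - k) 0 ^ 2 * SS ε v1 D1 v2 D2 x ^ p ∂μ := by
    refine setIntegral_mono_on (H.iSp.integrableOn.const_mul _) (j3.mono_set hsub) (H.mA _)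
      fun x (hx : k + d < _) => ?_
    refine mul_le_mul_of_nonneg_right ?_ (hS x)
    have := le_max_left (v2 x - v1 x - k) 0
    gcongr
    linarith
  have l2 : ∫ x in AA v1 v2 (k+d), max (v2 x - v1 x - k) 0 ^ 2 * SS ε v1 D1 v2 D2 x ^ p ∂μ ≤
     ∫ x in AA v1 v2 k, max (v2 x - v1 x - k) 0 ^ 2 * SS ε v1 D1 v2 D2 x ^ p ∂μ :=
    setIntegral_mono_set j3 (Filter.Eventually.of_forall fun x =>
      mul_nonneg (sq_nonneg _) (hS x))
      (Filter.Eventually.of_forall hsub)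
  have l3 : ∫ x in AA v1 v2 k, max (v2 x - v1 x - k) 0 ^ 2 * SS ε v1 D1 v2 D2 x ^ p ∂μ ≤
     ∫ x in AA v1 v2 k, 2 ^ p * (max (v2 x - v1 x - k) 0 ^ 2 * PP ε v1 D1 x ^ p +
       max (v2 x - v1 x - k) 0 ^ 2 * PP ε v2 D2 x ^ p) ∂μ := by
    refine setIntegral_mono j3 ((j1.add j2).const_mul _) fun x => ?_
    have := mul_le_mul_of_nonneg_left (add_rpow_le' H.hp (PP_nonneg ε v1 D1 x) (PP_nonneg ε v2 D2 x))
      (sq_nonneg (max (v2 x - v1 x - k) 0))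
    simp only [SS]
    linarith
  rw [integral_const_mul] at l1 l3
  rw [integral_add j1 j2] at l3
  refine (l1.trans (l2.trans l3)).trans ?_
  refine mul_le_mul_of_nonneg_left ?_ (by positivity)
  linarith

end PairH
end PF

section PF
set_option linter.unusedSectionVars false
variable {E : Type*} [NormedAddCommGroup E] [InnerProductSpace ℝ E] [FiniteDimensional ℝ E]
  [CompleteSpace E] [MeasurableSpace E] [BorelSpace E]
variable {p C ε k0 : ℝ} {Ω1 : Set E} {v1 : E → ℝ} {D1 : E → E}
    {Ω2 : Set E} {v2 : E → ℝ} {D2 : E → E} {μ : Measure E} [μ.IsAddHaarMeasure]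

lemma comb_real {C t d κ q P CS K X X₁ X₂ X₃ a a₂ a₃ I I₁ Y M m : ℝ} (hC : 0 ≤ C) (ht : 0 < t)
    (ht1 : t ≤ 1) (hd : 0 < d) (hd1 : d ≤ 1) (hκ : 0 < κ) (hq1 : 1 ≤ q) (hP : 0 ≤ P) (hCS0 : 0 ≤ CS)
    (hK : K = P * (4 * (1 + C) + 4 * (1 + 2 * κ⁻¹ * (2 + C))))
    (q1 : d * M ≤ (2 + C) * I)
    (q2 : d ^ 2 * X₂ ≤ P * (2 * (1 + C) * I₁ + 4 * Y))
    (q3 : a₃ ≤ (CS * (d⁻¹ ^ 2 * (a₂ + X₂))) ^ q)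
    (Yb : Y ≤ t * X₁ + κ⁻¹ * (t⁻¹ * M))
    (Ib : I ≤ t ^ 2 * X + (1 + t * m) * a) (Im : I₁ ≤ I) (X1 : X₁ ≤ X) (X3 : X₃ ≤ X₂) (a2 : a₂ ≤ a)
    (hX0 : 0 ≤ X) (hX20 : 0 ≤ X₂) (ha0 : 0 ≤ a) (ha20 : 0 ≤ a₂) (hm2 : 1 ≤ t * m) (hm3 : 1 ≤ m) :
    X₃ ≤ ((1+K)*(1+CS)) * d⁻¹ ^ 5 * (t * X + m * a) ∧
    a₃ ≤ (((1+K)*(1+CS)) * d⁻¹ ^ 5 * (t * X + m * a)) ^ q := by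
  have hK0 : 0 ≤ K := by rw [hK]; positivity
  obtain ⟨Z, hZ⟩ : ∃ Z, Z = t * X + m * a := ⟨_, rfl⟩
  have hZ0 : 0 ≤ Z := by rw [hZ]; positivity
  have haZ : a ≤ Z := by rw [hZ]; nlinarith only [mul_nonneg ht.le hX0, hm3, ha0]
  have hXZ : t * X ≤ Z := by rw [hZ]; nlinarith only [hm3, ha0]
  obtain ⟨D, hD⟩ : ∃ D, D = d⁻¹ := ⟨_, rfl⟩
  have hDd : D * d = 1 := by rw [hD]; exact inv_mul_cancel₀ hd.ne'
  have hD1 : 1 ≤ D := by rw [hD]; exact (one_le_inv₀ hd).2 hd1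
  have hI : I ≤ 2 * t * Z := by
    have h1 : a ≤ t * m * a := le_mul_of_one_le_left ha0 hm2
    have h2 : 0 ≤ t ^ 2 * X := by positivity
    have h3 : 2 * t * Z = 2 * (t ^ 2 * X) + 2 * (t * m * a) := by rw [hZ]; ring
    rw [h3]; linarith
  have hI' : I ≤ 2 * Z := by nlinarith only [hI, hZ0, ht1]
  have hM : M ≤ D * ((2 + C) * (2 * t * Z)) := by
    have h1 : d * M ≤ (2 + C) * (2 * t * Z) := q1.trans (by gcongr)
    calc M = D * (d * M) := by rw [← mul_assoc, hDd, one_mul]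
      _ ≤ _ := by gcongr
  have hY : Y ≤ D * ((1 + 2 * κ⁻¹ * (2 + C)) * Z) := by
    have h1 : κ⁻¹ * (t⁻¹ * M) ≤ κ⁻¹ * (t⁻¹ * (D * ((2 + C) * (2 * t * Z)))) := by gcongr
    have h2 : κ⁻¹ * (t⁻¹ * (D * ((2 + C) * (2 * t * Z)))) = D * (2 * κ⁻¹ * (2 + C) * Z) := by
      field_simp
    have h3 : t * X₁ ≤ t * X := by gcongr
    have h4 : Z ≤ D * Z := le_mul_of_one_le_left hZ0 hD1
    have h5 : D * ((1 + 2 * κ⁻¹ * (2 + C)) * Z) = D * Z + D * (2 * κ⁻¹ * (2 + C) * Z) := by ring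
    rw [h5]; linarith
  have hX2 : X₂ ≤ K * D ^ 3 * Z := by
    have h1 : d ^ 2 * X₂ ≤ K * (D * Z) := by
      refine q2.trans ?_
      rw [hK, mul_assoc P]
      refine mul_le_mul_of_nonneg_left ?_ hP
      have h2 : (1 + C) * I₁ ≤ (1 + C) * (2 * Z) := by gcongr; linarith
      have h3 : (1 + C) * (2 * Z) ≤ (1 + C) * (2 * (D * Z)) := by
        gcongr; exact le_mul_of_one_le_left hZ0 hD1
      have h6 : (4 * (1 + C) + 4 * (1 + 2 * κ⁻¹ * (2 + C))) * (D * Z) =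
        2 * ((1 + C) * (2 * (D * Z))) + 4 * (D * ((1 + 2 * κ⁻¹ * (2 + C)) * Z)) := by ring
      rw [h6]; linarith
    calc X₂ = D ^ 2 * (d ^ 2 * X₂) := by rw [← mul_assoc, ← mul_pow, hDd]; ring
      _ ≤ D ^ 2 * (K * (D * Z)) := by gcongr
      _ = _ := by ring
  have hD3 : D ^ 3 ≤ D ^ 5 := pow_le_pow_right₀ hD1 (by norm_num)
  have hD3' : 1 ≤ D ^ 3 := one_le_pow₀ hD1
  rw [← hD] at q3 ⊢
  rw [← hZ]
  refine ⟨?_, q3.trans ?_⟩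
  · refine X3.trans (hX2.trans ?_)
    have : K ≤ (1 + K) * (1 + CS) := by nlinarith [mul_nonneg hK0 hCS0]
    gcongr
  · have e : CS * (D ^ 2 * (a₂ + X₂)) ≤ (1 + K) * (1 + CS) * D ^ 5 * Z := by
      have h1 : a₂ + X₂ ≤ (1 + K) * D ^ 3 * Z := by
        have : Z ≤ D ^ 3 * Z := le_mul_of_one_le_left hZ0 hD3'
        linarith
      calc CS * (D ^ 2 * (a₂ + X₂)) ≤ (1 + CS) * (D ^ 2 * ((1 + K) * D ^ 3 * Z)) := by
            gcongr; linarith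
        _ = _ := by ring
    apply rpow_le_rpow _ e (by linarith)
    positivity

namespace PairH
variable (H : PairH p C ε k0 Ω1 v1 D1 Ω2 v2 D2 μ)
include H

lemma iSp1 {k : ℝ} (hk : k0 ≤ k) :
    IntegrableOn (fun x => 1 + SS ε v1 D1 v2 D2 x ^ p) (AA v1 v2 k) μ :=
  (integrableOn_const (H.finA hk).ne).add H.iSp.integrableOn

lemma int1 {k : ℝ} (hk : k0 ≤ k) :
    ∫ x in AA v1 v2 k, (1 + SS ε v1 D1 v2 D2 x ^ p) ∂μ =
      μ.real (AA v1 v2 k) + ∫ x in AA v1 v2 k, SS ε v1 D1 v2 D2 x ^ p ∂μ := by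
  rw [integral_add (by exact integrableOn_const (H.finA hk).ne) H.iSp.integrableOn]
  simp

lemma ineq3 {q : ℝ} (hq : (Module.finrank ℝ E : ℝ).HolderConjugate q) {k d : ℝ} (hk : k0 ≤ k) (hd : 0 < d) :
    μ.real (AA v1 v2 (k+d)) ≤ (2 * (1 + lintegralPowLePowLIntegralFDerivConst μ q) *
      (d⁻¹ ^ 2 * (μ.real (AA v1 v2 k) + ∫ x in AA v1 v2 k, SS ε v1 D1 v2 D2 x ^ p ∂μ))) ^ q := by
  have hq1 : 1 < q := hq.symm.lt
  obtain ⟨t1, t2, t3, t4, t5⟩ := test_mk (H.d1.opn.inter H.d2.opn) H.cw H.cdw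
    (contDiffOn_const (c := (1:ℝ))) (hasDerivAt_sqp k) (by fun_prop) (k := k)
    (fun s hs => by rw [max_eq_right (by linarith)]; norm_num) (H.cpt hk)
    (fun x hx => ⟨H.s1 x (le_trans hk hx), H.s2 x (le_trans hk hx)⟩)
  set φ : E → ℝ := fun x => max (v2 x - v1 x - k) 0 ^ 2 * 1 with hφ
  set CS := lintegralPowLePowLIntegralFDerivConst μ q
  have hS := lintegral_pow_le_pow_lintegral_fderiv μ t1 t2 hq
  set T := ∫ x in AA v1 v2 k, (1 + SS ε v1 D1 v2 D2 x ^ p) ∂μ with hT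
  have hSp := fun x => rpow_nonneg (SS_nonneg ε v1 D1 v2 D2 x) p
  have hT0 : 0 ≤ T := setIntegral_nonneg (H.mA k) fun x _ => by linarith [hSp x]
  rw [← H.int1 hk, ← hT]
  have hder : ∫⁻ x, ‖fderiv ℝ φ x‖ₑ ∂μ ≤ ENNReal.ofReal (2 * T) := by
    rw [hT, ← integral_const_mul, ofReal_integral_eq_lintegral_ofReal ((H.iSp1 hk).const_mul 2)
      (Filter.Eventually.of_forall fun x => by have := hSp x; simp only [Pi.zero_apply]; linarith)]
    rw [← lintegral_indicator (H.mA k)]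
    refine lintegral_mono fun x => ?_
    by_cases hx : x ∈ AA v1 v2 k
    · rw [indicator_of_mem hx, ← ofReal_norm_eq_enorm]
      apply ENNReal.ofReal_le_ofReal
      have hx' : k0 ≤ v2 x - v1 x := le_trans hk (le_of_lt hx)
      have hS0 := SS_nonneg ε v1 D1 v2 D2 x
      have h1 : SS ε v1 D1 v2 D2 x ≤ 1 + SS ε v1 D1 v2 D2 x ^ p := by
        rcases le_total (SS ε v1 D1 v2 D2 x) 1 with h | h
        · linarith [hSp x]
        · have := rpow_le_rpow_of_exponent_le h H.hp.le
          rw [rpow_one] at this; linarith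
      refine ContinuousLinearMap.opNorm_le_bound _ (by linarith [hSp x]) fun y => ?_
      rw [t4 x ⟨H.s1 x hx', H.s2 x hx'⟩, H.fdw (H.s1 x hx') (H.s2 x hx')]
      simp only [mul_one, fderiv_fun_const, Pi.zero_apply, ContinuousLinearMap.zero_apply, mul_zero,
        add_zero]
      have hm0 : 0 ≤ max (v2 x - v1 x - k) 0 := le_max_right _ _
      rw [Real.norm_eq_abs, abs_mul, abs_of_nonneg (by positivity)]
      have b1 := abs_real_inner_le_norm (D2 x - D1 x) y
      have b2 := (H.DD_le x).trans ((H.NN_le x).trans h1)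
      have b3 : |⟪D2 x - D1 x, y⟫| ≤ (1 + SS ε v1 D1 v2 D2 x ^ p) * ‖y‖ :=
        b1.trans (mul_le_mul_of_nonneg_right b2 (norm_nonneg _))
      have := mul_le_mul (H.mx_le hk x) b3 (abs_nonneg _) zero_le_one
      linarith
    · rw [indicator_of_notMem hx, t5 x (le_of_not_gt hx), ← ofReal_norm_eq_enorm, norm_zero, ENNReal.ofReal_zero]
  have hlow : ENNReal.ofReal ((d ^ 2) ^ q) * μ (AA v1 v2 (k+d)) ≤ ∫⁻ x, ‖φ x‖ₑ ^ q ∂μ := by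
    calc _ ≤ ENNReal.ofReal ((d ^ 2) ^ q) * μ {x | ENNReal.ofReal ((d ^ 2) ^ q) ≤ ‖φ x‖ₑ ^ q} := by
          gcongr
          intro x (hx : k + d < _)
          show ENNReal.ofReal ((d ^ 2) ^ q) ≤ ‖φ x‖ₑ ^ q
          rw [← ofReal_norm_eq_enorm, ENNReal.ofReal_rpow_of_nonneg (norm_nonneg _) (by linarith)]
          apply ENNReal.ofReal_le_ofReal
          have h1 : d ≤ max (v2 x - v1 x - k) 0 := le_trans (by linarith) (le_max_left _ _)
          have h2 : d ^ 2 ≤ ‖φ x‖ := by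
            simp only [hφ, mul_one]
            rw [Real.norm_eq_abs, abs_of_nonneg (sq_nonneg _)]
            gcongr
          gcongr
      _ ≤ _ := mul_meas_ge_le_lintegral₀ (t1.continuous.measurable.enorm.pow_const q).aemeasurable _
  have h3 : ENNReal.ofReal ((d ^ 2) ^ q) * μ (AA v1 v2 (k+d)) ≤ CS * ENNReal.ofReal (2 * T) ^ q :=
    hlow.trans (hS.trans (by gcongr))
  rw [ENNReal.ofReal_rpow_of_nonneg (by linarith) (by linarith)] at h3
  have h4 := ENNReal.toReal_mono (by finiteness) h3
  rw [ENNReal.toReal_mul, ENNReal.toReal_mul, ENNReal.toReal_ofReal (by positivity),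
    ENNReal.toReal_ofReal (by positivity), ENNReal.coe_toReal] at h4
  change (d ^ 2) ^ q * μ.real (AA v1 v2 (k+d)) ≤ CS * (2 * T) ^ q at h4
  have hCS : (CS : ℝ) ≤ (1 + CS) ^ q := by
    have : (1 + CS : ℝ) ^ (1:ℝ) ≤ (1 + CS) ^ q :=
      rpow_le_rpow_of_exponent_le (by have := CS.2; simp) hq1.le
    rw [rpow_one] at this; linarith
  have e : 2 * (1 + (CS:ℝ)) * (d⁻¹ ^ 2 * T) = (1 + CS) * (2 * T) / d ^ 2 := by
    field_simp
  rw [e, div_rpow (by positivity) (by positivity), mul_rpow (by positivity) (by positivity),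
    le_div_iff₀ (by positivity), mul_comm]
  exact h4.trans (by gcongr)

lemma comb {q : ℝ} (hq : (Module.finrank ℝ E : ℝ).HolderConjugate q) {CS K : ℝ}
    (hCS : CS = 2 * (1 + lintegralPowLePowLIntegralFDerivConst μ q))
    (hK : K = 2 ^ p * (4 * (1 + C) + 4 * (1 + 2 * (kap p)⁻¹ * (2 + C))))
    {k d t : ℝ} (hk : k0 ≤ k) (hd : 0 < d) (hd1 : d ≤ 1) (ht : 0 < t) (ht1 : t ≤ 1) :
    (∫ x in AA v1 v2 (k+3*d), SS ε v1 D1 v2 D2 x ^ p ∂μ ≤ ((1+K)*(1+CS)) * d⁻¹ ^ 5 *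
      (t * (∫ x in AA v1 v2 k, SS ε v1 D1 v2 D2 x ^ p ∂μ) + t ^ (1-2*p) * μ.real (AA v1 v2 k))) ∧
    (μ.real (AA v1 v2 (k+3*d)) ≤ (((1+K)*(1+CS)) * d⁻¹ ^ 5 *
      (t * (∫ x in AA v1 v2 k, SS ε v1 D1 v2 D2 x ^ p ∂μ) + t ^ (1-2*p) * μ.real (AA v1 v2 k))) ^ q) := by
  have hκ := kap_pos H.hp
  have hC := H.hC
  have hp := H.hp
  have hq1 : 1 < q := hq.symm.lt
  have q1 := H.ineq1 hk hd
  have q2 := H.ineq2 (k := k + d) (by linarith) hd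
  have q3 := H.ineq3 hq (k := k + 2 * d) (by linarith) hd
  rw [show k + d + d = k + 2 * d by ring] at q2
  rw [show k + 2 * d + d = k + 3 * d by ring] at q3
  rw [← hCS] at q3
  have sub : ∀ {k l : ℝ}, k ≤ l → AA v1 v2 l ⊆ AA v1 v2 k := fun {k l} h x (hx : l < _) =>
    (lt_of_le_of_lt h hx : k < v2 x - v1 x)
  have hSp := fun x => rpow_nonneg (SS_nonneg ε v1 D1 v2 D2 x) p
  have hSp1 := fun x => rpow_nonneg (SS_nonneg ε v1 D1 v2 D2 x) (p-1)
  have Xm : ∀ {k l : ℝ}, k ≤ l → ∫ x in AA v1 v2 l, SS ε v1 D1 v2 D2 x ^ p ∂μ ≤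
      ∫ x in AA v1 v2 k, SS ε v1 D1 v2 D2 x ^ p ∂μ := fun h =>
    setIntegral_mono_set H.iSp.integrableOn (Filter.Eventually.of_forall hSp)
      (Filter.Eventually.of_forall (sub h))
  have am : ∀ {l : ℝ}, k ≤ l → μ.real (AA v1 v2 l) ≤ μ.real (AA v1 v2 k) := fun h =>
    measureReal_mono (sub h) (H.finA hk).ne
  have Im : ∫ x in AA v1 v2 (k+d), (1 + SS ε v1 D1 v2 D2 x ^ (p-1)) ∂μ ≤
      ∫ x in AA v1 v2 k, (1 + SS ε v1 D1 v2 D2 x ^ (p-1)) ∂μ :=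
    setIntegral_mono_set (H.iS1 hk) (Filter.Eventually.of_forall fun x => by
      simp only [Pi.zero_apply]; linarith [hSp1 x])
      (Filter.Eventually.of_forall (sub (by linarith)))
  have Yb : ∫ x in AA v1 v2 (k+d), SS ε v1 D1 v2 D2 x ^ (p-1) * NN ε v1 D1 v2 D2 x ∂μ ≤
      t * (∫ x in AA v1 v2 (k+d), SS ε v1 D1 v2 D2 x ^ p ∂μ) + (kap p)⁻¹ * (t⁻¹ *
        ∫ x in AA v1 v2 (k+d), MM p ε v1 D1 v2 D2 x ∂μ) := by
    have hkd : k0 ≤ k + d := by linarith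
    have : ∫ x in AA v1 v2 (k+d), SS ε v1 D1 v2 D2 x ^ (p-1) * NN ε v1 D1 v2 D2 x ∂μ ≤
       ∫ x in AA v1 v2 (k+d), (t * SS ε v1 D1 v2 D2 x ^ p + (kap p)⁻¹ * (t⁻¹ * MM p ε v1 D1 v2 D2 x)) ∂μ := by
      refine setIntegral_mono (H.iSN hkd) ((H.iSp.integrableOn.const_mul t).add
        (((H.iM hkd).const_mul _).const_mul _)) fun x => ?_
      have := mon_young hp ht (VV ε v2 D2 x) (VV ε v1 D1 x)
      rw [norm_VV H.d1.e0.le, norm_VV H.d1.e0.le, add_comm (PP ε v2 D2 x)] at this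
      exact this
    rwa [integral_add (H.iSp.integrableOn.const_mul t) (((H.iM hkd).const_mul _).const_mul _),
      integral_const_mul, integral_const_mul, integral_const_mul] at this
  have Ib : ∫ x in AA v1 v2 k, (1 + SS ε v1 D1 v2 D2 x ^ (p-1)) ∂μ ≤
      t^2 * (∫ x in AA v1 v2 k, SS ε v1 D1 v2 D2 x ^ p ∂μ) + (1 + (t^2)^(-(p-1))) * μ.real (AA v1 v2 k) := by
    have : ∫ x in AA v1 v2 k, (1 + SS ε v1 D1 v2 D2 x ^ (p-1)) ∂μ ≤
       ∫ x in AA v1 v2 k, (t^2 * SS ε v1 D1 v2 D2 x ^ p + (1 + (t^2)^(-(p-1)))) ∂μ := by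
      refine setIntegral_mono (H.iS1 hk) ((H.iSp.integrableOn.const_mul _).add
        (integrableOn_const (H.finA hk).ne)) fun x => ?_
      have := rpow_young (t := t^2) hp (by positivity) (SS_nonneg ε v1 D1 v2 D2 x)
      simp only
      linarith
    rw [integral_add (H.iSp.integrableOn.const_mul _) (by exact integrableOn_const (H.finA hk).ne),
      integral_const_mul] at this
    simp only [integral_const, smul_eq_mul, measureReal_restrict_apply_univ] at this
    linarith
  have X1 := Xm (show k ≤ k + d by linarith)
  have X3 := Xm (show k + 2*d ≤ k + 3*d by linarith)
  have a2 := am (show k ≤ k + 2 * d by linarith)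
  have hX0 : 0 ≤ ∫ x in AA v1 v2 k, SS ε v1 D1 v2 D2 x ^ p ∂μ := integral_nonneg hSp
  have hX20 : 0 ≤ ∫ x in AA v1 v2 (k+2*d), SS ε v1 D1 v2 D2 x ^ p ∂μ := integral_nonneg hSp
  have ha0 : 0 ≤ μ.real (AA v1 v2 k) := measureReal_nonneg
  have ha20 : 0 ≤ μ.real (AA v1 v2 (k+2*d)) := measureReal_nonneg
  have hm1 : (t^2)^(-(p-1)) = t * t ^ (1 - 2*p) := by
    rw [← rpow_natCast, ← rpow_mul ht.le]
    nth_rewrite 2 [← rpow_one t]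
    rw [← rpow_add ht]
    congr 1; push_cast; ring
  have hm2 : 1 ≤ t * t ^ (1 - 2*p) := by
    rw [← hm1]
    exact one_le_rpow_of_pos_of_le_one_of_nonpos (by positivity) (by nlinarith) (by linarith)
  have hm3 : 1 ≤ t ^ (1 - 2*p) := one_le_rpow_of_pos_of_le_one_of_nonpos ht ht1 (by linarith)
  rw [hm1] at Ib
  have hCS0 : 0 ≤ CS := by rw [hCS]; positivity
  have hK0 : 0 ≤ K := by rw [hK]; positivity
  exact comb_real hC ht ht1 hd hd1 hκ hq1.le (by positivity) hCS0 hK q1 q2 q3 Yb Ib Im X1 X3 a2 hX0 hX20 ha0 ha20 hm2 hm3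

end PairH
end PF

section PK
set_option linter.unusedSectionVars false

noncomputable def kp (δ s : ℝ) : ℝ := √(max s 0 ^ 2 + δ ^ 2) - δ
noncomputable def kp' (δ s : ℝ) : ℝ := max s 0 / √(max s 0 ^ 2 + δ ^ 2)

lemma kp_deriv {δ : ℝ} (hδ : 0 < δ) (s : ℝ) : HasDerivAt (kp δ) (kp' δ s) s := by
  have h1 := hasDerivAt_sqp 0 s
  simp only [sub_zero] at h1
  have h2 := ((h1.add_const (δ ^ 2)).sqrt (by positivity)).sub_const δ
  have : kp' δ s = 2 * max s 0 / (2 * √(max s 0 ^ 2 + δ ^ 2)) := by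
    rw [kp', mul_div_mul_left _ _ two_ne_zero]
  rw [this]
  exact h2

lemma kp'_cont {δ : ℝ} (hδ : 0 < δ) : Continuous (kp' δ) := by
  unfold kp'
  refine Continuous.div (by fun_prop) (by fun_prop) fun s => ?_
  positivity

lemma kp_zero {δ s : ℝ} (hδ : 0 < δ) (hs : s ≤ 0) : kp δ s = 0 := by
  simp [kp, max_eq_right hs, Real.sqrt_sq hδ.le]

lemma kp'_nonneg {δ s : ℝ} : 0 ≤ kp' δ s := div_nonneg (le_max_right _ _) (Real.sqrt_nonneg _)

lemma kp'_le {δ s : ℝ} : kp' δ s ≤ 1 := by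
  apply div_le_one_of_le₀ _ (Real.sqrt_nonneg _)
  apply Real.le_sqrt_of_sq_le; nlinarith [sq_nonneg δ]

lemma kp_le {δ s : ℝ} (hδ : 0 < δ) : kp δ s ≤ max s 0 := by
  have h0 : 0 ≤ max s 0 := le_max_right _ _
  have : √(max s 0 ^ 2 + δ ^ 2) ≤ max s 0 + δ := by
    rw [Real.sqrt_le_left (by positivity)]; nlinarith
  unfold kp; linarith

lemma kp_ge {δ s : ℝ} : max s 0 - δ ≤ kp δ s := by
  have : max s 0 ≤ √(max s 0 ^ 2 + δ ^ 2) := by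
    apply Real.le_sqrt_of_sq_le; nlinarith [sq_nonneg δ]
  unfold kp; linarith

lemma kp_nonneg {δ s : ℝ} (hδ : 0 < δ) : 0 ≤ kp δ s := by
  have : δ ≤ √(max s 0 ^ 2 + δ ^ 2) := by
    apply Real.le_sqrt_of_sq_le; nlinarith [sq_nonneg (max s 0)]
  unfold kp; linarith

lemma kp_err {δ s : ℝ} (hδ : 0 < δ) : |kp δ s - kp' δ s * (s + δ)| ≤ 2 * δ := by
  rcases le_total s 0 with h | h
  · rw [kp_zero hδ h, kp', max_eq_right h]; simp; linarith
  · have h1 : kp δ s - kp' δ s * s = δ ^ 2 / √(s ^ 2 + δ ^ 2) - δ := by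
      rw [kp, kp', max_eq_left h]
      have : 0 < √(s ^ 2 + δ ^ 2) := by positivity
      have h9 := Real.mul_self_sqrt (show 0 ≤ s^2+δ^2 by positivity)
      field_simp
      linear_combination h9
    have h2 : δ ^ 2 / √(s ^ 2 + δ ^ 2) ≤ δ := by
      rw [div_le_iff₀ (by positivity)]
      have : δ ≤ √(s ^ 2 + δ ^ 2) := by
        apply Real.le_sqrt_of_sq_le; nlinarith
      nlinarith
    have h3 : 0 ≤ δ ^ 2 / √(s ^ 2 + δ ^ 2) := by positivity
    have h4 := kp'_nonneg (δ := δ) (s := s)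
    have h5 := kp'_le (δ := δ) (s := s)
    rw [abs_le]; constructor <;> nlinarith

variable {E : Type*} [NormedAddCommGroup E] [InnerProductSpace ℝ E] [FiniteDimensional ℝ E]
  [CompleteSpace E] [MeasurableSpace E] [BorelSpace E]
variable {p C ε : ℝ} {Ω : Set E} {v : E → ℝ} {D : E → E} {μ : Measure E} [μ.IsAddHaarMeasure]

/-- The regularized truncation of `v` as a test function. -/
lemma Dat.trunc (d : Dat ε Ω v D) {δ : ℝ} (hδ : 0 < δ) :
    ContDiff ℝ 1 (fun x => kp δ (v x - δ)) ∧ HasCompactSupport (fun x => kp δ (v x - δ)) ∧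
    tsupport (fun x => kp δ (v x - δ)) ⊆ Ω ∧
    (∀ x y, fderiv ℝ (fun x => kp δ (v x - δ)) x y = kp' δ (v x - δ) * ⟪D x, y⟫) := by
  have hcl : IsClosed {x | δ ≤ v x} := isClosed_le continuous_const d.cont
  have hsub : {x | δ ≤ v x} ⊆ Ω := fun x (hx : δ ≤ v x) => by
    by_contra h; rw [d.off x h] at hx; linarith
  have hK : IsCompact {x | δ ≤ v x} :=
    Metric.isCompact_of_isClosed_isBounded hcl (d.bdd.subset hsub)
  obtain ⟨t1, t2, t3, t4, t5⟩ := test_mk d.opn d.cont d.cd (contDiffOn_const (c := (1:ℝ)))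
    (θ := fun s => kp δ (s - δ)) (θ' := fun s => kp' δ (s - δ))
    (fun s => (kp_deriv hδ (s - δ)).comp_sub_const s δ) ((kp'_cont hδ).comp (by fun_prop)) (k := δ)
    (fun s hs => kp_zero hδ (by linarith)) hK hsub
  simp only [mul_one] at t1 t2 t3 t4 t5
  refine ⟨t1, t2, t3.trans hsub, fun x y => ?_⟩
  by_cases hx : x ∈ Ω
  · rw [t4 x hx y, d.fd x hx]; simp
  · rw [t5 x (by rw [d.off x hx]; exact hδ.le), d.Doff x hx]; simp

lemma l1_trans {f : E → ℝ} (hf : ContDiff ℝ 1 f) (h : E) :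
    ∫⁻ x, ‖f (x + h) - f x‖ₑ ∂μ ≤ ‖h‖ₑ * ∫⁻ x, ‖fderiv ℝ f x‖ₑ ∂μ := by
  have hcf : Continuous (fderiv ℝ f) := hf.continuous_fderiv (by norm_num)
  have h1 : ∀ x, ‖f (x + h) - f x‖ₑ ≤ ∫⁻ s in Set.Icc (0:ℝ) 1, ‖h‖ₑ * ‖fderiv ℝ f (x + s • h)‖ₑ := by
    intro x
    have hd : ∀ s : ℝ, HasDerivAt (fun s : ℝ => f (x + s • h)) (fderiv ℝ f (x + s • h) h) s := by
      intro s
      have a1 : HasDerivAt (fun s : ℝ => x + s • h) h s := by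
        simpa using ((hasDerivAt_id s).smul_const h).const_add x
      exact ((hf.differentiable (by norm_num)) _).hasFDerivAt.comp_hasDerivAt s a1
    have hc : Continuous (fun s : ℝ => fderiv ℝ f (x + s • h) h) := by fun_prop
    have e := intervalIntegral.integral_eq_sub_of_hasDerivAt (a := 0) (b := 1) (fun s _ => hd s)
      (hc.intervalIntegrable _ _)
    simp only [one_smul, zero_smul, add_zero] at e
    rw [← e, intervalIntegral.integral_of_le zero_le_one]
    calc _ ≤ ∫⁻ s in Ioc (0:ℝ) 1, ‖fderiv ℝ f (x + s • h) h‖ₑ := enorm_integral_le_lintegral_enorm _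
      _ ≤ ∫⁻ s in Icc (0:ℝ) 1, ‖fderiv ℝ f (x + s • h) h‖ₑ := lintegral_mono_set Ioc_subset_Icc_self
      _ ≤ _ := by
        refine lintegral_mono fun s => ?_
        rw [mul_comm]
        exact ContinuousLinearMap.le_opNorm_enorm _ _
  calc _ ≤ ∫⁻ x, ∫⁻ s in Set.Icc (0:ℝ) 1, ‖h‖ₑ * ‖fderiv ℝ f (x + s • h)‖ₑ ∂volume ∂μ := lintegral_mono h1
    _ = ∫⁻ s in Set.Icc (0:ℝ) 1, ∫⁻ x, ‖h‖ₑ * ‖fderiv ℝ f (x + s • h)‖ₑ ∂μ := by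
        rw [lintegral_lintegral_swap]
        apply Measurable.aemeasurable
        apply Measurable.const_mul
        have : Continuous (fun z : E × ℝ => ‖fderiv ℝ f (z.1 + z.2 • h)‖ₑ) := by
          apply Continuous.enorm
          exact hcf.comp (by fun_prop)
        exact this.measurable
    _ = ∫⁻ s in Set.Icc (0:ℝ) 1, ‖h‖ₑ * ∫⁻ x, ‖fderiv ℝ f x‖ₑ ∂μ := by
        congr 1; ext s
        rw [lintegral_const_mul' _ _ (by finiteness)]
        rw [lintegral_add_right_eq_self (fun x => ‖fderiv ℝ f x‖ₑ) (s • h)]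
    _ = _ := by simp

lemma Dat.level (d : Dat ε Ω v D) (hi : Integrable (fun x => ‖D x‖) μ) (h : E) {k : ℝ} (hk : 0 < k) :
    μ.real {x | k < v (x + h) - v x} ≤ 2 * k⁻¹ * (‖h‖ * ∫ x, ‖D x‖ ∂μ) := by
  obtain ⟨t1, t2, t3, t4⟩ := d.trunc (δ := k / 4) (by positivity)
  set f := fun x => kp (k/4) (v x - k/4) with hf
  have hfv : ∀ x, f x ≤ v x ∧ v x - k / 2 ≤ f x := fun x => by
    have h1 := kp_le (δ := k/4) (s := v x - k/4) (by positivity)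
    have h2 := kp_ge (δ := k/4) (s := v x - k/4)
    have h3 : max (v x - k/4) 0 ≤ v x := max_le (by linarith) (d.nn x)
    have h4 := le_max_left (v x - k/4) 0
    constructor <;> simp only [hf] <;> linarith
  have hfd : ∫⁻ x, ‖fderiv ℝ f x‖ₑ ∂μ ≤ ENNReal.ofReal (∫ x, ‖D x‖ ∂μ) := by
    rw [ofReal_integral_eq_lintegral_ofReal hi (Filter.Eventually.of_forall fun x => norm_nonneg _)]
    refine lintegral_mono fun x => ?_
    rw [← ofReal_norm_eq_enorm]
    apply ENNReal.ofReal_le_ofReal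
    refine ContinuousLinearMap.opNorm_le_bound _ (norm_nonneg _) fun y => ?_
    rw [t4, Real.norm_eq_abs, abs_mul, abs_of_nonneg kp'_nonneg]
    calc _ ≤ 1 * (‖D x‖ * ‖y‖) := mul_le_mul kp'_le (abs_real_inner_le_norm _ _) (abs_nonneg _) zero_le_one
      _ = _ := one_mul _
  have hD0 : 0 ≤ ∫ x, ‖D x‖ ∂μ := integral_nonneg fun x => norm_nonneg _
  have h1 : ENNReal.ofReal (k/2) * μ {x | k < v (x + h) - v x} ≤ ENNReal.ofReal (‖h‖ * ∫ x, ‖D x‖ ∂μ) := by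
    calc _ ≤ ENNReal.ofReal (k/2) * μ {x | ENNReal.ofReal (k/2) ≤ ‖f (x + h) - f x‖ₑ} := by
          refine mul_le_mul_right (measure_mono fun x (hx : k < _) => ?_) _
          show ENNReal.ofReal (k/2) ≤ ‖f (x + h) - f x‖ₑ
          rw [← ofReal_norm_eq_enorm]
          apply ENNReal.ofReal_le_ofReal
          refine le_trans ?_ (le_abs_self _)
          linarith [(hfv x).1, (hfv (x+h)).2]
      _ ≤ ∫⁻ x, ‖f (x + h) - f x‖ₑ ∂μ := mul_meas_ge_le_lintegral₀ (by
          have := t1.continuous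
          exact (((this.comp (continuous_add_right h)).sub this).enorm).measurable.aemeasurable) _
      _ ≤ ‖h‖ₑ * ∫⁻ x, ‖fderiv ℝ f x‖ₑ ∂μ := l1_trans t1 h
      _ ≤ ‖h‖ₑ * ENNReal.ofReal (∫ x, ‖D x‖ ∂μ) := by gcongr
      _ = _ := by rw [ENNReal.ofReal_mul (norm_nonneg _), ofReal_norm_eq_enorm]
  have h4 := ENNReal.toReal_mono (by finiteness) h1
  rw [ENNReal.toReal_mul, ENNReal.toReal_ofReal (by positivity),
    ENNReal.toReal_ofReal (by positivity)] at h4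
  change k / 2 * μ.real _ ≤ _ at h4
  calc _ = 2 * k⁻¹ * (k / 2 * μ.real {x | k < v (x + h) - v x}) := by field_simp
    _ ≤ _ := by gcongr

lemma Dat.shift (d : Dat ε Ω v D) (h : E) :
    Dat ε {x | x + h ∈ Ω} (fun x => v (x + h)) (fun x => D (x + h)) where
  opn := d.opn.preimage (continuous_add_right h)
  bdd := by
    have : {x | x + h ∈ Ω} = (fun y => y - h) '' Ω := by
      ext x; simp only [mem_setOf_eq, mem_image]
      exact ⟨fun hx => ⟨x + h, hx, by simp⟩, fun ⟨y, hy, e⟩ => by rw [← e]; simpa using hy⟩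
    rw [this]
    obtain ⟨R, hR⟩ := d.bdd.exists_norm_le
    refine isBounded_iff_forall_norm_le.2 ⟨R + ‖h‖, ?_⟩
    rintro _ ⟨y, hy, rfl⟩
    exact (norm_sub_le _ _).trans (by linarith [hR y hy])
  cont := d.cont.comp (continuous_add_right h)
  nn x := d.nn _
  le1 x := d.le1 _
  off x hx := d.off _ hx
  cd := d.cd.comp (by fun_prop) fun x hx => hx
  fd x hx y := by rw [fderiv_comp_add_right]; exact d.fd _ hx y
  Doff x hx := d.Doff _ hx
  e0 := d.e0
  e1 := d.e1

lemma ELp.shift (l : ELp p C ε Ω v D μ) (h : E) :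
    ELp p C ε {x | x + h ∈ Ω} (fun x => v (x + h)) (fun x => D (x + h)) μ := by
  intro φ h1 h2 h3
  have hts : tsupport (fun x => φ (x + -h)) = (Homeomorph.addRight (-h)) ⁻¹' tsupport φ :=
    tsupport_comp_eq_preimage φ (Homeomorph.addRight (-h))
  have q := l (fun x => φ (x + -h)) (h1.comp (by fun_prop)) (h2.comp_homeomorph (Homeomorph.addRight (-h)))
    (by
      rw [hts]
      intro x hx
      have := h3 hx
      simpa using this)
  rw [← integral_add_right_eq_self _ h, ← integral_add_right_eq_self (fun x => (1 + PP ε v D x ^ (p - 1)) * |φ (x + -h)|) h] at q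
  simp only [fderiv_comp_add_right, add_neg_cancel_right] at q
  exact q

end PK

section PI
set_option linter.unusedSectionVars false
variable {E : Type*} [NormedAddCommGroup E] [InnerProductSpace ℝ E] [FiniteDimensional ℝ E]
  [CompleteSpace E] [MeasurableSpace E] [BorelSpace E]
variable {p C ε : ℝ} {Ω : Set E} {v : E → ℝ} {D : E → E} {μ : Measure E} [μ.IsAddHaarMeasure]

lemma Dat.PPoff (d : Dat ε Ω v D) {x : E} (hx : x ∉ Ω) : PP ε v D x = 0 := by
  simp [PP, d.off x hx, d.Doff x hx]

lemma Dat.finΩ (d : Dat ε Ω v D) : μ Ω < ⊤ := d.bdd.measure_lt_top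

lemma le_one_add_rpow {p s : ℝ} (hp : 1 < p) (hs : 0 ≤ s) : s ≤ 1 + s ^ p := by
  rcases le_total s 1 with h | h
  · have : 0 ≤ s ^ p := rpow_nonneg hs _
    linarith
  · have := Real.self_le_rpow_of_one_le h hp.le
    linarith

lemma Dat.intD (d : Dat ε Ω v D) (hp : 1 < p) (hi : Integrable (fun x => PP ε v D x ^ p) μ) :
    Integrable (fun x => ‖D x‖) μ ∧ ∫ x, ‖D x‖ ∂μ ≤ μ.real Ω + ∫ x, PP ε v D x ^ p ∂μ := by
  have h1 : Integrable (Ω.indicator fun _ => (1:ℝ)) μ :=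
    (integrable_indicator_iff d.opn.measurableSet).2 (integrableOn_const d.finΩ.ne)
  have hb : ∀ x, ‖D x‖ ≤ Ω.indicator (fun _ => (1:ℝ)) x + PP ε v D x ^ p := by
    intro x
    by_cases hx : x ∈ Ω
    · simp only [hx, indicator_of_mem]
      exact (norm_D_le d.e0.le v D x).trans (le_one_add_rpow hp (PP_nonneg _ _ _ _))
    · have : 0 ≤ PP ε v D x ^ p := rpow_nonneg (PP_nonneg _ _ _ _) _
      simp [hx, d.Doff x hx, this]
  have h2 : Integrable (fun x => ‖D x‖) μ := by
    refine (h1.add hi).mono' d.measD.norm.aestronglyMeasurable (Filter.Eventually.of_forall fun x => ?_)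
    simpa using hb x
  refine ⟨h2, ?_⟩
  calc _ ≤ ∫ x, (Ω.indicator (fun _ => (1:ℝ)) x + PP ε v D x ^ p) ∂μ := integral_mono h2 (h1.add hi) hb
    _ = _ := by
      rw [integral_add h1 hi, integral_indicator d.opn.measurableSet]
      simp

theorem holder_main (hp : 1 < p) (hn : 2 ≤ Module.finrank ℝ E) (hC : 0 ≤ C) {L C2 : ℝ} (hL : 0 ≤ L)
    (hC2 : 0 ≤ C2) (μ : Measure E) [μ.IsAddHaarMeasure] :
    ∃ β M : ℝ, 0 < β ∧ β < 1 ∧ 0 < M ∧ ∀ (ε : ℝ) (Ω : Set E) (v : E → ℝ) (D : E → E),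
      Dat ε Ω v D → ELp p C ε Ω v D μ → Integrable (fun x => PP ε v D x ^ p) μ →
      ∫ x, PP ε v D x ^ p ∂μ ≤ C2 → μ.real Ω ≤ C2 →
      (∀ z, z ∉ Ω → ∀ y, v y ≤ L * ‖y - z‖) →
      ∀ x h, |v (x + h) - v x| ≤ M * ‖h‖ ^ β := by
  set q : ℝ := Real.conjExponent (Module.finrank ℝ E : ℝ) with hqdef
  have hn1 : (1:ℝ) < Module.finrank ℝ E := by exact_mod_cast hn
  have hq : (Module.finrank ℝ E : ℝ).HolderConjugate q := Real.HolderConjugate.conjExponent hn1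
  have hq1 : 1 < q := hq.symm.lt
  set CS : ℝ := 2*(1+lintegralPowLePowLIntegralFDerivConst μ q) with hCS
  set K : ℝ := 2^p*(4*(1+C)+4*(1+2*(kap p)⁻¹*(2+C))) with hK
  have hκ := kap_pos hp
  have hCS0 : 0 ≤ CS := by positivity
  have hK0 : 0 ≤ K := by positivity
  set Cc : ℝ := (1+K)*(1+CS) + 2^p*(2*C2) + 4*C2 + 1 with hCc
  have e1 : 0 ≤ (1+K)*(1+CS) := by positivity
  have e2 : 0 ≤ 2^p*(2*C2) := by positivity
  obtain ⟨β, r0, hβ, hβ1, hr0, hr01, hit⟩ := iter_lemma (C := Cc) (ν := q - 1) hp (by linarith) (by linarith)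
  have hr0β : 0 < r0 ^ β := by positivity
  refine ⟨β, (L + 7) + (r0 ^ β)⁻¹, hβ, hβ1, by positivity, ?_⟩
  intro ε Ω v D d l hi hiC hΩC hBL
  have key : ∀ h : E, 0 < ‖h‖ → ‖h‖ ≤ r0 → ∀ x, v (x + h) - v x ≤ (L + 7) * ‖h‖ ^ β := by
    intro h hh hhr
    set r := ‖h‖ with hr
    set dd := r ^ β with hdd
    have hdd0 : 0 < dd := by positivity
    have hrd : r ≤ dd := by
      calc r = r ^ (1:ℝ) := (rpow_one r).symm
        _ ≤ _ := rpow_le_rpow_of_exponent_ge hh (hhr.trans hr01) hβ1.le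
    have hdd1 : dd ≤ 1 := rpow_le_one hh.le (hhr.trans hr01) hβ.le
    set k0 := (L + 1) * dd with hk0
    have hk00 : 0 < k0 := by positivity
    have hk0L : L * r < k0 := by
      calc L * r ≤ L * dd := by gcongr
        _ < k0 := by rw [hk0]; linarith
    have hi2 : Integrable (fun x => PP ε (fun x => v (x + h)) (fun x => D (x + h)) x ^ p) μ :=
      hi.comp_add_right h
    have H : PairH p C ε k0 Ω v D {x | x + h ∈ Ω} (fun x => v (x + h)) (fun x => D (x + h)) μ :=
      { hp := hp, hC := hC, d1 := d, d2 := d.shift h, l1 := l, l2 := l.shift h, i1 := hi, i2 := hi2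
        hk0 := hk00
        s1 := fun x hx => by
          by_contra hxn
          have := hBL x hxn (x + h)
          rw [add_sub_cancel_left] at this
          have := d.nn x
          linarith
        s2 := fun x hx => by
          by_contra hxn
          have h1 : v (x + h) = 0 := d.off _ hxn
          have := d.nn x
          linarith }
    set v2 := fun x => v (x + h) with hv2
    set D2 := fun x => D (x + h) with hD2
    set kk : ℕ → ℝ := fun j => k0 + 6 * dd * (1 - (1/2)^j) with hkk
    set a : ℕ → ℝ := fun j => μ.real (AA v v2 (kk j)) with ha
    set X : ℕ → ℝ := fun j => ∫ x in AA v v2 (kk j), SS ε v D v2 D2 x ^ p ∂μ with hX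
    have hpw : ∀ j : ℕ, (0:ℝ) < (1/2)^j ∧ ((1:ℝ)/2)^j ≤ 1 := fun j =>
      ⟨by positivity, pow_le_one₀ (by norm_num) (by norm_num)⟩
    have hkj : ∀ j, k0 ≤ kk j := fun j => by
      have : 0 ≤ 6 * dd * (1 - (1/2)^j) := mul_nonneg (by positivity) (by linarith [(hpw j).2])
      simp only [hkk]; linarith
    have hstep : ∀ j, kk (j+1) = kk j + 3 * (dd * (1/2)^j) := fun j => by
      simp only [hkk, pow_succ]; ring
    have hSp := fun x => rpow_nonneg (SS_nonneg ε v D v2 D2 x) p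
    have hX0 : ∀ j, 0 ≤ X j := fun j => integral_nonneg hSp
    have ha0 : ∀ j, 0 ≤ a j := fun j => measureReal_nonneg
    have hpre : ∀ j : ℕ, ∀ t : ℝ, 0 < t → ((1+K)*(1+CS))*(dd * (1/2)^j)⁻¹^5*(t* X j + t^(1-2*p)*a j) ≤
        Cc * 32 ^ j * ((r ^ β)⁻¹) ^ 5 * (t * X j + t ^ (1 - 2 * p) * a j) := by
      intro j t ht
      have hz : 0 ≤ t * X j + t ^ (1 - 2 * p) * a j :=
        add_nonneg (mul_nonneg ht.le (hX0 j)) (mul_nonneg (by positivity) (ha0 j))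
      have : (dd * (1/2)^j)⁻¹^5 = 32 ^ j * ((r ^ β)⁻¹) ^ 5 := by
        rw [mul_inv, mul_pow, mul_comm, show (32:ℝ) = 2^5 by norm_num]
        congr 1
        rw [one_div, inv_pow, inv_pow, inv_pow, inv_inv, ← pow_mul, ← pow_mul, mul_comm]
      rw [this, mul_assoc Cc]
      gcongr
      linarith
    have hlim : Filter.Tendsto a Filter.atTop (𝓝 0) := by
      refine hit r hh hhr a X ha0 hX0 ?_ ?_ ?_ ?_
      · have q1 : X 0 ≤ ∫ x, SS ε v D v2 D2 x ^ p ∂μ :=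
          setIntegral_le_integral H.iSp (Filter.Eventually.of_forall hSp)
        have q2 : ∫ x, SS ε v D v2 D2 x ^ p ∂μ ≤ ∫ x, 2 ^ p * (PP ε v D x ^ p + PP ε v2 D2 x ^ p) ∂μ :=
          integral_mono H.iSp ((hi.add hi2).const_mul _) fun x =>
            add_rpow_le' hp (PP_nonneg _ _ _ _) (PP_nonneg _ _ _ _)
        rw [integral_const_mul, integral_add hi hi2] at q2
        have q3 : ∫ x, PP ε v2 D2 x ^ p ∂μ = ∫ x, PP ε v D x ^ p ∂μ :=
          integral_add_right_eq_self (fun x => PP ε v D x ^ p) h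
        rw [q3] at q2
        have q4 : (2:ℝ)^p * ((∫ x, PP ε v D x ^ p ∂μ) + ∫ x, PP ε v D x ^ p ∂μ) ≤ 2^p * (2 * C2) := by
          gcongr; linarith
        linarith
      · have q1 := d.level (d.intD hp hi).1 h hk00
        have q2 := (d.intD hp hi).2
        have q3 : a 0 = μ.real {x | k0 < v (x + h) - v x} := by
          simp [ha, hkk, AA, hv2]
        rw [q3]
        refine q1.trans ?_
        have q4 : k0⁻¹ ≤ dd⁻¹ := by
          apply inv_anti₀ hdd0; rw [hk0]; nlinarith
        have q5 : 0 ≤ ∫ x, ‖D x‖ ∂μ := integral_nonneg fun x => norm_nonneg _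
        calc 2 * k0⁻¹ * (‖h‖ * ∫ x, ‖D x‖ ∂μ) ≤ 2 * dd⁻¹ * (r * (2 * C2)) := by
              gcongr; linarith
          _ = (4 * C2) * (r * dd⁻¹) := by ring
          _ ≤ Cc * (r * dd⁻¹) := by
              gcongr; linarith
      · intro j t ht ht1
        have := (H.comb hq hCS hK (hkj j) (d := dd * (1/2)^j) (mul_pos hdd0 (hpw j).1)
          (mul_le_one₀ hdd1 (hpw j).1.le (hpw j).2) ht ht1).1
        rw [← hstep] at this
        exact this.trans (hpre j t ht)
      · intro j t ht ht1
        have := (H.comb hq hCS hK (hkj j) (d := dd * (1/2)^j) (mul_pos hdd0 (hpw j).1)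
          (mul_le_one₀ hdd1 (hpw j).1.le (hpw j).2) ht ht1).2
        rw [← hstep] at this
        rw [show 1 + (q - 1) = q by ring]
        refine this.trans (rpow_le_rpow ?_ (hpre j t ht) (by linarith))
        have hz : 0 ≤ t * X j + t ^ (1 - 2 * p) * a j :=
          add_nonneg (mul_nonneg ht.le (hX0 j)) (mul_nonneg (by positivity) (ha0 j))
        have := hpw j
        exact mul_nonneg (by positivity) hz
    have hnull : μ.real (AA v v2 (k0 + 6 * dd)) = 0 := by
      refine le_antisymm (ge_of_tendsto' hlim fun j => ?_) measureReal_nonneg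
      refine measureReal_mono ?_ (H.finA (hkj j)).ne
      intro x (hx : _ < v2 x - v x)
      show _ < v2 x - v x
      refine lt_of_le_of_lt ?_ hx
      simp only [hkk]
      have := hpw j
      nlinarith
    have hnull' : μ (AA v v2 (k0 + 6 * dd)) = 0 := by
      rwa [measureReal_eq_zero_iff (H.finA (by linarith)).ne] at hnull
    have hop : IsOpen (AA v v2 (k0 + 6 * dd)) := isOpen_lt continuous_const H.cw
    have hemp := (hop.measure_eq_zero_iff μ).1 hnull'
    intro x
    by_contra hx
    push Not at hx
    have : x ∈ AA v v2 (k0 + 6 * dd) := by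
      show _ < v2 x - v x
      simp only [hv2, hk0]; linarith
    rw [hemp] at this
    exact this
  have h01 : ∀ x y, |v x - v y| ≤ 1 := fun x y => by
    rw [abs_le]; constructor <;> linarith [d.nn x, d.nn y, d.le1 x, d.le1 y]
  intro x h
  rcases (norm_nonneg h).eq_or_lt with hh | hh
  · have : h = 0 := norm_eq_zero.1 hh.symm
    subst this
    simp [zero_rpow hβ.ne']
  have hhβ : 0 < ‖h‖ ^ β := by positivity
  rcases le_total ‖h‖ r0 with hr | hr
  · have q1 := key h hh hr x
    have q2 := key (-h) (by rwa [norm_neg]) (by rwa [norm_neg]) (x + h)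
    rw [add_neg_cancel_right, norm_neg] at q2
    have q3 : 0 < (r0 ^ β)⁻¹ * ‖h‖ ^ β := by positivity
    rw [abs_le]; constructor <;> linarith
  · have q1 : 1 ≤ (r0 ^ β)⁻¹ * ‖h‖ ^ β := by
      rw [inv_mul_eq_div, one_le_div hr0β]; gcongr
    have q2 : 0 ≤ (L + 7) * ‖h‖ ^ β := by positivity
    have := h01 (x + h) x
    linarith
end PI

section PC1
set_option linter.unusedSectionVars false
variable {E : Type*} [NormedAddCommGroup E] [InnerProductSpace ℝ E] [FiniteDimensional ℝ E]
  [CompleteSpace E] [MeasurableSpace E] [BorelSpace E]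

open scoped Convolution in
lemma mollify {Ω : Set E} (hΩ : IsOpen Ω) {φ : E → ℝ} (h1 : ContDiff ℝ 1 φ) (h2 : HasCompactSupport φ)
    (h3 : tsupport φ ⊆ Ω) : ∃ (f : ℕ → E → ℝ) (B : ℝ), 0 ≤ B ∧ (∀ m, ContDiff ℝ (⊤ : ℕ∞) (f m)) ∧
      (∀ m, HasCompactSupport (f m)) ∧ (∀ m, tsupport (f m) ⊆ Ω) ∧ (∀ m x, |f m x| ≤ B) ∧
      (∀ m x, ‖fderiv ℝ (f m) x‖ ≤ B) ∧ (∀ x, Filter.Tendsto (fun m => f m x) Filter.atTop (𝓝 (φ x))) ∧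
      (∀ x, Filter.Tendsto (fun m => fderiv ℝ (f m) x) Filter.atTop (𝓝 (fderiv ℝ φ x))) := by
  obtain ⟨r, hr, hrΩ⟩ := h2.exists_cthickening_subset_open hΩ h3
  let μ : Measure E := Measure.addHaar
  let bmp : ℕ → ContDiffBump (0 : E) := fun m =>
    { rIn := r / (2 * (m + 1)), rOut := r / (m + 1)
      rIn_pos := by positivity
      rIn_lt_rOut := by
        apply div_lt_div_of_pos_left hr (by positivity)
        have : (0:ℝ) ≤ m := by positivity
        linarith }
  have hrO : ∀ m, (bmp m).rOut = r / (m + 1) := fun m => rfl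
  have hlim : Filter.Tendsto (fun m => (bmp m).rOut) Filter.atTop (𝓝 0) := by
    simp only [hrO]
    have := (tendsto_one_div_add_atTop_nhds_zero_nat (𝕜 := ℝ)).const_mul r
    simpa [div_eq_mul_inv] using this
  have hrr : ∀ m, (bmp m).rOut ≤ r := fun m => by
    rw [hrO]; apply div_le_self hr.le
    have : (0:ℝ) ≤ m := by positivity
    linarith
  let f : ℕ → E → ℝ := fun m => (bmp m).normed μ ⋆[ContinuousLinearMap.lsmul ℝ ℝ, μ] φ
  have hcd : Continuous (fderiv ℝ φ) := h1.continuous_fderiv (by norm_num)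
  have hfd : ∀ m x, fderiv ℝ (f m) x =
      ((bmp m).normed μ ⋆[ContinuousLinearMap.lsmul ℝ ℝ, μ] (fderiv ℝ φ)) x := by
    intro m x
    have := h2.hasFDerivAt_convolution_right (ContinuousLinearMap.lsmul ℝ ℝ) (μ := μ)
      ((bmp m).integrable_normed (μ := μ)).locallyIntegrable h1 x
    rw [this.fderiv]
    rfl
  obtain ⟨B1, hB1⟩ := h1.continuous.bounded_above_of_compact_support h2
  obtain ⟨B2, hB2⟩ := hcd.bounded_above_of_compact_support (h2.fderiv ℝ)
  have hB10 : 0 ≤ B1 := (norm_nonneg _).trans (hB1 0)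
  have hB20 : 0 ≤ B2 := (norm_nonneg _).trans (hB2 0)
  have hts : ∀ m, tsupport (f m) ⊆ cthickening r (tsupport φ) := by
    intro m
    apply closure_minimal _ isClosed_cthickening
    refine (support_convolution_subset (ContinuousLinearMap.lsmul ℝ ℝ) (μ := μ)).trans ?_
    rw [ContDiffBump.support_normed_eq]
    rintro _ ⟨a, ha, b, hb, rfl⟩
    apply mem_cthickening_of_dist_le (a + b) b r _ (subset_tsupport _ hb)
    rw [dist_eq_norm, add_sub_cancel_right]
    rw [mem_ball_zero_iff] at ha
    exact ha.le.trans (hrr m)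
  refine ⟨f, 3 * (B1 + B2), by positivity, fun m => ?_, fun m => ?_, fun m => (hts m).trans hrΩ, ?_, ?_, ?_, ?_⟩
  · exact ((bmp m).hasCompactSupport_normed).contDiff_convolution_left _ ((bmp m).contDiff_normed)
      h1.continuous.locallyIntegrable
  · exact (IsCompact.cthickening h2).of_isClosed_subset (isClosed_tsupport _) (hts m)
  · intro m x
    have := (bmp m).dist_normed_convolution_le (μ := μ) (g := φ) (x₀ := x) (ε := 2 * B1)
      h1.continuous.aestronglyMeasurable (fun y _ => by
        rw [dist_eq_norm]; linarith [norm_sub_le (φ y) (φ x), hB1 x, hB1 y])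
    rw [dist_eq_norm] at this
    have h5 := norm_add_le (f m x - φ x) (φ x)
    rw [sub_add_cancel] at h5
    rw [← Real.norm_eq_abs]
    have h6 := hB1 x
    have h7 : ‖f m x - φ x‖ ≤ 2 * B1 := this
    linarith
  · intro m x
    have := (bmp m).dist_normed_convolution_le (μ := μ) (g := fderiv ℝ φ) (x₀ := x) (ε := 2 * B2)
      hcd.aestronglyMeasurable (fun y _ => by
        rw [dist_eq_norm]; linarith [norm_sub_le (fderiv ℝ φ y) (fderiv ℝ φ x), hB2 x, hB2 y])
    rw [dist_eq_norm, ← hfd] at this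
    have h5 := norm_add_le (fderiv ℝ (f m) x - fderiv ℝ φ x) (fderiv ℝ φ x)
    rw [sub_add_cancel] at h5
    have h6 := hB2 x
    linarith
  · intro x
    exact ContDiffBump.convolution_tendsto_right_of_continuous hlim h1.continuous x
  · intro x
    simp only [hfd]
    exact ContDiffBump.convolution_tendsto_right_of_continuous hlim hcd x

lemma norm_grad (f : E → ℝ) (x : E) : ‖gradient f x‖ = ‖fderiv ℝ f x‖ := by
  simp [gradient]

lemma grad_inner (f : E → ℝ) (x y : E) : ⟪gradient f x, y⟫ = fderiv ℝ f x y := by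
  simp [gradient]

lemma grad_cont {f : E → ℝ} (h : ContDiff ℝ 1 f) : Continuous (gradient f) := by
  unfold gradient
  exact (LinearIsometryEquiv.continuous _).comp (h.continuous_fderiv (by norm_num))

lemma PP_cont {ε : ℝ} {f : E → ℝ} (h : ContDiff ℝ 1 f) : Continuous (PP ε f (gradient f)) := by
  have h1 := grad_cont h
  have h2 := h.continuous
  unfold PP
  fun_prop

lemma PP_le_of_bd {ε B : ℝ} (he : 0 ≤ ε) (he1 : ε ≤ 1) {f : E → ℝ} {D : E → E} {x : E} (h1 : |f x| ≤ B)
    (h2 : ‖D x‖ ≤ B) : PP ε f D x ≤ 2 * B := by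
  have hB : 0 ≤ B := (abs_nonneg _).trans h1
  unfold PP
  rw [Real.sqrt_le_left (by positivity)]
  have h3 : f x ^ 2 ≤ B ^ 2 := sq_le_sq.2 (by rwa [abs_of_nonneg hB])
  have h4 : ‖D x‖ ^ 2 ≤ B ^ 2 := by gcongr
  have h5 : ε * f x ^ 2 ≤ 1 * f x ^ 2 := by gcongr
  nlinarith

lemma min_C1 {p lam ε : ℝ} (hp : 1 < p) {Ω : Set E} (hΩ : IsOpen Ω) (he : 0 ≤ ε) (he1 : ε ≤ 1) {γ : Measure E} [IsFiniteMeasure γ]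
    (hmin : ∀ φ : E → ℝ, ContDiff ℝ (⊤ : ℕ∞) φ → HasCompactSupport φ → tsupport φ ⊆ Ω →
      lam * ∫ x, |φ x| ^ p ∂γ ≤ ∫ x, PP ε φ (gradient φ) x ^ p ∂γ) {φ : E → ℝ}
    (h1 : ContDiff ℝ 1 φ) (h2 : HasCompactSupport φ)
    (h3 : tsupport φ ⊆ Ω) : lam * ∫ x, |φ x| ^ p ∂γ ≤ ∫ x, PP ε φ (gradient φ) x ^ p ∂γ := by
  obtain ⟨f, B, hB, f1, f2, f3, f4, f5, f6, f7⟩ := mollify hΩ h1 h2 h3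
  have f1' : ∀ m, ContDiff ℝ 1 (f m) := fun m => (f1 m).of_le (by exact_mod_cast le_top)
  have hp0 : 0 < p := by linarith
  have l1 : Filter.Tendsto (fun m => ∫ x, |f m x| ^ p ∂γ) Filter.atTop (𝓝 (∫ x, |φ x| ^ p ∂γ)) := by
    refine tendsto_integral_of_dominated_convergence (fun _ => B ^ p) (fun m => ?_) (integrable_const _)
      (fun m => Filter.Eventually.of_forall fun x => ?_) (Filter.Eventually.of_forall fun x => ?_)
    · have := (f1' m).continuous
      exact ((this.abs).rpow_const fun x => Or.inr hp0.le).aestronglyMeasurable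
    · rw [Real.norm_eq_abs, abs_of_nonneg (by positivity)]
      have := f4 m x
      gcongr
    · exact ((f6 x).abs).rpow_const (Or.inr hp0.le)
  have l2 : Filter.Tendsto (fun m => ∫ x, PP ε (f m) (gradient (f m)) x ^ p ∂γ) Filter.atTop
      (𝓝 (∫ x, PP ε φ (gradient φ) x ^ p ∂γ)) := by
    refine tendsto_integral_of_dominated_convergence (fun _ => (2 * B) ^ p) (fun m => ?_) (integrable_const _)
      (fun m => Filter.Eventually.of_forall fun x => ?_) (Filter.Eventually.of_forall fun x => ?_)
    · exact ((PP_cont (f1' m)).rpow_const fun x => Or.inr hp0.le).aestronglyMeasurable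
    · have h0 := PP_nonneg ε (f m) (gradient (f m)) x
      rw [Real.norm_eq_abs, abs_of_nonneg (by positivity)]
      have := PP_le_of_bd (D := gradient (f m)) he he1 (f4 m x) (by rw [norm_grad]; exact f5 m x)
      gcongr
    · refine Filter.Tendsto.rpow_const ?_ (Or.inr hp0.le)
      unfold PP
      simp only [norm_grad]
      exact ((((f6 x).pow 2).const_mul ε).add ((f7 x).norm.pow 2)).sqrt
  exact le_of_tendsto_of_tendsto' (l1.const_mul lam) l2 fun m => hmin _ (f1 m) (f2 m) (f3 m)

end PC1

section PC2
set_option linter.unusedSectionVars false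
variable {E : Type*} [NormedAddCommGroup E] [InnerProductSpace ℝ E] [FiniteDimensional ℝ E]
  [CompleteSpace E] [MeasurableSpace E] [BorelSpace E]
variable {p lam ε : ℝ} {Ω : Set E} {v : E → ℝ} {D : E → E} {γ : Measure E} [IsFiniteMeasure γ]

lemma Dat.D_zero (d : Dat ε Ω v D) {x : E} (hx : v x = 0) : D x = 0 := by
  by_cases h : x ∈ Ω
  · have : IsLocalMin v x := Filter.Eventually.of_forall fun y => by rw [hx]; exact d.nn y
    have h2 := this.fderiv_eq_zero
    have h3 := d.fd x h (D x)
    rw [h2] at h3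
    simpa using h3.symm
  · exact d.Doff x h

lemma VV_add (f g : E → ℝ) (F G : E → E) (t : ℝ) (x : E) :
    VV ε (fun x => f x + t * g x) (fun x => F x + t • G x) x = VV ε f F x + t • VV ε g G x := by
  simp only [VV]
  rw [← WithLp.toLp_smul, ← WithLp.toLp_add]
  congr 1
  ext1
  · simp; ring
  · simp

lemma PP_add_le (he : 0 ≤ ε) (f g : E → ℝ) (F G : E → E) (t : ℝ) (x : E) :
    PP ε (fun x => f x + t * g x) (fun x => F x + t • G x) x ≤ PP ε f F x + |t| * PP ε g G x := by
  rw [← norm_VV he, ← norm_VV he, ← norm_VV he, VV_add]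
  refine (norm_add_le _ _).trans ?_
  rw [norm_smul, Real.norm_eq_abs]

lemma bd_C1c {φ : E → ℝ} (h1 : ContDiff ℝ 1 φ) (h2 : HasCompactSupport φ) :
    ∃ B, 0 ≤ B ∧ (∀ x, |φ x| ≤ B) ∧ (∀ x, ‖gradient φ x‖ ≤ B) := by
  obtain ⟨B1, hB1⟩ := h1.continuous.bounded_above_of_compact_support h2
  obtain ⟨B2, hB2⟩ := (h1.continuous_fderiv (by norm_num)).bounded_above_of_compact_support (h2.fderiv ℝ)
  have hB10 : 0 ≤ B1 := (norm_nonneg _).trans (hB1 0)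
  have hB20 : 0 ≤ B2 := (norm_nonneg _).trans (hB2 0)
  refine ⟨B1 + B2, by positivity, fun x => ?_, fun x => ?_⟩
  · have := hB1 x; rw [Real.norm_eq_abs] at this; linarith
  · rw [norm_grad]; have := hB2 x; linarith

lemma PP_int_C1c (hp : 1 < p) (he : 0 ≤ ε) (he1 : ε ≤ 1) {φ : E → ℝ} (h1 : ContDiff ℝ 1 φ) (h2 : HasCompactSupport φ) :
    Integrable (fun x => PP ε φ (gradient φ) x ^ p) γ := by
  obtain ⟨B, hB, b1, b2⟩ := bd_C1c h1 h2
  refine Integrable.mono' (integrable_const ((2 * B) ^ p))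
    (((PP_cont h1).rpow_const fun x => Or.inr (by linarith)).aestronglyMeasurable)
    (Filter.Eventually.of_forall fun x => ?_)
  have h0 := PP_nonneg ε φ (gradient φ) x
  rw [Real.norm_eq_abs, abs_of_nonneg (by positivity)]
  have := PP_le_of_bd (D := gradient φ) he he1 (b1 x) (b2 x)
  gcongr

lemma pert (hp : 1 < p) (d : Dat ε Ω v D) (hi : Integrable (fun x => PP ε v D x ^ p) γ)
    (hmin : ∀ φ : E → ℝ, ContDiff ℝ (⊤ : ℕ∞) φ → HasCompactSupport φ → tsupport φ ⊆ Ω →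
      lam * ∫ x, |φ x| ^ p ∂γ ≤ ∫ x, PP ε φ (gradient φ) x ^ p ∂γ) {φ : E → ℝ}
    (h1 : ContDiff ℝ 1 φ) (h2 : HasCompactSupport φ)
    (h3 : tsupport φ ⊆ Ω) (t : ℝ) : lam * ∫ x, |v x + t * φ x| ^ p ∂γ ≤
      ∫ x, PP ε (fun x => v x + t * φ x) (fun x => D x + t • gradient φ x) x ^ p ∂γ := by
  have hp0 : 0 < p := by linarith
  have he := d.e0.le
  obtain ⟨B, hB, b1, b2⟩ := bd_C1c h1 h2
  have hi2 := PP_int_C1c (γ := γ) hp he d.e1 h1 h2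
  set δ : ℕ → ℝ := fun m => 1 / ((m:ℝ) + 1) with hδ
  have δ0 : ∀ m, 0 < δ m := fun m => by simp only [hδ]; positivity
  have δl : Filter.Tendsto δ Filter.atTop (𝓝 0) := tendsto_one_div_add_atTop_nhds_zero_nat
  set vv : ℕ → E → ℝ := fun m x => kp (δ m) (v x - δ m) with hvv
  set DD : ℕ → E → E := fun m x => kp' (δ m) (v x - δ m) • D x with hDD
  have hT := fun m => d.trunc (δ0 m)
  have hv0 : ∀ m x, 0 ≤ vv m x := fun m x => kp_nonneg (δ0 m)
  have hv1 : ∀ m x, vv m x ≤ v x := fun m x => (kp_le (δ0 m)).trans (max_le (by linarith [δ0 m]) (d.nn x))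
  have hv2 : ∀ m x, v x - 2 * δ m ≤ vv m x := fun m x => by
    have := kp_ge (δ := δ m) (s := v x - δ m)
    have := le_max_left (v x - δ m) 0
    simp only [hvv]; linarith
  have hDl : ∀ m x, ‖DD m x‖ ≤ ‖D x‖ := fun m x => by
    simp only [hDD]
    rw [norm_smul, Real.norm_eq_abs, abs_of_nonneg kp'_nonneg]
    exact mul_le_of_le_one_left (norm_nonneg _) kp'_le
  have hPl : ∀ m x, PP ε (vv m) (DD m) x ≤ PP ε v D x := fun m x => by
    unfold PP
    apply Real.sqrt_le_sqrt
    have := hv0 m x; have := hv1 m x; have := hDl m x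
    gcongr
  have cd1 : ∀ m, ContDiff ℝ 1 (fun x => vv m x + t * φ x) := fun m => (hT m).1.add (contDiff_const.mul h1)
  have hgr : ∀ m x, gradient (fun x => vv m x + t * φ x) x = DD m x + t • gradient φ x := by
    intro m x
    apply ext_inner_right ℝ
    intro y
    rw [grad_inner]
    have e1 := (((hT m).1.differentiable (by norm_num)) x).hasFDerivAt
    have e2 := ((h1.differentiable (by norm_num)) x).hasFDerivAt.const_mul t
    have e3 : fderiv ℝ (fun x => vv m x + t * φ x) x = _ := (e1.add e2).fderiv
    have e4 : ⟪DD m x + t • gradient φ x, y⟫ = kp' (δ m) (v x - δ m) * ⟪D x, y⟫ + t * fderiv ℝ φ x y := by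
      rw [inner_add_left, real_inner_smul_left, real_inner_smul_left, grad_inner]
    rw [e3, e4, ContinuousLinearMap.add_apply, (hT m).2.2.2]
    simp
  have ineq : ∀ m, lam * ∫ x, |vv m x + t * φ x| ^ p ∂γ ≤
      ∫ x, PP ε (fun x => vv m x + t * φ x) (fun x => DD m x + t • gradient φ x) x ^ p ∂γ := by
    intro m
    have cs : HasCompactSupport (fun x => vv m x + t * φ x) := (hT m).2.1.add (h2.mul_left)
    have ts : tsupport (fun x => vv m x + t * φ x) ⊆ Ω := by
      refine (tsupport_add (vv m) (fun x => t * φ x)).trans (union_subset (hT m).2.2.1 ?_)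
      exact (tsupport_mul_subset_right).trans h3
    have := min_C1 hp d.opn he d.e1 hmin (cd1 m) cs ts
    have e : gradient (fun x => vv m x + t * φ x) = fun x => DD m x + t • gradient φ x := funext (hgr m)
    rwa [e] at this
  have lv : ∀ x, Filter.Tendsto (fun m => vv m x) Filter.atTop (𝓝 (v x)) := fun x => by
    refine tendsto_of_tendsto_of_tendsto_of_le_of_le ?_ tendsto_const_nhds (fun m => hv2 m x) (fun m => hv1 m x)
    have := (δl.const_mul 2).const_sub (v x)
    simpa using this
  have lD : ∀ x, Filter.Tendsto (fun m => DD m x) Filter.atTop (𝓝 (D x)) := fun x => by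
    rcases (d.nn x).eq_or_lt with h | h
    · have := d.D_zero h.symm
      simp [hDD, this]
    · have hc : ContinuousAt (fun s : ℝ => kp' s (v x - s)) 0 := by
        unfold kp'
        refine ContinuousAt.div (by fun_prop) (by fun_prop) ?_
        simp only [sub_zero, max_eq_left h.le]
        positivity
      have h5 : kp' 0 (v x - 0) = 1 := by
        simp only [kp', sub_zero, max_eq_left h.le]
        rw [zero_pow (by norm_num), add_zero, Real.sqrt_sq h.le, div_self h.ne']
      have h6 := (hc.tendsto.comp δl).smul_const (D x)
      simp only [h5, one_smul] at h6
      exact h6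
  have l1 : Filter.Tendsto (fun m => ∫ x, |vv m x + t * φ x| ^ p ∂γ) Filter.atTop
      (𝓝 (∫ x, |v x + t * φ x| ^ p ∂γ)) := by
    refine tendsto_integral_of_dominated_convergence (fun _ => (1 + |t| * B) ^ p) (fun m => ?_) (integrable_const _)
      (fun m => Filter.Eventually.of_forall fun x => ?_) (Filter.Eventually.of_forall fun x => ?_)
    · exact (((cd1 m).continuous.abs).rpow_const fun x => Or.inr hp0.le).aestronglyMeasurable
    · rw [Real.norm_eq_abs, abs_of_nonneg (by positivity)]
      have q1 : |vv m x + t * φ x| ≤ |vv m x| + |t| * |φ x| := (abs_add_le _ _).trans (by rw [abs_mul])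
      rw [abs_of_nonneg (hv0 m x)] at q1
      have q2 : |vv m x + t * φ x| ≤ 1 + |t| * B := by
        have : |t| * |φ x| ≤ |t| * B := by have := b1 x; gcongr
        linarith [hv1 m x, d.le1 x]
      gcongr
    · exact (((lv x).add tendsto_const_nhds).abs).rpow_const (Or.inr hp0.le)
  have l2 : Filter.Tendsto (fun m => ∫ x, PP ε (fun x => vv m x + t * φ x) (fun x => DD m x + t • gradient φ x) x ^ p ∂γ) Filter.atTop
      (𝓝 (∫ x, PP ε (fun x => v x + t * φ x) (fun x => D x + t • gradient φ x) x ^ p ∂γ)) := by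
    refine tendsto_integral_of_dominated_convergence
      (fun x => 2 ^ p * (PP ε v D x ^ p + |t| ^ p * PP ε φ (gradient φ) x ^ p)) (fun m => ?_)
      ((hi.add (hi2.const_mul _)).const_mul _)
      (fun m => Filter.Eventually.of_forall fun x => ?_) (Filter.Eventually.of_forall fun x => ?_)
    · have e : (fun x => DD m x + t • gradient φ x) = gradient (fun x => vv m x + t * φ x) := (funext (hgr m)).symm
      rw [e]
      exact ((PP_cont (cd1 m)).rpow_const fun x => Or.inr hp0.le).aestronglyMeasurable
    · have h0 := PP_nonneg ε (fun x => vv m x + t * φ x) (fun x => DD m x + t • gradient φ x) x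
      have h00 := PP_nonneg ε φ (gradient φ) x
      have h000 := PP_nonneg ε v D x
      rw [Real.norm_eq_abs, abs_of_nonneg (by positivity)]
      have q1 := PP_add_le he (vv m) φ (DD m) (gradient φ) t x
      have q2 := hPl m x
      calc _ ≤ (PP ε v D x + |t| * PP ε φ (gradient φ) x) ^ p := by
            refine rpow_le_rpow h0 (by linarith) hp0.le
        _ ≤ _ := by
            refine (add_rpow_le' hp h000 (by positivity)).trans ?_
            rw [mul_rpow (abs_nonneg _) h00]
    · refine Filter.Tendsto.rpow_const ?_ (Or.inr hp0.le)
      unfold PP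
      exact (((((lv x).add_const _).pow 2).const_mul ε).add (((lD x).add_const _).norm.pow 2)).sqrt
  exact le_of_tendsto_of_tendsto' (l1.const_mul lam) l2 ineq

/-- Differentiating the `p`-th power of a norm under the integral sign. -/
lemma deriv_int {H : Type*} [NormedAddCommGroup H] [InnerProductSpace ℝ H] (hp : 1 < p) {a b : E → H}
    (ha : AEStronglyMeasurable a γ) (hb : AEStronglyMeasurable b γ)
    (hai : Integrable (fun x => ‖a x‖ ^ p) γ) (hbi : Integrable (fun x => ‖b x‖ ^ p) γ) :
    HasDerivAt (fun t : ℝ => ∫ x, ‖a x + t • b x‖ ^ p ∂γ) (∫ x, p * (‖a x‖ ^ (p-2) * ⟪a x, b x⟫) ∂γ) 0 := by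
  have hp0 : 0 < p := by linarith
  have hm : ∀ t : ℝ, AEStronglyMeasurable (fun x => a x + t • b x) γ := fun t => ha.add (hb.const_smul t)
  have := (hasDerivAt_integral_of_dominated_loc_of_deriv_le (μ := γ) (𝕜 := ℝ) (x₀ := (0:ℝ))
    (F := fun t x => ‖a x + t • b x‖ ^ p) (s := ball (0:ℝ) 1)
    (F' := fun t x => p * (‖a x + t • b x‖ ^ (p-2) * ⟪a x + t • b x, b x⟫))
    (bound := fun x => p * (2 ^ p * (‖a x‖ ^ p + ‖b x‖ ^ p)))
    (ball_mem_nhds _ one_pos) (Filter.Eventually.of_forall fun t => ?_) ?_ ?_ ?_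
    (((hai.add hbi).const_mul _).const_mul _) ?_).2
  · simpa using this
  · exact (hm t).norm.aemeasurable.pow_const p |>.aestronglyMeasurable
  · simpa using hai
  · refine AEStronglyMeasurable.const_mul (AEStronglyMeasurable.mul ?_ ((hm 0).inner hb)) _
    exact (hm 0).norm.aemeasurable.pow_const (p-2) |>.aestronglyMeasurable
  · refine Filter.Eventually.of_forall fun x t ht => ?_
    rw [mem_ball_zero_iff, Real.norm_eq_abs] at ht
    rw [norm_mul, norm_mul, Real.norm_eq_abs, Real.norm_eq_abs, Real.norm_eq_abs, abs_of_pos hp0,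
      abs_of_nonneg (by positivity : 0 ≤ ‖a x + t • b x‖ ^ (p-2))]
    refine mul_le_mul_of_nonneg_left ?_ hp0.le
    have q1 : ‖a x + t • b x‖ ≤ ‖a x‖ + ‖b x‖ := by
      refine (norm_add_le _ _).trans ?_
      rw [norm_smul, Real.norm_eq_abs]
      have := mul_le_of_le_one_left (norm_nonneg (b x)) ht.le
      linarith
    calc _ ≤ ‖a x + t • b x‖ ^ (p-2) * (‖a x + t • b x‖ * ‖b x‖) := by
          exact mul_le_mul_of_nonneg_left (abs_real_inner_le_norm _ _) (by positivity)
      _ = ‖a x + t • b x‖ ^ (p-1) * ‖b x‖ := by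
          rw [← mul_assoc, rpow_two_mul_self hp (norm_nonneg _)]
      _ ≤ (‖a x‖ + ‖b x‖) ^ (p-1) * (‖a x‖ + ‖b x‖) := by
          have q3 := norm_nonneg (a x)
          exact mul_le_mul (rpow_le_rpow (norm_nonneg _) q1 (by linarith)) (by linarith) (norm_nonneg _) (by positivity)
      _ = (‖a x‖ + ‖b x‖) ^ p := rpow_one_mul_self hp (by positivity)
      _ ≤ _ := add_rpow_le' hp (norm_nonneg _) (norm_nonneg _)
  · refine Filter.Eventually.of_forall fun x t ht => ?_
    have e1 : HasDerivAt (fun t : ℝ => a x + t • b x) (b x) t := by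
      simpa using ((hasDerivAt_id t).smul_const (b x)).const_add (a x)
    have e2 := (hasFDerivAt_norm_rpow (a x + t • b x) hp).comp_hasDerivAt t e1
    simp only [ContinuousLinearMap.smul_apply, innerSL_apply_apply, smul_eq_mul] at e2
    rw [← mul_assoc]
    exact e2

/-- The Euler-Lagrange equation. -/
lemma EL_eq (hp : 1 < p) (d : Dat ε Ω v D) (hi : Integrable (fun x => PP ε v D x ^ p) γ)
    (hmin : ∀ φ : E → ℝ, ContDiff ℝ (⊤ : ℕ∞) φ → HasCompactSupport φ → tsupport φ ⊆ Ω →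
      lam * ∫ x, |φ x| ^ p ∂γ ≤ ∫ x, PP ε φ (gradient φ) x ^ p ∂γ)
    (heq : ∫ x, PP ε v D x ^ p ∂γ = lam * ∫ x, v x ^ p ∂γ) {φ : E → ℝ}
    (h1 : ContDiff ℝ 1 φ) (h2 : HasCompactSupport φ)
    (h3 : tsupport φ ⊆ Ω) :
    ∫ x, PP ε v D x ^ (p-2) * (fderiv ℝ φ x (D x) + ε * v x * φ x) ∂γ = lam * ∫ x, v x ^ (p-1) * φ x ∂γ := by
  have hp0 : 0 < p := by linarith
  have he := d.e0.le
  obtain ⟨B, hB, b1, b2⟩ := bd_C1c h1 h2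
  have hi2 := PP_int_C1c (γ := γ) hp he d.e1 h1 h2
  have mv := d.cont.measurable
  have mφ := h1.continuous.measurable
  have hiv : Integrable (fun x => ‖v x‖ ^ p) γ := by
    refine Integrable.mono' (integrable_const (1:ℝ)) (mv.norm.pow_const p).aestronglyMeasurable (Filter.Eventually.of_forall fun x => ?_)
    rw [Real.norm_eq_abs, abs_of_nonneg (by positivity), Real.norm_eq_abs, abs_of_nonneg (d.nn x)]
    exact rpow_le_one (d.nn x) (d.le1 x) hp0.le
  have hiφ : Integrable (fun x => ‖φ x‖ ^ p) γ := by
    refine Integrable.mono' (integrable_const (B ^ p)) (mφ.norm.pow_const p).aestronglyMeasurable (Filter.Eventually.of_forall fun x => ?_)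
    rw [Real.norm_eq_abs, abs_of_nonneg (by positivity), Real.norm_eq_abs]
    have := b1 x
    gcongr
  have mVV : ∀ {f : E → ℝ} {G : E → E}, Measurable f → Measurable G →
      AEStronglyMeasurable (VV ε f G) γ := by
    intro f G hf hG
    have : StronglyMeasurable (fun x => ((√ε * f x, G x) : ℝ × E)) := by
      apply Measurable.stronglyMeasurable
      fun_prop
    exact ((WithLp.prod_continuous_toLp 2 ℝ E).comp_stronglyMeasurable this).aestronglyMeasurable
  have A1 := deriv_int hp (mVV mv d.measD) (mVV mφ (grad_cont h1).measurable) (by simpa only [norm_VV he] using hi)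
    (by simpa only [norm_VV he] using hi2)
  have A2 := deriv_int hp mv.aestronglyMeasurable mφ.aestronglyMeasurable hiv hiφ
  have A3 := A1.sub (A2.const_mul lam)
  have hmn : IsLocalMin (fun t : ℝ => (∫ x, ‖VV ε v D x + t • VV ε φ (gradient φ) x‖ ^ p ∂γ) -
      lam * ∫ x, ‖v x + t • φ x‖ ^ p ∂γ) 0 := by
    refine Filter.Eventually.of_forall fun t => ?_
    have q1 := pert hp d hi hmin h1 h2 h3 t
    have q2 : (∫ x, ‖VV ε v D x + (0:ℝ) • VV ε φ (gradient φ) x‖ ^ p ∂γ) -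
      lam * ∫ x, ‖v x + (0:ℝ) • φ x‖ ^ p ∂γ = 0 := by
      simp only [zero_smul, add_zero, norm_VV he, Real.norm_eq_abs]
      rw [heq]
      simp only [abs_of_nonneg (d.nn _), sub_self]
    beta_reduce
    rw [q2]
    simp only [← VV_add, norm_VV he, Real.norm_eq_abs, smul_eq_mul]
    linarith
  have A4 := hmn.hasDerivAt_eq_zero A3
  rw [integral_const_mul, integral_const_mul, mul_left_comm lam p, ← mul_sub] at A4
  have A5 := (mul_eq_zero.1 A4).resolve_left hp0.ne'
  have e1 : ∀ x, ‖VV ε v D x‖ ^ (p - 2) * ⟪VV ε v D x, VV ε φ (gradient φ) x⟫ =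
      PP ε v D x ^ (p-2) * (fderiv ℝ φ x (D x) + ε * v x * φ x) := by
    intro x
    rw [norm_VV he]
    congr 1
    simp only [VV, WithLp.prod_inner_apply]
    rw [← grad_inner, real_inner_comm]
    have : √ε * √ε = ε := Real.mul_self_sqrt he
    simp [real_inner_comm]
    linear_combination (v x * φ x) * this
  have e2 : ∀ x, ‖v x‖ ^ (p - 2) * ⟪v x, φ x⟫ = v x ^ (p-1) * φ x := by
    intro x
    rw [Real.norm_eq_abs, abs_of_nonneg (d.nn x), ← rpow_two_mul_self hp (d.nn x)]
    simp; ring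
  simp only [e1, e2] at A5
  linarith
end PC2

section PD
set_option linter.unusedSectionVars false
variable {E : Type*} [NormedAddCommGroup E] [InnerProductSpace ℝ E] [FiniteDimensional ℝ E]
  [CompleteSpace E] [MeasurableSpace E] [BorelSpace E]
variable {p lam ε : ℝ} {Ω : Set E} {v : E → ℝ} {D : E → E} {μ : Measure E} [μ.IsAddHaarMeasure]

noncomputable def gg (x : E) : ℝ := Real.exp (-‖x‖ ^ 2 / 2)

lemma gg_pos (x : E) : 0 < gg x := Real.exp_pos _

lemma gg_le (x : E) : gg x ≤ 1 := by
  unfold gg; rw [Real.exp_le_one_iff]; have := sq_nonneg ‖x‖; linarith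

lemma exq_deriv (c : ℝ) (x : E) : HasFDerivAt (fun x : E => Real.exp (c * ‖x‖ ^ 2 / 2))
    ((Real.exp (c * ‖x‖ ^ 2 / 2)) • (c • innerSL ℝ x)) x := by
  have h1 := (hasStrictFDerivAt_norm_sq x).hasFDerivAt
  have h2 := ((h1.const_mul c).mul_const (1/2)).exp
  convert h2 using 1
  · ext y; simp; ring_nf
  · ext y; simp; ring_nf

lemma exq_cd (c : ℝ) : ContDiff ℝ 1 (fun x : E => Real.exp (c * ‖x‖ ^ 2 / 2)) := by
  have := contDiff_norm_sq ℝ (E := E) (n := 1)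
  fun_prop

lemma gg_eq : (gg : E → ℝ) = fun x => Real.exp ((-1) * ‖x‖ ^ 2 / 2) := by
  funext x; simp [gg]

lemma gg_cd : ContDiff ℝ 1 (gg : E → ℝ) := by rw [gg_eq]; exact exq_cd _

lemma gg_fderiv (x y : E) : fderiv ℝ (gg : E → ℝ) x y = - gg x * ⟪x, y⟫ := by
  rw [gg_eq, (exq_deriv _ x).fderiv]; simp

def ELw (p lam ε : ℝ) (Ω : Set E) (v : E → ℝ) (D : E → E) (μ : Measure E) : Prop :=
  ∀ φ : E → ℝ, ContDiff ℝ 1 φ → HasCompactSupport φ → tsupport φ ⊆ Ω →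
    ∫ x, gg x * (PP ε v D x ^ (p - 2) * (fderiv ℝ φ x (D x) + ε * v x * φ x)) ∂μ =
      lam * ∫ x, gg x * (v x ^ (p-1) * φ x) ∂μ

lemma rpow_sub_one_le {p s : ℝ} (hp : 1 < p) (hs : 0 ≤ s) : s ^ (p-1) ≤ 1 + s ^ p := by
  rcases le_total s 1 with h | h
  · have := rpow_le_one hs h (show 0 ≤ p - 1 by linarith)
    have : 0 ≤ s ^ p := by positivity
    linarith
  · have := rpow_le_rpow_of_exponent_le h (show p - 1 ≤ p by linarith)
    linarith

lemma Dat.intg (d : Dat ε Ω v D) (hi : Integrable (fun x => PP ε v D x ^ p) μ) {f : E → ℝ}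
    (hf : Measurable f) (c : ℝ) (h : ∀ x ∈ Ω, |f x| ≤ c * (1 + PP ε v D x ^ p)) (h0 : ∀ x, x ∉ Ω → f x = 0) :
    Integrable f μ := by
  have h1 : Integrable (Ω.indicator fun _ => (1:ℝ)) μ :=
    (integrable_indicator_iff d.opn.measurableSet).2 (integrableOn_const d.finΩ.ne)
  refine ((h1.add hi).const_mul |c|).mono' hf.aestronglyMeasurable (Filter.Eventually.of_forall fun x => ?_)
  have hP : 0 ≤ PP ε v D x ^ p := rpow_nonneg (PP_nonneg _ _ _ _) _
  rw [Real.norm_eq_abs]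
  by_cases hx : x ∈ Ω
  · simp only [Pi.add_apply, hx, indicator_of_mem]
    refine (h x hx).trans ?_
    have := le_abs_self c
    gcongr
  · simp only [Pi.add_apply, hx, not_false_eq_true, indicator_of_notMem, h0 x hx, abs_zero, zero_add]
    positivity

lemma eps_v_le (d : Dat ε Ω v D) (x : E) : ε * v x ≤ PP ε v D x := by
  have h1 := v_le_PP d.e0.le v D x
  rw [abs_of_nonneg (d.nn x)] at h1
  have h2 : √ε ≤ 1 := Real.sqrt_le_one.2 d.e1
  have h3 : √ε * √ε = ε := Real.mul_self_sqrt d.e0.le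
  have h4 : 0 ≤ √ε * v x := mul_nonneg (Real.sqrt_nonneg _) (d.nn x)
  calc ε * v x = √ε * (√ε * v x) := by rw [← mul_assoc, h3]
    _ ≤ 1 * (√ε * v x) := by gcongr
    _ ≤ _ := by linarith

lemma supp_fderiv {φ : E → ℝ} (h3 : tsupport φ ⊆ Ω) {x : E} (hx : x ∉ Ω) : φ x = 0 ∧ fderiv ℝ φ x = 0 := by
  have h : x ∉ tsupport φ := fun h => hx (h3 h)
  exact ⟨image_eq_zero_of_notMem_tsupport h, by
    have := tsupport_fderiv_subset ℝ (f := φ)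
    exact image_eq_zero_of_notMem_tsupport fun h' => h (this h')⟩

lemma measfd {φ : E → ℝ} (h1 : ContDiff ℝ 1 φ) (hD : Measurable D) : Measurable fun x => fderiv ℝ φ x (D x) := by
  have e : (fun x => fderiv ℝ φ x (D x)) = fun x => ⟪gradient φ x, D x⟫ := by
    funext x; rw [grad_inner]
  rw [e]
  exact (grad_cont h1).measurable.inner hD

lemma ELw.toELp (hp : 1 < p) (d : Dat ε Ω v D) (hi : Integrable (fun x => PP ε v D x ^ p) μ)
    (hw : ELw p lam ε Ω v D μ) {R Λ : ℝ} (hR : ∀ x ∈ Ω, ‖x‖ ≤ R) (hR0 : 0 ≤ R) (hl : 0 ≤ lam) (hlΛ : lam ≤ Λ) :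
    ELp p (Λ + R + 1) ε Ω v D μ := by
  intro φ h1 h2 h3
  obtain ⟨B, hB, b1, b2⟩ := bd_C1c h1 h2
  set G : E → ℝ := fun x => Real.exp (1 * ‖x‖ ^ 2 / 2) with hG
  have hGg : ∀ x, gg x * G x = 1 := fun x => by
    simp only [gg, hG]; rw [← Real.exp_add, show -‖x‖^2/2 + 1*‖x‖^2/2 = 0 by ring, Real.exp_zero]
  have hψ : ContDiff ℝ 1 (fun x => φ x * G x) := h1.mul (exq_cd _)
  have hf : ∀ x y, fderiv ℝ (fun x => φ x * G x) x y = G x * (fderiv ℝ φ x y + φ x * ⟪x, y⟫) := by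
    intro x y
    have e1 := (((h1.differentiable (by norm_num)) x).hasFDerivAt).mul (exq_deriv 1 x)
    have e2 : fderiv ℝ (fun x => φ x * G x) x = _ := e1.fderiv
    rw [e2]; simp [hG]; ring
  have hw' := hw _ hψ h2.mul_right ((tsupport_mul_subset_left).trans h3)
  simp only [hf] at hw'
  have m1 := d.measP
  have m2 := d.measD
  have m3 := d.cont.measurable
  have m4 := h1.continuous.measurable
  have m5 := measfd h1 m2
  have mP : ∀ r : ℝ, Measurable fun x => PP ε v D x ^ r := fun r => m1.pow_const r
  have e1 : ∀ x, gg x * (PP ε v D x ^ (p - 2) * (G x * (fderiv ℝ φ x (D x) + φ x * ⟪x, D x⟫) + ε * v x * (φ x * G x))) =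
     PP ε v D x ^ (p-2) * fderiv ℝ φ x (D x) + PP ε v D x ^ (p-2) * (⟪x, D x⟫ + ε * v x) * φ x := fun x => by
    linear_combination (PP ε v D x ^ (p - 2) * (fderiv ℝ φ x (D x) + φ x * ⟪x, D x⟫ + ε * v x * φ x)) * hGg x
  have e2 : ∀ x, gg x * (v x ^ (p-1) * (φ x * G x)) = v x ^ (p-1) * φ x := fun x => by
    linear_combination (v x ^ (p-1) * φ x) * hGg x
  simp only [e1, e2] at hw'
  have hP0 := PP_nonneg ε v D
  have hPp := fun x => rpow_nonneg (hP0 x) p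
  have hP1 := fun x => rpow_sub_one_le hp (hP0 x)
  have i1 : Integrable (fun x => PP ε v D x ^ (p-2) * fderiv ℝ φ x (D x)) μ := by
    refine d.intg hi ((mP _).mul m5) B (fun x _ => ?_) (fun x hx => by rw [d.Doff x hx]; simp)
    have hr : 0 ≤ PP ε v D x ^ (p-2) := rpow_nonneg (hP0 x) _
    rw [abs_mul, abs_of_nonneg hr, ← grad_inner]
    calc _ ≤ PP ε v D x ^ (p-2) * (B * PP ε v D x) := by
          gcongr
          refine (abs_real_inner_le_norm _ _).trans ?_
          exact mul_le_mul (b2 x) (norm_D_le d.e0.le v D x) (norm_nonneg _) hB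
      _ = B * PP ε v D x ^ (p-1) := by rw [← rpow_two_mul_self hp (hP0 x)]; ring
      _ ≤ _ := by have := hP1 x; gcongr
  have bd2 : ∀ x ∈ Ω, |PP ε v D x ^ (p-2) * (⟪x, D x⟫ + ε * v x) * φ x| ≤ (R + 1) * PP ε v D x ^ (p-1) * |φ x| := by
    intro x hx
    have hr : 0 ≤ PP ε v D x ^ (p-2) := rpow_nonneg (hP0 x) _
    rw [abs_mul, abs_mul, abs_of_nonneg hr]
    refine mul_le_mul_of_nonneg_right ?_ (abs_nonneg _)
    have q1 : |⟪x, D x⟫ + ε * v x| ≤ (R + 1) * PP ε v D x := by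
      refine (abs_add_le _ _).trans ?_
      have q2 : |⟪x, D x⟫| ≤ R * PP ε v D x :=
        (abs_real_inner_le_norm _ _).trans (mul_le_mul (hR x hx) (norm_D_le d.e0.le v D x) (norm_nonneg _) hR0)
      rw [abs_of_nonneg (mul_nonneg d.e0.le (d.nn x))]
      linarith [eps_v_le d x]
    calc _ ≤ PP ε v D x ^ (p-2) * ((R + 1) * PP ε v D x) := mul_le_mul_of_nonneg_left q1 hr
      _ = _ := by rw [← rpow_two_mul_self hp (hP0 x)]; ring
  have z : ∀ x, x ∉ Ω → φ x = 0 := fun x hx => (supp_fderiv h3 hx).1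
  have i2 : Integrable (fun x => PP ε v D x ^ (p-2) * (⟪x, D x⟫ + ε * v x) * φ x) μ := by
    refine d.intg hi (((mP _).mul ((measurable_id.inner m2).add (m3.const_mul ε))).mul m4) ((R+1) * B) (fun x hx => (bd2 x hx).trans ?_)
      (fun x hx => by rw [z x hx]; simp)
    calc _ ≤ (R + 1) * (1 + PP ε v D x ^ p) * B := by
          have := hP1 x; have := b1 x; have := hPp x; gcongr
      _ = _ := by ring
  have i3 : Integrable (fun x => v x ^ (p-1) * φ x) μ := by
    refine d.intg hi ((m3.pow_const _).mul m4) B (fun x _ => ?_) (fun x hx => by rw [z x hx]; simp)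
    have := rpow_le_one (d.nn x) (d.le1 x) (show 0 ≤ p - 1 by linarith)
    have h0 := rpow_nonneg (d.nn x) (p-1)
    rw [abs_mul, abs_of_nonneg h0]
    calc _ ≤ 1 * B := by have := b1 x; gcongr
      _ ≤ B * (1 + PP ε v D x ^ p) := by nlinarith [hPp x]
  have i4 : Integrable (fun x => (1 + PP ε v D x ^ (p-1)) * |φ x|) μ := by
    refine d.intg hi (((mP _).const_add 1).mul m4.abs) (2 * B) (fun x _ => ?_) (fun x hx => by rw [z x hx]; simp)
    have h0 := rpow_nonneg (hP0 x) (p-1)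
    rw [abs_of_nonneg (by positivity)]
    calc _ ≤ (2 * (1 + PP ε v D x ^ p)) * B := by
          have := hP1 x; have := b1 x; have := hPp x
          gcongr
          linarith
      _ = _ := by ring
  rw [integral_add i1 i2] at hw'
  have key : ∫ x, PP ε v D x ^ (p-2) * fderiv ℝ φ x (D x) ∂μ =
      ∫ x, (lam * (v x ^ (p-1) * φ x) - PP ε v D x ^ (p-2) * (⟪x, D x⟫ + ε * v x) * φ x) ∂μ := by
    rw [integral_sub (i3.const_mul _) i2, integral_const_mul]; linarith
  rw [key, ← integral_const_mul]
  refine (abs_integral_le_integral_abs).trans ?_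
  refine integral_mono ((i3.const_mul _).sub i2).abs (i4.const_mul _) fun x => ?_
  beta_reduce
  by_cases hx : x ∈ Ω
  · refine (abs_sub _ _).trans ?_
    have q1 := bd2 x hx
    have h0 := rpow_nonneg (d.nn x) (p-1)
    have h00 := rpow_nonneg (hP0 x) (p-1)
    have hΛ : 0 ≤ Λ := hl.trans hlΛ
    have q2 : |lam * (v x ^ (p-1) * φ x)| ≤ Λ * (1 * |φ x|) := by
      rw [abs_mul, abs_mul, abs_of_nonneg hl, abs_of_nonneg h0]
      have := rpow_le_one (d.nn x) (d.le1 x) (show 0 ≤ p - 1 by linarith)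
      gcongr
    have q3 : 0 ≤ PP ε v D x ^ (p-1) * |φ x| := by positivity
    have q4 : 0 ≤ |φ x| := abs_nonneg _
    nlinarith [mul_nonneg hΛ q3, mul_nonneg hR0 q4]
  · simp [z x hx]
end PD

section PE
set_option linter.unusedSectionVars false
variable {E : Type*} [NormedAddCommGroup E] [InnerProductSpace ℝ E] [FiniteDimensional ℝ E]
  [CompleteSpace E] [MeasurableSpace E] [BorelSpace E]
variable {p lam ε : ℝ} {Ω : Set E} {v : E → ℝ} {D : E → E} {μ : Measure E} [μ.IsAddHaarMeasure]

lemma eps_abs_le (he : 0 ≤ ε) (he1 : ε ≤ 1) (v : E → ℝ) (D : E → E) (x : E) : ε * |v x| ≤ PP ε v D x := by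
  have h1 := v_le_PP he v D x
  have h2 : √ε ≤ 1 := Real.sqrt_le_one.2 he1
  have h3 : √ε * √ε = ε := Real.mul_self_sqrt he
  have h4 : 0 ≤ √ε * |v x| := mul_nonneg (Real.sqrt_nonneg _) (abs_nonneg _)
  calc ε * |v x| = √ε * (√ε * |v x|) := by rw [← mul_assoc, h3]
    _ ≤ 1 * (√ε * |v x|) := by gcongr
    _ ≤ _ := by linarith

lemma flux_bd (hp : 1 < p) (he : 0 ≤ ε) (he1 : ε ≤ 1) (v : E → ℝ) (D : E → E) (x : E) {φ : E → ℝ} {B : ℝ} (hB : 0 ≤ B)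
    (b1 : |φ x| ≤ B) (b2 : ‖gradient φ x‖ ≤ B) :
    |gg x * (PP ε v D x ^ (p-2) * (fderiv ℝ φ x (D x) + ε * v x * φ x))| ≤ 2 * B * PP ε v D x ^ (p-1) := by
  have hP0 := PP_nonneg ε v D x
  have hr : 0 ≤ PP ε v D x ^ (p-2) := rpow_nonneg hP0 _
  rw [abs_mul, abs_mul, abs_of_nonneg hr, abs_of_pos (gg_pos x)]
  have q1 : |fderiv ℝ φ x (D x) + ε * v x * φ x| ≤ 2 * B * PP ε v D x := by
    refine (abs_add_le _ _).trans ?_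
    have q2 : |fderiv ℝ φ x (D x)| ≤ B * PP ε v D x := by
      rw [← grad_inner]
      exact (abs_real_inner_le_norm _ _).trans (mul_le_mul b2 (norm_D_le he v D x) (norm_nonneg _) hB)
    have q3 : |ε * v x * φ x| ≤ PP ε v D x * B := by
      rw [abs_mul, abs_mul, abs_of_nonneg he]
      exact mul_le_mul (eps_abs_le he he1 v D x) b1 (abs_nonneg _) hP0
    linarith
  calc _ ≤ 1 * (PP ε v D x ^ (p-2) * (2 * B * PP ε v D x)) := by
        refine mul_le_mul (gg_le x) (mul_le_mul_of_nonneg_left q1 hr) (by positivity) zero_le_one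
    _ = _ := by rw [← rpow_two_mul_self hp hP0]; ring

lemma compare (hp : 1 < p) (d : Dat ε Ω v D) (hi : Integrable (fun x => PP ε v D x ^ p) μ)
    (hw : ELw p lam ε Ω v D μ) {Λ : ℝ} (hl : 0 ≤ lam) (hlΛ : lam ≤ Λ) {Ψ : E → ℝ} {DΨ : E → E}
    (c1 : ContDiff ℝ 1 Ψ) (c2 : ∀ x ∈ Ω, 0 < Ψ x) (c3 : Continuous DΨ)
    (c4 : ∀ x y, fderiv ℝ Ψ x y = ⟪DΨ x, y⟫)
    (hs : ∀ φ : E → ℝ, ContDiff ℝ 1 φ → HasCompactSupport φ → tsupport φ ⊆ Ω → (∀ x, 0 ≤ φ x) →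
      (Λ + 1) * ∫ x, gg x * φ x ∂μ ≤
        ∫ x, gg x * (PP ε Ψ DΨ x ^ (p - 2) * (fderiv ℝ φ x (DΨ x) + ε * Ψ x * φ x)) ∂μ) :
    ∀ x ∈ Ω, v x ≤ Ψ x := by
  set f : E → ℝ := fun x => v x - max (Ψ x) 0 with hf
  have fc : Continuous f := d.cont.sub (c1.continuous.max continuous_const)
  have foff : ∀ x, x ∉ Ω → f x ≤ 0 := fun x hx => by
    simp only [hf, d.off x hx]; have := le_max_right (Ψ x) 0; linarith
  have fon : ∀ x ∈ Ω, f x = v x - Ψ x := fun x hx => by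
    simp only [hf, max_eq_left (c2 x hx).le]
  have fle : ∀ x, f x ≤ 1 := fun x => by
    have := le_max_right (Ψ x) 0; have := d.le1 x; simp only [hf]; linarith
  have fcd : ContDiffOn ℝ 1 f Ω := (d.cd.sub c1.contDiffOn).congr fon
  have ffd : ∀ x ∈ Ω, ∀ y, fderiv ℝ f x y = ⟪D x - DΨ x, y⟫ := by
    intro x hx y
    have e : f =ᶠ[𝓝 x] fun x => v x - Ψ x := by
      filter_upwards [d.opn.mem_nhds hx] with z hz using fon z hz
    have dv : DifferentiableAt ℝ v x := (d.cd.contDiffAt (d.opn.mem_nhds hx)).differentiableAt (by norm_num)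
    have dψ : DifferentiableAt ℝ Ψ x := c1.differentiable (by norm_num) x
    rw [e.fderiv_eq, fderiv_fun_sub dv dψ, ContinuousLinearMap.sub_apply, d.fd x hx, c4, inner_sub_left]
  have he := d.e0.le
  have hP0 := PP_nonneg ε v D
  have hQ0 := PP_nonneg ε Ψ DΨ
  have hPp := fun x => rpow_nonneg (hP0 x) p
  have hP1 := fun x => rpow_sub_one_le hp (hP0 x)
  have Qc : Continuous (fun x => PP ε Ψ DΨ x ^ (p-1)) := by
    have : Continuous (PP ε Ψ DΨ) := by
      unfold PP; have := c1.continuous; fun_prop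
    exact this.rpow_const fun x => Or.inr (by linarith)
  obtain ⟨BQ, hBQ⟩ := (d.bdd.isCompact_closure).exists_bound_of_continuousOn Qc.continuousOn
  have hBQ' : ∀ x ∈ Ω, PP ε Ψ DΨ x ^ (p-1) ≤ |BQ| := fun x hx =>
    (le_abs_self _).trans ((hBQ x (subset_closure hx)).trans (le_abs_self _))
  have mgg : Measurable (gg : E → ℝ) := gg_cd.continuous.measurable
  have mP : ∀ r : ℝ, Measurable fun x => PP ε v D x ^ r := fun r => d.measP.pow_const r
  have mQ : ∀ r : ℝ, Measurable fun x => PP ε Ψ DΨ x ^ r := fun r => by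
    have : Continuous (PP ε Ψ DΨ) := by
      unfold PP; have := c1.continuous; fun_prop
    exact this.measurable.pow_const r
  have mv := d.cont.measurable
  have mΨ := c1.continuous.measurable
  set W : E → ℝ := Ω.indicator fun x => PP ε v D x ^ (p-1) + |BQ| + 1 with hW
  have iW : Integrable W μ := by
    refine d.intg hi (((((mP _).add_const _).add_const _)).indicator d.opn.measurableSet) (|BQ| + 2) (fun x hx => ?_)
      (fun x hx => indicator_of_notMem hx _)
    rw [hW, indicator_of_mem hx]
    have := rpow_nonneg (hP0 x) (p-1)
    rw [abs_of_nonneg (by positivity)]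
    nlinarith [hP1 x, hPp x, abs_nonneg BQ, mul_nonneg (abs_nonneg BQ) (hPp x)]
  set w : E → ℝ := fun x => max (f x) 0 with hwdef
  have wc : Continuous w := fc.max continuous_const
  have w0 : ∀ x, x ∉ Ω → w x = 0 := fun x hx => max_eq_right (foff x hx)
  have wn : ∀ x, 0 ≤ w x := fun x => le_max_right _ _
  have wl : ∀ x, w x ≤ 1 := fun x => max_le (fle x) zero_le_one
  have bnd : ∀ g : E → ℝ, Measurable g → (∀ x ∈ Ω, |g x| ≤ 1) → (∀ x, x ∉ Ω → g x = 0) →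
      Integrable (fun x => gg x * g x) μ := by
    intro g hg h1 h2
    refine d.intg hi (mgg.mul hg) 1 (fun x hx => ?_) (fun x hx => by rw [h2 x hx, mul_zero])
    rw [abs_mul, abs_of_pos (gg_pos x)]
    have := mul_le_mul (gg_le x) (h1 x hx) (abs_nonneg _) zero_le_one
    linarith [hPp x]
  have iw : Integrable (fun x => gg x * w x) μ :=
    bnd w wc.measurable (fun x _ => by rw [abs_of_nonneg (wn x)]; exact wl x) w0
  have main : ∀ δ : ℝ, 0 < δ → ∫ x, gg x * w x ∂μ ≤ 4 * δ * ∫ x, W x ∂μ := by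
    intro δ hδ
    have hcl : IsClosed {x | δ ≤ f x} := isClosed_le continuous_const fc
    have hsub : {x | δ ≤ f x} ⊆ Ω := fun x (hx : δ ≤ f x) => by
      by_contra h; have := foff x h; linarith
    have hK : IsCompact {x | δ ≤ f x} :=
      Metric.isCompact_of_isClosed_isBounded hcl (d.bdd.subset hsub)
    obtain ⟨t1, t2, t3, t4, t5⟩ := test_mk d.opn fc fcd (contDiffOn_const (c := (1:ℝ)))
      (θ := fun s => kp δ (s - δ)) (θ' := fun s => kp' δ (s - δ))
      (fun s => (kp_deriv hδ (s - δ)).comp_sub_const s δ) ((kp'_cont hδ).comp (by fun_prop)) (k := δ)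
      (fun s hs => kp_zero hδ (by linarith)) hK hsub
    simp only [mul_one] at t1 t2 t3 t4 t5
    set φ : E → ℝ := fun x => kp δ (f x - δ) with hφ
    replace t3 := t3.trans hsub
    have φn : ∀ x, 0 ≤ φ x := fun x => kp_nonneg hδ
    have φl : ∀ x, φ x ≤ w x := fun x => (kp_le hδ).trans (max_le_max (by linarith) le_rfl)
    have φo : ∀ x, x ∉ Ω → φ x = 0 := fun x hx => (supp_fderiv t3 hx).1
    have s1 := hs φ t1 t2 t3 φn
    have s2 := hw φ t1 t2 t3
    obtain ⟨B, hB, b1, b2⟩ := bd_C1c t1 t2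
    have mφ := t1.continuous.measurable
    have iφ : Integrable (fun x => gg x * φ x) μ :=
      bnd φ mφ (fun x _ => by rw [abs_of_nonneg (φn x)]; exact (φl x).trans (wl x)) φo
    have iA : Integrable (fun x => gg x * (PP ε v D x ^ (p - 2) * (fderiv ℝ φ x (D x) + ε * v x * φ x))) μ := by
      refine d.intg hi (mgg.mul ((mP _).mul ((measfd t1 d.measD).add ((mv.const_mul ε).mul mφ)))) (2 * B) (fun x _ => ?_)
        (fun x hx => by rw [(supp_fderiv t3 hx).2, φo x hx]; simp)
      refine (flux_bd hp he d.e1 v D x hB (b1 x) (b2 x)).trans ?_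
      have := hP1 x
      gcongr
    have iB : Integrable (fun x => gg x * (PP ε Ψ DΨ x ^ (p - 2) * (fderiv ℝ φ x (DΨ x) + ε * Ψ x * φ x))) μ := by
      refine d.intg hi (mgg.mul ((mQ _).mul ((measfd t1 c3.measurable).add ((mΨ.const_mul ε).mul mφ)))) (2 * B * |BQ|) (fun x hx => ?_)
        (fun x hx => by rw [(supp_fderiv t3 hx).2, φo x hx]; simp)
      refine (flux_bd hp he d.e1 Ψ DΨ x hB (b1 x) (b2 x)).trans ?_
      have h1 := hBQ' x hx
      calc _ ≤ 2 * B * |BQ| * 1 := by rw [mul_one]; gcongr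
        _ ≤ _ := by have := hPp x; gcongr; linarith
    have s3 : ∫ x, gg x * (v x ^ (p-1) * φ x) ∂μ ≤ ∫ x, gg x * φ x ∂μ := by
      refine integral_mono_of_nonneg (Filter.Eventually.of_forall fun x => ?_) iφ (Filter.Eventually.of_forall fun x => ?_)
      · exact mul_nonneg (gg_pos x).le (mul_nonneg (rpow_nonneg (d.nn x) _) (φn x))
      · have := rpow_le_one (d.nn x) (d.le1 x) (show 0 ≤ p - 1 by linarith)
        have := mul_le_mul_of_nonneg_right this (φn x)
        rw [one_mul] at this
        exact mul_le_mul_of_nonneg_left this (gg_pos x).le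
    have s4 : 0 ≤ ∫ x, gg x * φ x ∂μ := integral_nonneg fun x => mul_nonneg (gg_pos x).le (φn x)
    have s5 : lam * ∫ x, gg x * (v x ^ (p-1) * φ x) ∂μ ≤ Λ * ∫ x, gg x * φ x ∂μ :=
      (mul_le_mul_of_nonneg_left s3 hl).trans (mul_le_mul_of_nonneg_right hlΛ s4)
    have s6 : ∫ x, gg x * φ x ∂μ ≤ ∫ x, 2 * δ * W x ∂μ := by
      have : ∫ x, gg x * φ x ∂μ ≤ ∫ x, (gg x * (PP ε Ψ DΨ x ^ (p - 2) * (fderiv ℝ φ x (DΨ x) + ε * Ψ x * φ x)) -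
         gg x * (PP ε v D x ^ (p - 2) * (fderiv ℝ φ x (D x) + ε * v x * φ x))) ∂μ := by
        rw [integral_sub iB iA]; linarith
      refine this.trans (integral_mono (iB.sub iA) (iW.const_mul _) fun x => ?_)
      beta_reduce
      by_cases hx : x ∈ Ω
      swap
      · rw [(supp_fderiv t3 hx).2, φo x hx, hW, indicator_of_notMem hx]; simp
      rw [hW, indicator_of_mem hx]
      have hm := mon_nonneg hp (VV ε v D x) (VV ε Ψ DΨ x)
      unfold mon at hm
      rw [norm_VV he, norm_VV he] at hm
      change 0 ≤ ⟪PP ε v D x ^ (p-2) • VV ε v D x - PP ε Ψ DΨ x ^ (p-2) • VV ε Ψ DΨ x, VV ε v D x - VV ε Ψ DΨ x⟫ at hm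
      rw [VVinner he] at hm
      have er := kp_err (s := f x - δ) hδ
      rw [show f x - δ + δ = f x by ring] at er
      have fo := fon x hx
      have a1 : ⟪PP ε v D x ^ (p-2) • D x - PP ε Ψ DΨ x ^ (p-2) • DΨ x, D x - DΨ x⟫ =
          PP ε v D x ^ (p-2) * ⟪D x - DΨ x, D x⟫ - PP ε Ψ DΨ x ^ (p-2) * ⟪D x - DΨ x, DΨ x⟫ := by
        rw [real_inner_comm, inner_sub_right, inner_smul_right, inner_smul_right]
      rw [a1] at hm
      rw [t4 x hx, t4 x hx, ffd x hx, ffd x hx]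
      simp only [fderiv_fun_const, Pi.zero_apply, ContinuousLinearMap.zero_apply, mul_zero, add_zero]
      have p1 : |ε * v x * PP ε v D x ^ (p-2)| ≤ PP ε v D x ^ (p-1) := by
        rw [abs_mul, abs_mul, abs_of_nonneg he, abs_of_nonneg (rpow_nonneg (hP0 x) _), ← rpow_two_mul_self hp (hP0 x), mul_comm]
        exact mul_le_mul_of_nonneg_left (eps_abs_le he d.e1 v D x) (rpow_nonneg (hP0 x) _)
      have p2 : |ε * Ψ x * PP ε Ψ DΨ x ^ (p-2)| ≤ |BQ| := by
        refine le_trans ?_ (hBQ' x hx)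
        rw [abs_mul, abs_mul, abs_of_nonneg he, abs_of_nonneg (rpow_nonneg (hQ0 x) _), ← rpow_two_mul_self hp (hQ0 x), mul_comm]
        exact mul_le_mul_of_nonneg_left (eps_abs_le he d.e1 Ψ DΨ x) (rpow_nonneg (hQ0 x) _)
      set κ := kp' δ (f x - δ)
      have hκ : 0 ≤ κ := kp'_nonneg
      set X := ε * v x * PP ε v D x ^ (p-2) with hX
      set Y := ε * Ψ x * PP ε Ψ DΨ x ^ (p-2) with hY
      set a := PP ε v D x ^ (p-2) * ⟪D x - DΨ x, D x⟫
      set b' := PP ε Ψ DΨ x ^ (p-2) * ⟪D x - DΨ x, DΨ x⟫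
      have hm2 : 0 ≤ κ * ((X - Y) * f x + (a - b')) := by
        refine mul_nonneg hκ ?_
        rw [fo]
        have : (X - Y) * (v x - Ψ x) + (a - b') = ε * (PP ε v D x ^ (p-2) * v x - PP ε Ψ DΨ x ^ (p-2) * Ψ x) * (v x - Ψ x) + (a - b') := by
          rw [hX, hY]; ring
        rw [this]; exact hm
      have key : (X - Y) * (κ * f x - φ x) ≤ 2 * δ * (PP ε v D x ^ (p-1) + |BQ|) := by
        refine (le_abs_self _).trans ?_
        rw [abs_mul, mul_comm]
        have q1 : |X - Y| ≤ PP ε v D x ^ (p-1) + |BQ| := (abs_sub _ _).trans (add_le_add p1 p2)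
        rw [abs_sub_comm] at er
        exact mul_le_mul er q1 (abs_nonneg _) (by positivity)
      have fin : (b' * κ + Y * φ x) - (a * κ + X * φ x) ≤ 2 * δ * (PP ε v D x ^ (p-1) + |BQ| + 1) := by nlinarith
      have rw1 : gg x * (PP ε Ψ DΨ x ^ (p - 2) * (κ * ⟪D x - DΨ x, DΨ x⟫ + ε * Ψ x * φ x)) -
          gg x * (PP ε v D x ^ (p - 2) * (κ * ⟪D x - DΨ x, D x⟫ + ε * v x * φ x)) =
          gg x * ((b' * κ + Y * φ x) - (a * κ + X * φ x)) := by
        simp only [hX, hY, a, b']; ring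
      rw [rw1]
      have hr := rpow_nonneg (hP0 x) (p-1)
      calc _ ≤ gg x * (2 * δ * (PP ε v D x ^ (p-1) + |BQ| + 1)) := mul_le_mul_of_nonneg_left fin (gg_pos x).le
        _ ≤ 1 * (2 * δ * (PP ε v D x ^ (p-1) + |BQ| + 1)) := mul_le_mul_of_nonneg_right (gg_le x) (by positivity)
        _ = _ := one_mul _
    have s7 : ∫ x, gg x * w x ∂μ ≤ ∫ x, (gg x * φ x + 2 * δ * W x) ∂μ := by
      refine integral_mono iw (iφ.add (iW.const_mul _)) fun x => ?_
      beta_reduce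
      by_cases hx : x ∈ Ω
      swap
      · rw [w0 x hx, φo x hx, hW, indicator_of_notMem hx]; simp
      rw [hW, indicator_of_mem hx]
      have hr := rpow_nonneg (hP0 x) (p-1)
      have g1 : w x ≤ φ x + 2 * δ := by
        have := kp_ge (δ := δ) (s := f x - δ)
        have h2 : w x ≤ max (f x - δ) 0 + δ := by
          apply max_le
          · linarith [le_max_left (f x - δ) 0]
          · linarith [le_max_right (f x - δ) 0]
        linarith
      have g2 := mul_le_mul_of_nonneg_left g1 (gg_pos x).le
      have g3 := mul_le_mul_of_nonneg_right (gg_le x) (show 0 ≤ 2 * δ by linarith)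
      have g4 : 0 ≤ 2 * δ * (PP ε v D x ^ (p-1) + |BQ|) := by positivity
      linarith
    rw [integral_add iφ (iW.const_mul _), integral_const_mul] at s7
    rw [integral_const_mul] at s6
    linarith
  have le0 : ∫ x, gg x * w x ∂μ ≤ 0 := by
    have hW0 : 0 ≤ ∫ x, W x ∂μ := integral_nonneg fun x => by
      apply indicator_nonneg; intro x _; have := rpow_nonneg (hP0 x) (p-1); positivity
    by_contra hcon
    push Not at hcon
    set I := ∫ x, gg x * w x ∂μ
    set Z := ∫ x, W x ∂μ
    have := main (I / (8 * (Z + 1))) (by positivity)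
    have h2 : 4 * (I / (8 * (Z + 1))) * Z ≤ I / 2 := by
      rw [show 4 * (I / (8 * (Z + 1))) * Z = (I / 2) * (Z / (Z + 1)) by field_simp; ring]
      have : Z / (Z + 1) ≤ 1 := by rw [div_le_one (by positivity)]; linarith
      nlinarith
    linarith
  intro x hx
  by_contra hcon
  push Not at hcon
  have hwx : w x ≠ 0 := by
    have : 0 < f x := by rw [fon x hx]; linarith
    simp only [hwdef, max_eq_left this.le]; exact this.ne'
  have := Continuous.integral_pos_of_hasCompactSupport_nonneg_nonzero (μ := μ) (f := fun x => gg x * w x)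
    (gg_cd.continuous.mul wc) (HasCompactSupport.of_support_subset_isCompact d.bdd.isCompact_closure (fun y hy => by
      by_contra h
      exact hy (by simp [w0 y (fun h' => h (subset_closure h'))])))
    (fun y => mul_nonneg (gg_pos y).le (wn y)) (x := x) (mul_ne_zero (gg_pos x).ne' hwx)
  linarith
end PE

noncomputable def bN (ε a s : ℝ) : ℝ := ε * (1 - Real.exp (-(a * s))) ^ 2 + (a * Real.exp (-(a * s))) ^ 2
noncomputable def bq (p ε a s : ℝ) : ℝ := bN ε a s ^ ((p-2)/2) * (a * Real.exp (-(a * s)))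
noncomputable def bq' (p ε a s : ℝ) : ℝ :=
  (2 * ε * (1 - Real.exp (-(a * s))) * (a * Real.exp (-(a * s))) - 2 * a * (a * Real.exp (-(a * s))) ^ 2) * ((p-2)/2) *
    bN ε a s ^ ((p-2)/2 - 1) * (a * Real.exp (-(a * s))) - bN ε a s ^ ((p-2)/2) * (a * (a * Real.exp (-(a * s))))

lemma bN_pos {ε a : ℝ} (he : 0 ≤ ε) (ha : 0 < a) (s : ℝ) : 0 < bN ε a s := by
  unfold bN; positivity

lemma bE_deriv (a s : ℝ) : HasDerivAt (fun s => Real.exp (-(a * s))) (-(a * Real.exp (-(a * s)))) s := by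
  have h : HasDerivAt (fun s => -(a * s)) (-a) s := 
    HasDerivAt.congr_deriv ((hasDerivAt_id s).const_mul a).neg (by simp)
  have := h.exp
  rwa [show Real.exp (-(a * s)) * -a = -(a * Real.exp (-(a * s))) by ring] at this

lemma bq_deriv (p : ℝ) {ε a : ℝ} (he : 0 ≤ ε) (ha : 0 < a) (s : ℝ) : HasDerivAt (bq p ε a) (bq' p ε a s) s := by
  have h1 := bE_deriv a s
  have h2 : HasDerivAt (bN ε a) (2 * ε * (1 - Real.exp (-(a * s))) * (a * Real.exp (-(a * s))) - 2 * a * (a * Real.exp (-(a * s))) ^ 2) s := by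
    have := (((h1.const_sub 1).pow 2).const_mul ε).add ((h1.const_mul a).pow 2)
    refine this.congr_deriv ?_
    push_cast; ring
  have h3 := (h2.rpow_const (p := (p-2)/2) (Or.inl (bN_pos he ha s).ne')).mul (h1.const_mul a)
  refine HasDerivAt.congr_deriv h3 ?_
  unfold bq'; ring

lemma bq'_cont (p : ℝ) {ε a : ℝ} (he : 0 ≤ ε) (ha : 0 < a) : Continuous (bq' p ε a) := by
  have h : Continuous (bN ε a) := by unfold bN; fun_prop
  have h2 : ∀ r : ℝ, Continuous fun s => bN ε a s ^ r := fun r =>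
    h.rpow_const fun s => Or.inl (bN_pos he ha s).ne'
  have := h2 ((p-2)/2)
  have := h2 ((p-2)/2-1)
  unfold bq'; fun_prop

lemma bq_cd (p : ℝ) {ε a : ℝ} (he : 0 ≤ ε) (ha : 0 < a) : ContDiff ℝ 1 (bq p ε a) := by
  refine contDiff_one_iff_deriv.2 ⟨fun s => (bq_deriv p he ha s).differentiableAt, ?_⟩
  rw [show deriv (bq p ε a) = bq' p ε a from funext fun s => (bq_deriv p he ha s).deriv]
  exact bq'_cont p he ha

noncomputable def ba (p R : ℝ) : ℝ := (R + 2 + p^2) * (1 + 1 / (p-1))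

lemma ba_ge {p R : ℝ} (hp : 1 < p) (hR : 0 ≤ R) : R + 2 + p^2 ≤ ba p R ∧ R + 2 + p^2 ≤ (p-1) * ba p R := by
  have h : 0 < p - 1 := by linarith
  unfold ba
  constructor
  · have : 0 ≤ (R + 2 + p^2) * (1 / (p-1)) := by positivity
    linarith
  · rw [show (p-1) * ((R + 2 + p^2) * (1 + 1 / (p-1))) = (R + 2 + p^2) * p by field_simp; ring]
    nlinarith [sq_nonneg p]

lemma bq_ode {p ε R : ℝ} (hp : 1 < p) (he : 0 ≤ ε) (he1 : ε ≤ 1) (hR : 0 ≤ R) (s : ℝ) :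
    (R + 1) * bq p ε (ba p R) s ≤ - bq' p ε (ba p R) s := by
  obtain ⟨k1, k2⟩ := ba_ge hp hR
  set a := ba p R
  have ha : 0 < a := by nlinarith [sq_nonneg p]
  have hN := bN_pos he ha s
  unfold bq bq'
  have hNr : bN ε a s ^ ((p-2)/2) = bN ε a s ^ ((p-2)/2 - 1) * bN ε a s := by
    rw [← Real.rpow_add_one hN.ne']; congr 1; ring
  rw [hNr]
  set Nr := bN ε a s ^ ((p-2)/2 - 1) with hNrd
  have h0 : 0 < Nr := rpow_pos_of_pos hN _
  unfold bN
  set y := 1 - Real.exp (-(a * s))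
  have ht : 0 < a * Real.exp (-(a * s)) := by positivity
  set t := a * Real.exp (-(a * s))
  have key : (R + 1) * (ε * y^2 + t^2) ≤ (p-1) * a * t^2 + a * ε * y^2 - (p-2) * ε * y * t := by
    have e1 : (p-2) * ε * y * t ≤ ε * y^2 + (p-2)^2/4 * t^2 := by
      have : ε * ((p-2) * y * t) ≤ ε * (y^2 + (p-2)^2/4 * t^2) :=
        mul_le_mul_of_nonneg_left (by nlinarith [sq_nonneg (y - (p-2)/2*t)]) he
      have h2 : ε * ((p-2)^2/4 * t^2) ≤ 1 * ((p-2)^2/4 * t^2) := by gcongr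
      linarith
    have e2 : (R + 1 + (p-2)^2/4) * t^2 ≤ (p-1) * a * t^2 := by
      apply mul_le_mul_of_nonneg_right _ (sq_nonneg t); nlinarith
    have e3 : (R + 2) * (ε * y^2) ≤ a * (ε * y^2) := by
      apply mul_le_mul_of_nonneg_right _ (by positivity); nlinarith
    linarith
  have := mul_le_mul_of_nonneg_left key (mul_nonneg h0.le ht.le)
  linarith

lemma bq_lower {p ε a D0 s : ℝ} (he : 0 ≤ ε) (he1 : ε ≤ 1) (ha : 0 < a) (h0 : 0 < s) (h1 : s ≤ D0) :
    min (((a * Real.exp (-(a * D0))) ^ 2) ^ ((p-2)/2)) ((1 + a^2) ^ ((p-2)/2)) * (a * Real.exp (-(a * D0))) ≤ bq p ε a s := by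
  have hN := bN_pos he ha s
  have e1 : Real.exp (-(a * D0)) ≤ Real.exp (-(a*s)) := by
    apply Real.exp_le_exp.2; nlinarith
  have e2 : Real.exp (-(a*s)) ≤ 1 := by rw [Real.exp_le_one_iff]; nlinarith
  have e3 := Real.exp_pos (-(a*s))
  have e4 := Real.exp_pos (-(a*D0))
  unfold bq
  refine mul_le_mul ?_ (by gcongr) (by positivity) (by positivity)
  have l1 : (a * Real.exp (-(a * D0))) ^ 2 ≤ bN ε a s := by
    unfold bN
    have : (a * Real.exp (-(a * D0))) ^ 2 ≤ (a * Real.exp (-(a * s))) ^ 2 := by gcongr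
    have : 0 ≤ ε * (1 - Real.exp (-(a * s))) ^ 2 := by positivity
    linarith
  have l2 : bN ε a s ≤ 1 + a^2 := by
    unfold bN
    have : (a * Real.exp (-(a * s))) ^ 2 ≤ (a * 1) ^ 2 := by gcongr
    have h3 : (1 - Real.exp (-(a * s))) ^ 2 ≤ 1 := by
      rw [sq_le_one_iff_abs_le_one, abs_le]; constructor <;> linarith
    have : ε * (1 - Real.exp (-(a * s))) ^ 2 ≤ 1 * 1 := by gcongr
    nlinarith
  rcases le_total 0 ((p-2)/2) with h | h
  · exact (min_le_left _ _).trans (rpow_le_rpow (by positivity) l1 h)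
  · exact (min_le_right _ _).trans (rpow_le_rpow_of_nonpos hN l2 h)

section PE2
set_option linter.unusedSectionVars false
variable {E : Type*} [NormedAddCommGroup E] [InnerProductSpace ℝ E] [FiniteDimensional ℝ E]
  [CompleteSpace E] [MeasurableSpace E] [BorelSpace E]
variable {p lam ε : ℝ} {Ω : Set E} {v : E → ℝ} {D : E → E} {μ : Measure E} [μ.IsAddHaarMeasure]

lemma lin_deriv (ν z x : E) : HasFDerivAt (fun x : E => ⟪ν, z - x⟫) (-(innerSL ℝ ν)) x := by
  have h : HasFDerivAt (fun x : E => ⟪ν, z⟫ - innerSL ℝ ν x) (-(innerSL ℝ ν)) x :=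
    ((innerSL ℝ ν).hasFDerivAt).const_sub _
  convert h using 1
  funext x; simp [inner_sub_right]

theorem barrier (hp : 1 < p) {R Λ D0 : ℝ} (hR0 : 0 ≤ R) (hΛ : 0 ≤ Λ) (hD : 0 < D0) :
    ∃ L : ℝ, 0 ≤ L ∧ ∀ (ε lam : ℝ) (Ω : Set E) (v : E → ℝ) (D : E → E), Dat ε Ω v D →
      Integrable (fun x => PP ε v D x ^ p) μ → ELw p lam ε Ω v D μ → 0 ≤ lam → lam ≤ Λ →
      (∀ x ∈ Ω, ‖x‖ ≤ R) → ∀ ν z : E, ‖ν‖ = 1 → (∀ x ∈ Ω, 0 < ⟪ν, z - x⟫) → (∀ x ∈ Ω, ⟪ν, z - x⟫ ≤ D0) →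
      ∀ x ∈ Ω, v x ≤ L * ⟪ν, z - x⟫ := by
  obtain ⟨k1, k2⟩ := ba_ge hp hR0
  set a := ba p R with had
  have ha : 0 < a := by nlinarith [sq_nonneg p]
  set c := min (((a * Real.exp (-(a * D0))) ^ 2) ^ ((p-2)/2)) ((1 + a^2) ^ ((p-2)/2)) * (a * Real.exp (-(a * D0))) with hc
  have hc0 : 0 < c := mul_pos (lt_min (by positivity) (by positivity)) (by positivity)
  have hp1 : 0 < p - 1 := by linarith
  set K := ((Λ + 1) / c) ^ (1 / (p-1)) with hK
  have hK0 : 0 < K := by positivity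
  have hKp : K ^ (p-1) * c = Λ + 1 := by
    rw [hK, ← rpow_mul (by positivity), one_div_mul_cancel hp1.ne', rpow_one]; field_simp
  refine ⟨K * a, by positivity, ?_⟩
  intro ε lam Ω v D d hi hw hl hlΛ hR ν z hν hs0 hsD
  have he := d.e0.le
  set σ : E → ℝ := fun x => ⟪ν, z - x⟫ with hσ
  have σd : ∀ x, HasFDerivAt σ (-(innerSL ℝ ν)) x := lin_deriv ν z
  have σc : ContDiff ℝ 1 σ := contDiff_const.inner ℝ (contDiff_const.sub contDiff_id)
  set e : E → ℝ := fun x => Real.exp (-(a * σ x)) with hedef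
  set Ψ : E → ℝ := fun x => K * (1 - e x) with hΨ
  set DΨ : E → E := fun x => -(K * (a * e x)) • ν with hDΨ
  have ec : Continuous e := by simp only [hedef]; have := σc.continuous; fun_prop
  have c1 : ContDiff ℝ 1 Ψ := by simp only [hΨ, hedef]; fun_prop
  have c2 : ∀ x ∈ Ω, 0 < Ψ x := by
    intro x hx
    have : e x < 1 := by simp only [hedef]; rw [Real.exp_lt_one_iff]; have := mul_pos ha (hs0 x hx); simp only [hσ]; linarith
    exact mul_pos hK0 (by linarith)
  have c3 : Continuous DΨ := by simp only [hDΨ]; fun_prop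
  have c4 : ∀ x y, fderiv ℝ Ψ x y = ⟪DΨ x, y⟫ := by
    intro x y
    have h1 := (((bE_deriv a (σ x)).const_sub 1).const_mul K).comp_hasFDerivAt x (σd x)
    have h2 : fderiv ℝ Ψ x = _ := h1.fderiv
    rw [h2]
    simp [hDΨ, hedef, inner_smul_left]
  have hPP : ∀ x, PP ε Ψ DΨ x ^ (p-2) * (K * (a * e x)) = K ^ (p-1) * bq p ε a (σ x) := by
    intro x
    have e1 : PP ε Ψ DΨ x = √(K^2 * bN ε a (σ x)) := by
      unfold PP bN
      congr 1
      simp only [hDΨ, hΨ, hedef, norm_smul, hν, mul_one, norm_neg, Real.norm_eq_abs, sq_abs]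
      ring
    rw [e1, Real.sqrt_mul (by positivity), Real.sqrt_sq hK0.le, mul_rpow hK0.le (Real.sqrt_nonneg _),
      ← rpow_two_mul_self hp hK0.le, Real.sqrt_eq_rpow, ← rpow_mul (bN_pos he ha _).le]
    unfold bq
    rw [show 1 / 2 * (p-2) = (p-2)/2 by ring]
    ring
  have cmp := compare hp d hi hw hl hlΛ c1 c2 c3 c4 ?_
  · intro x hx
    refine (cmp x hx).trans ?_
    have := Real.add_one_le_exp (-(a * σ x))
    simp only [hΨ, hedef]
    have : 1 - Real.exp (-(a * σ x)) ≤ a * σ x := by linarith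
    calc _ ≤ K * (a * σ x) := by gcongr
      _ = _ := by ring
  · intro φ h1 h2 h3 hφ
    have hfc : Continuous (fderiv ℝ φ) := h1.continuous_fderiv (by norm_num)
    set h : E → ℝ := fun x => gg x * bq p ε a (σ x) with hh
    have hcd : ContDiff ℝ 1 h := gg_cd.mul ((bq_cd p he ha).comp σc)
    have hhf : ∀ x, fderiv ℝ h x ν = gg x * (-⟪x, ν⟫ * bq p ε a (σ x) - bq' p ε a (σ x)) := by
      intro x
      have e1 := (bq_deriv p he ha (σ x)).comp_hasFDerivAt x (σd x)
      have e2 := (((gg_cd (E := E)).differentiable (by norm_num)) x).hasFDerivAt.mul e1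
      have e3 : fderiv ℝ h x = _ := e2.fderiv
      rw [e3]
      simp [gg_fderiv, hν]
      ring
    have hfν : Continuous (fun x => fderiv ℝ φ x ν) := by fun_prop
    have hfs : HasCompactSupport (fun x => fderiv ℝ φ x ν) := h2.fderiv_apply (𝕜 := ℝ) ν
    have hhc : Continuous (fun x => fderiv ℝ h x ν) := by
      have := hcd.continuous_fderiv (by norm_num); fun_prop
    have i1 : Integrable (fun x => h x * fderiv ℝ φ x ν) μ :=
      (hcd.continuous.mul hfν).integrable_of_hasCompactSupport hfs.mul_left
    have i2 : Integrable (fun x => fderiv ℝ h x ν * φ x) μ :=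
      (hhc.mul h1.continuous).integrable_of_hasCompactSupport h2.mul_left
    have i3 : Integrable (fun x => h x * φ x) μ :=
      (hcd.continuous.mul h1.continuous).integrable_of_hasCompactSupport h2.mul_left
    have i5 : Integrable (fun x => gg x * φ x) μ :=
      (gg_cd.continuous.mul h1.continuous).integrable_of_hasCompactSupport h2.mul_left
    have ibp := integral_mul_fderiv_eq_neg_fderiv_mul_of_integrable (μ := μ) (v := ν) i2 i1 i3
      (fun x _ => hcd.differentiable (by norm_num) x) (fun x _ => h1.differentiable (by norm_num) x)
    have PΨ : Continuous (PP ε Ψ DΨ) := by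
      unfold PP; have := c1.continuous; fun_prop
    have PΨpos : ∀ x, 0 < PP ε Ψ DΨ x := fun x => by
      unfold PP
      apply Real.sqrt_pos.2
      have : 0 < ‖DΨ x‖ := by simp only [hDΨ, norm_smul, hν, mul_one, norm_neg, Real.norm_eq_abs]; positivity
      positivity
    have PΨc : Continuous (fun x => PP ε Ψ DΨ x ^ (p-2)) := PΨ.rpow_const fun x => Or.inl (PΨpos x).ne'
    have i4 : Integrable (fun x => gg x * (PP ε Ψ DΨ x ^ (p-2) * (ε * Ψ x * φ x))) μ := by
      have := (gg_cd (E := E)).continuous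
      have := c1.continuous
      have := h1.continuous
      refine Continuous.integrable_of_hasCompactSupport (by fun_prop) ?_
      refine h2.mono fun x hx => ?_
      contrapose! hx
      simp only [Function.mem_support, not_not] at hx ⊢
      rw [hx]; ring
    have split : ∀ x, gg x * (PP ε Ψ DΨ x ^ (p - 2) * (fderiv ℝ φ x (DΨ x) + ε * Ψ x * φ x)) =
        (-K ^ (p-1)) * (h x * fderiv ℝ φ x ν) + gg x * (PP ε Ψ DΨ x ^ (p-2) * (ε * Ψ x * φ x)) := by
      intro x
      have : fderiv ℝ φ x (DΨ x) = -((K * (a * e x)) * fderiv ℝ φ x ν) := by simp [hDΨ]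
      rw [this]
      simp only [hh]
      linear_combination (- gg x * fderiv ℝ φ x ν) * hPP x
    simp only [split]
    rw [integral_add (i1.const_mul _) i4, integral_const_mul, ibp]
    have t1 : 0 ≤ ∫ x, gg x * (PP ε Ψ DΨ x ^ (p-2) * (ε * Ψ x * φ x)) ∂μ := by
      refine integral_nonneg fun x => ?_
      by_cases hx : x ∈ Ω
      · have := c2 x hx; have := hφ x; have := gg_pos x; have := PΨpos x; positivity
      · simp [(supp_fderiv h3 hx).1]
    have t2 : c * ∫ x, gg x * φ x ∂μ ≤ ∫ x, fderiv ℝ h x ν * φ x ∂μ := by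
      rw [← integral_const_mul]
      refine integral_mono (i5.const_mul _) i2 fun x => ?_
      beta_reduce
      by_cases hx : x ∈ Ω
      swap
      · simp [(supp_fderiv h3 hx).1]
      rw [hhf]
      have lo := bq_lower (p := p) he d.e1 ha (hs0 x hx) (hsD x hx)
      rw [← hc] at lo
      have od := bq_ode hp he d.e1 hR0 (σ x)
      rw [← had] at od
      have ip : ⟪x, ν⟫ ≤ R := (real_inner_le_norm _ _).trans (by rw [hν, mul_one]; exact hR x hx)
      have : c ≤ -⟪x, ν⟫ * bq p ε a (σ x) - bq' p ε a (σ x) := by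
        have := mul_le_mul_of_nonneg_right ip (hc0.le.trans lo)
        change c ≤ bq p ε a (σ x) at lo
        linarith
      have g := mul_nonneg (gg_pos x).le (hφ x)
      nlinarith [mul_le_mul_of_nonneg_right this g]
    have t3 := mul_le_mul_of_nonneg_left t2 (rpow_nonneg hK0.le (p-1))
    have : K ^ (p-1) * (c * ∫ x, gg x * φ x ∂μ) = (Λ + 1) * ∫ x, gg x * φ x ∂μ := by rw [← hKp]; ring
    linarith

end PE2

section PE3
set_option linter.unusedSectionVars false
variable {E : Type*} [NormedAddCommGroup E] [InnerProductSpace ℝ E] [FiniteDimensional ℝ E]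
  [CompleteSpace E] [MeasurableSpace E] [BorelSpace E]
variable {p : ℝ} {Ω : Set E} {μ : Measure E} [μ.IsAddHaarMeasure]

lemma normal_exists (ho : IsOpen Ω) (hc : Convex ℝ Ω) (hne : Ω.Nonempty) {z : E} (hz : z ∉ Ω) :
    ∃ ν : E, ‖ν‖ = 1 ∧ ∀ x ∈ Ω, 0 < ⟪ν, z - x⟫ := by
  obtain ⟨f, hf⟩ := geometric_hahn_banach_open_point hc ho hz
  set w := (InnerProductSpace.toDual ℝ E).symm f with hw
  have hwf : ∀ x, ⟪w, x⟫ = f x := fun x => by rw [hw, InnerProductSpace.toDual_symm_apply]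
  obtain ⟨y, hy⟩ := hne
  have hw0 : w ≠ 0 := fun h => by
    have h1 := hf y hy
    rw [← hwf, ← hwf, h] at h1; simp at h1
  have hn : 0 < ‖w‖ := norm_pos_iff.2 hw0
  refine ⟨(‖w‖)⁻¹ • w, by rw [norm_smul, norm_inv, norm_norm, inv_mul_cancel₀ hn.ne'], fun x hx => ?_⟩
  rw [inner_smul_left, hwf, map_sub]
  have := hf x hx
  exact mul_pos (by simpa using hw0) (by linarith)

theorem core (hp : 1 < p) (hn : 2 ≤ Module.finrank ℝ E) (ho : IsOpen Ω) (hc : Convex ℝ Ω)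
    {R Λ C2 : ℝ} (hR : ∀ x ∈ Ω, ‖x‖ ≤ R) (hR0 : 0 ≤ R) (hΛ : 0 ≤ Λ) (hC2 : 0 ≤ C2) (hμ : μ.real Ω ≤ C2) :
    ∃ β M : ℝ, 0 < β ∧ β < 1 ∧ 0 < M ∧ ∀ (ε lam : ℝ) (v : E → ℝ) (D : E → E), Dat ε Ω v D →
      Integrable (fun x => PP ε v D x ^ p) μ → ELw p lam ε Ω v D μ → 0 ≤ lam → lam ≤ Λ →
      ∫ x, PP ε v D x ^ p ∂μ ≤ C2 → ∀ x h, |v (x + h) - v x| ≤ M * ‖h‖ ^ β := by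
  obtain ⟨L, hL, bar⟩ := barrier (E := E) (μ := μ) hp hR0 hΛ (D0 := 1 + 2 * R) (by linarith)
  obtain ⟨β, M, h1, h2, h3, H⟩ := holder_main (E := E) hp hn (C := Λ + R + 1) (by positivity) (L := L + 1) (by linarith) hC2 μ
  refine ⟨β, M, h1, h2, h3, fun ε lam v D d hi hw hl hlΛ hen => ?_⟩
  refine H ε Ω v D d (hw.toELp hp d hi hR hR0 hl hlΛ) hi hen hμ fun z hz y => ?_
  by_cases hy : y ∈ Ω
  swap
  · rw [d.off y hy]; positivity
  rcases le_total 1 ‖y - z‖ with h | h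
  · have := d.le1 y
    nlinarith
  obtain ⟨ν, hν, hs⟩ := normal_exists ho hc ⟨y, hy⟩ hz
  have ipl : ∀ x, ⟪ν, z - x⟫ ≤ ‖z - x‖ := fun x => (real_inner_le_norm _ _).trans (by rw [hν, one_mul])
  have hzR : ‖z‖ ≤ 1 + R := by
    have e : z = y - (y - z) := by abel
    rw [e]; refine (norm_sub_le _ _).trans ?_; linarith [hR y hy]
  have := bar ε lam Ω v D d hi hw hl hlΛ hR ν z hν hs (fun x hx => (ipl x).trans ((norm_sub_le _ _).trans (by linarith [hR x hx]))) y hy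
  have h5 := mul_le_mul_of_nonneg_left (ipl y) hL
  rw [norm_sub_rev] at h5
  linarith [norm_nonneg (y - z)]
end PE3

section PL
variable {n : ℕ} {p ε : ℝ} {Ω : Set (EuclideanSpace ℝ (Fin n))}

noncomputable def cG (n : ℕ) : ℝ := (2 * π) ^ (-(n : ℝ) / 2)

lemma cG_pos (n : ℕ) : 0 < cG n := by unfold cG; have := Real.pi_pos; positivity

lemma gm_restrict (ho : IsOpen Ω) : (gaussianMeasure n).restrict Ω =
    (volume.restrict Ω).withDensity (fun x => ENNReal.ofReal (cG n * gg x)) := by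
  unfold gaussianMeasure
  rw [restrict_withDensity ho.measurableSet]; rfl

lemma dens_meas : Measurable (fun x : EuclideanSpace ℝ (Fin n) => cG n * gg x) :=
  (gg_cd.continuous.measurable).const_mul _

lemma gm_integral (ho : IsOpen Ω) {f : EuclideanSpace ℝ (Fin n) → ℝ} (hf : ∀ x, x ∉ Ω → f x = 0) :
    ∫ x in Ω, f x ∂(gaussianMeasure n) = cG n * ∫ x, gg x * f x := by
  rw [gm_restrict ho, integral_withDensity_eq_integral_toReal_smul dens_meas.ennreal_ofReal
    (Filter.Eventually.of_forall fun x => ENNReal.ofReal_lt_top)]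
  have : ∀ x : EuclideanSpace ℝ (Fin n), (ENNReal.ofReal (cG n * gg x)).toReal • f x = cG n * (gg x * f x) := fun x => by
    rw [ENNReal.toReal_ofReal (mul_nonneg (cG_pos n).le (gg_pos x).le), smul_eq_mul, mul_assoc]
  simp only [this]
  rw [integral_const_mul, setIntegral_eq_integral_of_forall_compl_eq_zero]
  intro x hx; rw [hf x hx, mul_zero]

lemma gm_integrable (ho : IsOpen Ω) {f : EuclideanSpace ℝ (Fin n) → ℝ} (hf : ∀ x, x ∉ Ω → f x = 0)
    (hm : Measurable f) {R : ℝ} (hR : ∀ x ∈ Ω, ‖x‖ ≤ R) (hi : Integrable f ((gaussianMeasure n).restrict Ω)) :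
    Integrable f := by
  rw [gm_restrict ho, integrable_withDensity_iff_integrable_smul' dens_meas.ennreal_ofReal
    (Filter.Eventually.of_forall fun x => ENNReal.ofReal_lt_top)] at hi
  have : ∀ x : EuclideanSpace ℝ (Fin n), (ENNReal.ofReal (cG n * gg x)).toReal • f x = cG n * (gg x * f x) := fun x => by
    rw [ENNReal.toReal_ofReal (mul_nonneg (cG_pos n).le (gg_pos x).le), smul_eq_mul, mul_assoc]
  simp only [this] at hi
  have h2 : IntegrableOn f Ω := by
    refine Integrable.mono' (hi.norm.const_mul ((cG n)⁻¹ * Real.exp (R^2/2))) hm.aestronglyMeasurable ?_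
    filter_upwards [ae_restrict_mem ho.measurableSet] with x hx
    have hg := gg_pos x
    have hc := cG_pos n
    rw [norm_mul, norm_mul, Real.norm_of_nonneg hc.le, Real.norm_of_nonneg hg.le]
    rw [show (cG n)⁻¹ * Real.exp (R^2/2) * (cG n * (gg x * ‖f x‖)) = (Real.exp (R^2/2) * gg x) * ‖f x‖ by field_simp]
    have : 1 ≤ Real.exp (R^2/2) * gg x := by
      unfold gg; rw [← Real.exp_add]; apply Real.one_le_exp
      have := pow_le_pow_left₀ (norm_nonneg x) (hR x hx) 2
      linarith
    nlinarith [norm_nonneg (f x)]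
  exact (integrableOn_iff_integrable_of_support_subset (fun x hx => by
    by_contra h; exact hx (hf x h))).1 h2

lemma gm_fin (ho : IsOpen Ω) (hb : IsBounded Ω) : IsFiniteMeasure ((gaussianMeasure n).restrict Ω) := by
  rw [gm_restrict ho]
  have : Integrable (fun x : EuclideanSpace ℝ (Fin n) => cG n * gg x) (volume.restrict Ω) := by
    refine Integrable.const_mul ?_ _
    have hf : IsFiniteMeasure ((volume : Measure (EuclideanSpace ℝ (Fin n))).restrict Ω) :=
      ⟨by rw [Measure.restrict_apply_univ]; exact hb.measure_lt_top⟩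
    exact Integrable.mono' (integrable_const (1:ℝ)) gg_cd.continuous.measurable.aestronglyMeasurable
      (Filter.Eventually.of_forall fun x => by rw [Real.norm_of_nonneg (gg_pos x).le]; exact gg_le x)
  exact isFiniteMeasure_withDensity_ofReal this.2

lemma Jeps_eq (he : 0 ≤ ε) (v : EuclideanSpace ℝ (Fin n) → ℝ) :
    Jeps n p ε Ω v = ∫ x in Ω, PP ε v (gradient v) x ^ p ∂(gaussianMeasure n) := by
  unfold Jeps PP
  congr 1; funext x
  rw [Real.sqrt_eq_rpow, ← rpow_mul (by positivity)]; congr 1; ring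

lemma test_int (hp : 1 < p) (ho : IsOpen Ω) (hb : IsBounded Ω) {φ : EuclideanSpace ℝ (Fin n) → ℝ} (h : IsTestFun n Ω φ) :
    Integrable (fun x => |φ x| ^ p) ((gaussianMeasure n).restrict Ω) := by
  have := gm_fin ho hb
  have hc : Continuous (fun x => |φ x| ^ p) := h.1.continuous.abs.rpow_const fun x => Or.inr (by linarith)
  have hs : HasCompactSupport (fun x => |φ x| ^ p) := h.2.1.mono fun x hx => by
    contrapose! hx
    simp only [Function.mem_support, not_not] at hx ⊢
    rw [hx, abs_zero, zero_rpow (by linarith)]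
  exact hc.integrable_of_hasCompactSupport hs

lemma test_smul {φ : EuclideanSpace ℝ (Fin n) → ℝ} (h : IsTestFun n Ω φ) (c : ℝ) :
    IsTestFun n Ω (fun x => c * φ x) :=
  ⟨contDiff_const.mul h.1, h.2.1.mul_left (f := fun _ => c), (tsupport_mul_subset_right (f := fun _ => c)).trans h.2.2⟩

lemma PP_smul {v : EuclideanSpace ℝ (Fin n) → ℝ} {c : ℝ} (hc : 0 ≤ c) (x : EuclideanSpace ℝ (Fin n))
    (hv : DifferentiableAt ℝ v x) :
    PP ε (fun x => c * v x) (gradient fun x => c * v x) x = c * PP ε v (gradient v) x := by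
  unfold PP
  rw [norm_grad, norm_grad, fderiv_const_mul hv c, norm_smul, Real.norm_of_nonneg hc,
    show ε * (c * v x)^2 + (c * ‖fderiv ℝ v x‖)^2 = c^2 * (ε * v x ^2 + ‖fderiv ℝ v x‖^2) by ring,
    Real.sqrt_mul (by positivity), Real.sqrt_sq hc]

lemma test_norm (hp : 1 < p) {φ : EuclideanSpace ℝ (Fin n) → ℝ} (h : IsTestFun n Ω φ)
    (hA : 0 < ∫ x in Ω, |φ x| ^ p ∂(gaussianMeasure n)) (he : 0 ≤ ε) :
    ∃ ψ, IsTestFun n Ω ψ ∧ ∫ x in Ω, |ψ x| ^ p ∂(gaussianMeasure n) = 1 ∧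
      Jeps n p ε Ω ψ * ∫ x in Ω, |φ x| ^ p ∂(gaussianMeasure n) = Jeps n p ε Ω φ := by
  set A := ∫ x in Ω, |φ x| ^ p ∂(gaussianMeasure n)
  set c := (A ^ (1/p))⁻¹ with hc
  have hc0 : 0 < c := by positivity
  have hcp : c ^ p = A⁻¹ := by
    rw [hc, inv_rpow (by positivity), ← rpow_mul hA.le, one_div_mul_cancel (by linarith), rpow_one]
  refine ⟨fun x => c * φ x, test_smul h c, ?_, ?_⟩
  · have : ∀ x, |c * φ x| ^ p = c ^ p * |φ x| ^ p := fun x => by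
      rw [abs_mul, abs_of_pos hc0, mul_rpow hc0.le (abs_nonneg _)]
    simp only [this]
    rw [integral_const_mul, hcp]; exact inv_mul_cancel₀ hA.ne'
  · rw [Jeps_eq he, Jeps_eq he]
    have : ∀ x, PP ε (fun x => c * φ x) (gradient fun x => c * φ x) x ^ p = c ^ p * PP ε φ (gradient φ) x ^ p := fun x => by
      rw [PP_smul hc0.le x (h.1.differentiable (by simp) x), mul_rpow hc0.le (PP_nonneg _ _ _ _)]
    simp only [this]
    rw [integral_const_mul, hcp]; field_simp

lemma test_exists (hp : 1 < p) (ho : IsOpen Ω) (hne : Ω.Nonempty) :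
    ∃ ψ, IsTestFun n Ω ψ ∧ ∫ x in Ω, |ψ x| ^ p ∂(gaussianMeasure n) = 1 := by
  obtain ⟨x0, hx0⟩ := hne
  obtain ⟨r, hr, hrb⟩ := Metric.isOpen_iff.1 ho x0 hx0
  let b : ContDiffBump x0 := ⟨r/4, r/2, by positivity, by linarith⟩
  have hb : IsTestFun n Ω b := ⟨b.contDiff, b.hasCompactSupport, by
    rw [b.tsupport_eq]; exact (closedBall_subset_ball (by change r/2 < r; linarith)).trans hrb⟩
  have hz : ∀ x, x ∉ Ω → |b x| ^ p = 0 := fun x hx => by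
    rw [image_eq_zero_of_notMem_tsupport (fun h => hx (hb.2.2 h)), abs_zero, zero_rpow (by linarith)]
  have hpos : 0 < ∫ x in Ω, |b x| ^ p ∂(gaussianMeasure n) := by
    rw [gm_integral ho hz]
    refine mul_pos (cG_pos n) ?_
    refine Continuous.integral_pos_of_hasCompactSupport_nonneg_nonzero (x := x0)
      (gg_cd.continuous.mul (b.continuous.abs.rpow_const fun x => Or.inr (by linarith))) ?_ ?_ ?_
    · refine b.hasCompactSupport.mono fun x hx => ?_
      contrapose! hx
      simp only [Function.mem_support, not_not] at hx ⊢
      rw [hx, abs_zero, zero_rpow (by linarith), mul_zero]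
    · intro x; exact mul_nonneg (gg_pos x).le (by positivity)
    · have : b x0 = 1 := b.one_of_mem_closedBall (mem_closedBall_self b.rIn_pos.le)
      rw [this]; simp [(gg_pos x0).ne']
  obtain ⟨ψ, h1, h2, -⟩ := test_norm (ε := 0) hp hb hpos le_rfl
  exact ⟨ψ, h1, h2⟩

lemma J_nonneg (he : 0 ≤ ε) (v : EuclideanSpace ℝ (Fin n) → ℝ) : 0 ≤ Jeps n p ε Ω v := by
  rw [Jeps_eq he]; exact integral_nonneg fun x => rpow_nonneg (PP_nonneg _ _ _ _) _

lemma lam_le (he : 0 ≤ ε) {ψ : EuclideanSpace ℝ (Fin n) → ℝ} (h : IsTestFun n Ω ψ)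
    (h1 : ∫ x in Ω, |ψ x| ^ p ∂(gaussianMeasure n) = 1) : lambdaEps n p ε Ω ≤ Jeps n p ε Ω ψ := by
  refine csInf_le ⟨0, ?_⟩ ⟨ψ, h, h1, rfl⟩
  rintro r ⟨w, -, -, rfl⟩
  exact J_nonneg he w

lemma test_J_int (hp : 1 < p) (ho : IsOpen Ω) (hb : IsBounded Ω) (he : 0 ≤ ε) (he1 : ε ≤ 1)
    {ψ : EuclideanSpace ℝ (Fin n) → ℝ} (h : IsTestFun n Ω ψ) :
    Integrable (fun x => PP ε ψ (gradient ψ) x ^ p) ((gaussianMeasure n).restrict Ω) := by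
  have := gm_fin ho hb
  exact PP_int_C1c hp he he1 (h.1.of_le (by simp)) h.2.1

lemma lam_unif (hp : 1 < p) (ho : IsOpen Ω) (hb : IsBounded Ω) (hne : Ω.Nonempty) :
    ∃ Λ : ℝ, 0 ≤ Λ ∧ ∀ ε, 0 ≤ ε → ε ≤ 1 → lambdaEps n p ε Ω ≤ Λ := by
  obtain ⟨ψ, h1, h2⟩ := test_exists hp ho hne
  refine ⟨Jeps n p 1 Ω ψ, J_nonneg zero_le_one _, fun ε he he1 => (lam_le he h1 h2).trans ?_⟩
  rw [Jeps_eq he, Jeps_eq zero_le_one]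
  refine integral_mono (test_J_int hp ho hb he he1 h1) (test_J_int hp ho hb zero_le_one le_rfl h1) fun x => ?_
  refine rpow_le_rpow (PP_nonneg _ _ _ _) ?_ (by linarith)
  unfold PP
  gcongr

lemma lam_pos (hp : 1 < p) (ho : IsOpen Ω) (hb : IsBounded Ω) (hne : Ω.Nonempty) (he : 0 < ε) (he1 : ε ≤ 1) :
    0 < lambdaEps n p ε Ω := by
  have h : (√ε) ^ p ≤ lambdaEps n p ε Ω := by
    obtain ⟨ψ, h1, h2⟩ := test_exists hp ho hne
    refine le_csInf ⟨_, ψ, h1, h2, rfl⟩ ?_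
    rintro r ⟨w, w1, w2, rfl⟩
    rw [Jeps_eq he.le, ← mul_one ((√ε)^p), ← w2, ← integral_const_mul]
    refine integral_mono ((test_int hp ho hb w1).const_mul _) (test_J_int hp ho hb he.le he1 w1) fun x => ?_
    beta_reduce
    rw [← mul_rpow (Real.sqrt_nonneg _) (abs_nonneg _)]
    exact rpow_le_rpow (by positivity) (v_le_PP he.le _ _ x) (by linarith)
  have : 0 < (√ε) ^ p := by positivity
  linarith

lemma lam_min (hp : 1 < p) (he : 0 ≤ ε) {φ : EuclideanSpace ℝ (Fin n) → ℝ} (h : IsTestFun n Ω φ) :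
    lambdaEps n p ε Ω * ∫ x in Ω, |φ x| ^ p ∂(gaussianMeasure n) ≤
      ∫ x in Ω, PP ε φ (gradient φ) x ^ p ∂(gaussianMeasure n) := by
  rw [← Jeps_eq he]
  have h0 : 0 ≤ ∫ x in Ω, |φ x| ^ p ∂(gaussianMeasure n) := integral_nonneg fun x => by positivity
  rcases h0.eq_or_lt with h0 | h0
  · rw [← h0, mul_zero]; exact J_nonneg he _
  · obtain ⟨ψ, h1, h2, h3⟩ := test_norm (ε := ε) hp h h0 he
    rw [← h3]
    exact mul_le_mul_of_nonneg_right (lam_le he h1 h2) h0.le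

end PL

theorem regularized_minimizers_uniform_holder
    (n : ℕ) (hn : 2 ≤ n) (p : ℝ) (hp : 1 < p)
    (Ω : Set (EuclideanSpace ℝ (Fin n)))
    (hΩo : IsOpen Ω) (hΩb : IsBounded Ω) (hΩconv : Convex ℝ Ω) (hΩ2 : HasC2Boundary n Ω)
    (hsc : ∃ R : ℝ, 0 < R ∧ ∀ x ∈ frontier Ω, ∃ y : EuclideanSpace ℝ (Fin n),
      dist x y = R ∧ closure Ω ⊆ Metric.closedBall y R) :
    ∃ (M β ε₀ : ℝ), 0 < M ∧ β ∈ Set.Ioo (0 : ℝ) 1 ∧ 0 < ε₀ ∧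
      ∀ ε : ℝ, 0 < ε → ε < ε₀ →
        ∀ uε : EuclideanSpace ℝ (Fin n) → ℝ, IsNormalizedMinimizer n p ε Ω uε →
          (∀ x ∈ closure Ω, |uε x| ≤ M) ∧
          (∀ x ∈ closure Ω, ∀ y ∈ closure Ω, |uε x - uε y| ≤ M * ‖x - y‖ ^ β) := by
  have hp0 : 0 < p := by linarith
  rcases Ω.eq_empty_or_nonempty with hne | hne
  · subst hne
    exact ⟨1, 1/2, 1, one_pos, ⟨by norm_num, by norm_num⟩, one_pos, fun ε _ _ u _ => by simp⟩
  obtain ⟨R, hR0, hR⟩ : ∃ R : ℝ, 0 ≤ R ∧ ∀ x ∈ Ω, ‖x‖ ≤ R := by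
    obtain ⟨R, hR⟩ := hΩb.exists_norm_le
    exact ⟨|R|, abs_nonneg _, fun x hx => (hR x hx).trans (le_abs_self _)⟩
  obtain ⟨Λ, hΛ, hΛl⟩ := lam_unif hp hΩo hΩb hne
  have hfin := gm_fin hΩo hΩb
  set γ := (gaussianMeasure n).restrict Ω with hγ
  set g0 : ℝ := Real.exp (-R^2/2) with hg0
  have hg0p : 0 < g0 := Real.exp_pos _
  have hgg : ∀ x ∈ Ω, g0 ≤ gg x := fun x hx => by
    apply Real.exp_le_exp.2
    have := pow_le_pow_left₀ (norm_nonneg x) (hR x hx) 2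
    linarith
  have hcG := cG_pos n
  set C2 : ℝ := (g0 * cG n)⁻¹ * (Λ * γ.real univ) + volume.real Ω with hC2
  have hC20 : 0 ≤ C2 := by positivity
  obtain ⟨β, M, hβ0, hβ1, hM, H⟩ := core (E := EuclideanSpace ℝ (Fin n)) (μ := volume) hp (by simpa using hn) hΩo hΩconv hR hR0 hΛ hC20
    (by rw [hC2]; have : 0 ≤ (g0 * cG n)⁻¹ * (Λ * γ.real univ) := by positivity
        linarith)
  set r1 : ℝ := (1 / (2 * M)) ^ (1 / β) with hr1
  have hr1p : 0 < r1 := by positivity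
  have hr1M : M * r1 ^ β = 1/2 := by
    rw [hr1, ← rpow_mul (by positivity), one_div_mul_cancel hβ0.ne', rpow_one]; field_simp
  set c0 : ℝ := cG n * (g0 * (1/2)^p * volume.real (ball (0 : EuclideanSpace ℝ (Fin n)) r1)) with hc0
  have hc0p : 0 < c0 := by
    have : 0 < volume.real (ball (0 : EuclideanSpace ℝ (Fin n)) r1) :=
      ENNReal.toReal_pos (measure_ball_pos _ _ hr1p).ne' measure_ball_lt_top.ne
    positivity
  set S0 : ℝ := (1 / c0) ^ (1 / p) with hS0
  have hS0p : 0 < S0 := by positivity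
  refine ⟨S0 * (1 + M), β, 1, by positivity, ⟨hβ0, hβ1⟩, one_pos, fun ε he he1 u hu => ?_⟩
  obtain ⟨u1, u2, u3, u4, u5, u6⟩ := hu
  obtain ⟨x0, hx0, hmax⟩ := hΩb.isCompact_closure.exists_isMaxOn hne.closure u1
  set S := u x0 with hS
  have hle : ∀ x ∈ closure Ω, u x ≤ S := fun x hx => hmax hx
  have hSp : 0 < S := by
    by_contra hcon
    push Not at hcon
    have h1 : ∫ x in Ω, u x ^ p ∂(gaussianMeasure n) = ∫ x in Ω, (0:ℝ) ∂(gaussianMeasure n) := by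
      refine setIntegral_congr_fun hΩo.measurableSet fun x hx => ?_
      have : u x = 0 := le_antisymm ((hle x (subset_closure hx)).trans hcon) (u3 x (subset_closure hx))
      simp only [this]; exact zero_rpow hp0.ne'
    rw [h1] at u5; simp at u5
  have hx0Ω : x0 ∈ Ω := by
    by_contra h
    have : x0 ∈ frontier Ω := ⟨hx0, by rwa [hΩo.interior_eq]⟩
    have := u4 x0 this
    linarith
  set v : EuclideanSpace ℝ (Fin n) → ℝ := Ω.indicator (fun x => S⁻¹ * u x) with hv
  set D : EuclideanSpace ℝ (Fin n) → EuclideanSpace ℝ (Fin n) := Ω.indicator (gradient v) with hD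
  have von : ∀ x ∈ Ω, v x = S⁻¹ * u x := fun x hx => indicator_of_mem hx _
  have voff : ∀ x, x ∉ Ω → v x = 0 := fun x hx => indicator_of_notMem hx _
  have vev : ∀ x ∈ Ω, v =ᶠ[𝓝 x] fun x => S⁻¹ * u x := fun x hx => by
    filter_upwards [hΩo.mem_nhds hx] with y hy using von y hy
  have hSi : 0 < S⁻¹ := inv_pos.2 hSp
  have d : Dat ε Ω v D := by
    refine ⟨hΩo, hΩb, ?_, ?_, ?_, voff, ?_, ?_, fun x hx => indicator_of_notMem hx _, he, he1.le⟩
    · exact continuous_indicator (fun x hx => by rw [u4 x hx, mul_zero]) (continuousOn_const.mul u1)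
    · intro x
      exact indicator_nonneg (fun x hx => mul_nonneg hSi.le (u3 x (subset_closure hx))) x
    · intro x
      by_cases hx : x ∈ Ω
      · rw [von x hx, inv_mul_le_iff₀ hSp, mul_one]; exact hle x (subset_closure hx)
      · rw [voff x hx]; exact zero_le_one
    · exact (contDiffOn_const.mul u2).congr von
    · intro x hx y
      rw [hD, indicator_of_mem hx, grad_inner]
  have PPu : ∀ x ∈ Ω, PP ε v D x = S⁻¹ * PP ε u (gradient u) x := by
    intro x hx
    rw [← PP_smul hSi.le x ((u2.contDiffAt (hΩo.mem_nhds hx)).differentiableAt (by norm_num))]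
    unfold PP
    rw [von x hx, hD, indicator_of_mem hx, norm_grad, norm_grad, (vev x hx).fderiv_eq]
  set lam := lambdaEps n p ε Ω with hlam
  have hl0 : 0 < lam := lam_pos hp hΩo hΩb hne he he1.le
  have hlΛ : lam ≤ Λ := hΛl ε he.le he1.le
  have eP : ∫ x, PP ε v D x ^ p ∂γ = S⁻¹ ^ p * lam := by
    rw [← u6, Jeps_eq he.le, ← integral_const_mul]
    refine setIntegral_congr_fun hΩo.measurableSet fun x hx => ?_
    beta_reduce
    rw [PPu x hx, mul_rpow hSi.le (PP_nonneg _ _ _ _)]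
  have ev : ∫ x, v x ^ p ∂γ = S⁻¹ ^ p := by
    rw [← mul_one (S⁻¹ ^ p), ← u5, ← integral_const_mul]
    refine setIntegral_congr_fun hΩo.measurableSet fun x hx => ?_
    beta_reduce
    rw [von x hx, mul_rpow hSi.le (u3 x (subset_closure hx))]
  have hiγ : Integrable (fun x => PP ε v D x ^ p) γ := by
    by_contra h
    rw [integral_undef h] at eP
    have : 0 < S⁻¹ ^ p * lam := by positivity
    linarith
  have heq : ∫ x, PP ε v D x ^ p ∂γ = lam * ∫ x, v x ^ p ∂γ := by rw [eP, ev, mul_comm]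
  have Poff : ∀ x, x ∉ Ω → PP ε v D x ^ p = 0 := fun x hx => by rw [d.PPoff hx, zero_rpow hp0.ne']
  have hi : Integrable (fun x => PP ε v D x ^ p) :=
    gm_integrable hΩo Poff (d.measP.pow_const p) hR hiγ
  have hw : ELw p lam ε Ω v D volume := by
    intro φ h1 h2 h3
    have := EL_eq hp d hiγ (fun ψ a b c => lam_min hp he.le ⟨a, b, c⟩) heq h1 h2 h3
    rw [hγ, gm_integral hΩo (fun x hx => by rw [(supp_fderiv h3 hx).1, (supp_fderiv h3 hx).2]; simp),
      gm_integral hΩo (fun x hx => by rw [(supp_fderiv h3 hx).1]; simp)] at this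
    refine mul_left_cancel₀ hcG.ne' ?_
    rw [this]; ring
  have vp1 : ∀ x, v x ^ p ≤ 1 := fun x => rpow_le_one (d.nn x) (d.le1 x) hp0.le
  have vp0 : ∀ x, 0 ≤ v x ^ p := fun x => rpow_nonneg (d.nn x) _
  have vpc : Continuous fun x => v x ^ p := d.cont.rpow_const fun x => Or.inr hp0.le
  have hen : ∫ x, PP ε v D x ^ p ≤ C2 := by
    have a1 : ∫ x, v x ^ p ∂γ ≤ γ.real univ := by
      have : ∫ x, v x ^ p ∂γ ≤ ∫ x, (1:ℝ) ∂γ :=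
        integral_mono_of_nonneg (Filter.Eventually.of_forall vp0) (integrable_const _) (Filter.Eventually.of_forall vp1)
      simpa using this
    have a2 : ∫ x, PP ε v D x ^ p ∂γ ≤ Λ * γ.real univ := by
      rw [heq]
      exact mul_le_mul hlΛ a1 (integral_nonneg vp0) hΛ
    rw [hγ, gm_integral hΩo Poff] at a2
    have i1 : Integrable (fun x => gg x * PP ε v D x ^ p) := by
      refine hi.mono' ((gg_cd.continuous.measurable.mul (d.measP.pow_const p)).aestronglyMeasurable) (Filter.Eventually.of_forall fun x => ?_)
      have h0 := rpow_nonneg (PP_nonneg ε v D x) p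
      rw [Real.norm_of_nonneg (mul_nonneg (gg_pos x).le h0)]
      nlinarith [gg_le x]
    have a3 : g0 * ∫ x, PP ε v D x ^ p ≤ ∫ x, gg x * PP ε v D x ^ p := by
      rw [← integral_const_mul]
      refine integral_mono (hi.const_mul _) i1 fun x => ?_
      beta_reduce
      by_cases hx : x ∈ Ω
      · exact mul_le_mul_of_nonneg_right (hgg x hx) (rpow_nonneg (PP_nonneg ε v D x) p)
      · rw [Poff x hx]; simp
    have a4 : (g0 * cG n) * ∫ x, PP ε v D x ^ p ≤ Λ * γ.real univ := by
      have := mul_le_mul_of_nonneg_left a3 hcG.le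
      rw [← hγ] at a2
      linarith
    have a5 : ∫ x, PP ε v D x ^ p ≤ (g0 * cG n)⁻¹ * (Λ * γ.real univ) := by
      rw [← div_eq_inv_mul, le_div_iff₀ (by positivity)]; linarith
    have a6 : 0 ≤ volume.real Ω := measureReal_nonneg
    linarith
  have hol := H ε lam v D d hi hw hl0.le hlΛ hen
  have vx0 : v x0 = 1 := by rw [von x0 hx0Ω]; exact inv_mul_cancel₀ hSp.ne'
  have vlow : ∀ x ∈ ball x0 r1, 1/2 ≤ v x := by
    intro x hx
    have h1 := hol x0 (x - x0)
    rw [add_sub_cancel, vx0] at h1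
    have h2 : ‖x - x0‖ ^ β ≤ r1 ^ β := rpow_le_rpow (norm_nonneg _) (by rw [← dist_eq_norm]; exact (mem_ball.1 hx).le) hβ0.le
    have h3 := mul_le_mul_of_nonneg_left h2 hM.le
    have h4 := (abs_le.1 h1).1
    linarith
  have bsub : ball x0 r1 ⊆ Ω := fun x hx => by
    by_contra h
    have := vlow x hx
    rw [voff x h] at this; linarith
  have low : c0 ≤ S⁻¹ ^ p := by
    rw [← ev, hγ, gm_integral hΩo (fun x hx => by rw [voff x hx, zero_rpow hp0.ne']), hc0]
    refine mul_le_mul_of_nonneg_left ?_ hcG.le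
    have i1 : Integrable (fun x => gg x * v x ^ p) := by
      refine (gg_cd.continuous.mul vpc).integrable_of_hasCompactSupport
        (HasCompactSupport.of_support_subset_isCompact hΩb.isCompact_closure (fun y hy => by
          by_contra h
          exact hy (by simp [voff y (fun h' => h (subset_closure h')), hp0.ne'])))
    have e1 : ∫ x, (ball x0 r1).indicator (fun _ => g0 * (1/2)^p) x =
        g0 * (1/2)^p * volume.real (ball (0 : EuclideanSpace ℝ (Fin n)) r1) := by
      rw [integral_indicator measurableSet_ball, setIntegral_const, smul_eq_mul, mul_comm]
      congr 1
      simp only [Measure.real]; rw [Measure.addHaar_ball_center]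
    rw [← e1]
    refine integral_mono ((integrable_indicator_iff measurableSet_ball).2 (integrableOn_const measure_ball_lt_top.ne)) i1 fun x => ?_
    beta_reduce
    by_cases hx : x ∈ ball x0 r1
    · rw [indicator_of_mem hx]
      exact mul_le_mul (hgg x (bsub hx)) (rpow_le_rpow (by norm_num) (vlow x hx) hp0.le) (by positivity) (gg_pos x).le
    · rw [indicator_of_notMem hx]; exact mul_nonneg (gg_pos x).le (vp0 x)
  have hSS : S ≤ S0 := by
    have h1 : S ^ p ≤ 1 / c0 := by
      rw [inv_rpow hSp.le] at low
      rw [le_div_iff₀ hc0p]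
      have h2 : 0 < S ^ p := by positivity
      calc S ^ p * c0 ≤ S ^ p * (S ^ p)⁻¹ := by gcongr
        _ = 1 := mul_inv_cancel₀ h2.ne'
    have := rpow_le_rpow (by positivity) h1 (show 0 ≤ 1 / p by positivity)
    rwa [← rpow_mul hSp.le, mul_one_div_cancel hp0.ne', rpow_one] at this
  have huv : ∀ x ∈ closure Ω, u x = S * v x := by
    intro x hx
    by_cases h : x ∈ Ω
    · rw [von x h, mul_inv_cancel_left₀ hSp.ne']
    · rw [voff x h, mul_zero]; exact u4 x ⟨hx, by rwa [hΩo.interior_eq]⟩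
  constructor
  · intro x hx
    rw [abs_of_nonneg (u3 x hx)]
    have := hle x hx
    have := mul_pos hS0p hM
    linarith
  · intro x hx y hy
    rw [huv x hx, huv y hy, ← mul_sub, abs_mul, abs_of_pos hSp, mul_assoc]
    have h1 := hol y (x - y)
    rw [add_sub_cancel] at h1
    have h2 : 0 ≤ ‖x - y‖ ^ β := by positivity
    refine mul_le_mul hSS (h1.trans ?_) (abs_nonneg _) hS0p.le
    nlinarith
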